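/- Let q ≥ 7 be a prime power and G = PSL_2(q). For a prime p dividing |G|, G has property (I_p) with respect to a subgroup H if and only if one of the following holds: (1) p is odd, p ∣ q+1, and H is a Borel subgroup B (the stabilizer of a point of the projective line over F_q, of order q(q−1)/gcd(2,q−1)), with |G:H| = q+1; (2) q = 2^f and p = 2^f − 1 is a (Mersenne) prime, and H is dihedral of order 2(q+1), with |G:H| = q(q−1)/2; (3) p = 2, q is odd, and H is the subgroup O^2(B) of a Borel subgroup B (the smallest normal subgroup of B with 2-group quotient), of odd order q·(q−1)_{2'}, with |G:H| = (q−1)_2·(q+1)/2; (4) q = 7, p = 7, and H is isomorphic to the symmetric group S_4, with |G:H| = 7; (5) q = 11, p = 11, and H is isomorphic to the alternating group A_5, with |G:H| = 11; (6) p = 2, q is even, and H is cyclic of order q+1, with |G:H| = q(q−1). -/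

import Mathlib

/-- A module is indecomposable if it is nonzero and admits no nontrivial direct sum
decomposition. -/
def IsIndecomposableModule (R M : Type*) [Ring R] [AddCommMonoid M] [Module R M] : Prop :=
  Nontrivial M ∧ ∀ N N' : Submodule R M, IsCompl N N' → N = ⊥ ∨ N' = ⊥

/-- The permutation module `k[G/H]`, as a module over the group algebra `k[G]`. -/
abbrev PermMod (k : Type*) [Field k] {G : Type*} [Group G] (H : Subgroup G) :=
  (Representation.ofMulAction k G (G ⧸ H)).asModule

/-- A finite group `G` has property `(I_p)` with respect to a subgroup `H` if `H` is a
`p'`-subgroup and the permutation module `k[G/H]` is indecomposable (equivalently, it is the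
projective cover of the trivial `k[G]`-module). -/
def HasIp (k : Type*) [Field k] {G : Type*} [Group G] (p : ℕ) (H : Subgroup G) : Prop :=
  ¬ (p ∣ Nat.card H) ∧ IsIndecomposableModule (MonoidAlgebra k G) (PermMod k H)

open Matrix

variable (F : Type) [Field F]

/-- The upper-triangular Borel subgroup of `SL_2(F)`. -/
def slBorel : Subgroup (Matrix.SpecialLinearGroup (Fin 2) F) where
  carrier := {A | (A : Matrix (Fin 2) (Fin 2) F) 1 0 = 0}
  one_mem' := by
    simp [Matrix.SpecialLinearGroup.coe_one, Matrix.one_apply_ne]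
  mul_mem' := by
    intro A B hA hB
    simp only [Set.mem_setOf_eq] at *
    rw [Matrix.SpecialLinearGroup.coe_mul, Matrix.mul_apply, Fin.sum_univ_two, hA, hB]
    ring
  inv_mem' := by
    intro A hA
    simp only [Set.mem_setOf_eq] at *
    rw [Matrix.SpecialLinearGroup.coe_inv, Matrix.adjugate_fin_two]
    simp [hA]

/-- The projective special linear group `PSL_2(F)`. -/
abbrev PSL2 :=
  Matrix.SpecialLinearGroup (Fin 2) F ⧸ Subgroup.center (Matrix.SpecialLinearGroup (Fin 2) F)

/-- The standard Borel subgroup of `PSL_2(F)`, i.e. the stabilizer of the point `[1:0]` of the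
projective line; every point stabilizer (Borel subgroup) is a conjugate of it. -/
def pslBorel : Subgroup (PSL2 F) :=
  (slBorel F).map (QuotientGroup.mk' (Subgroup.center (Matrix.SpecialLinearGroup (Fin 2) F)))

/-- `O^p(B)`: for a finite group `B`, the smallest normal subgroup of `B` with `p`-group
quotient, i.e. the subgroup generated by all elements of order prime to `p`. -/
def Op (p : ℕ) (B : Type*) [Group B] : Subgroup B :=
  Subgroup.closure {b : B | ¬ p ∣ orderOf b}

namespace Ip

section Generic

variable {k : Type*} [Field k] {G : Type*} [Group G] [Finite G]

/-- A space of functions on a `G`-set stable under translation. -/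
def Stab (G : Type*) [Group G] {X : Type*} [MulAction G X] (N : Submodule k (X → k)) : Prop :=
  ∀ g : G, ∀ f ∈ N, (fun x => f (g • x)) ∈ N

/-- The permutation module as a space of functions. -/
noncomputable def permEquiv (H : Subgroup G) : PermMod k H ≃ₗ[k] (G ⧸ H → k) :=
  (Representation.asModuleEquiv _).trans
    ((MonoidAlgebra.coeffLinearEquiv k).trans (Finsupp.linearEquivFunOnFinite k k (G ⧸ H)))

lemma permEquiv_single_smul (H : Subgroup G) (g : G) (t : k) (m : PermMod k H) (x : G ⧸ H) :
    permEquiv H (MonoidAlgebra.single g t • m) x = t * permEquiv H m (g⁻¹ • x) := by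
  have h := Representation.single_smul (ρ := Representation.ofMulAction k G (G ⧸ H)) t g m
  rw [h]
  have h2 : ∀ m' : MonoidAlgebra k (G ⧸ H), ((t • m' : MonoidAlgebra k (G ⧸ H)).coeff x)
    = t * m'.coeff x := fun m' => rfl
  refine (h2 _).trans ?_
  congr 1
  exact Representation.coeff_ofMulAction g _ x

/-- Stable function spaces as submodules. -/
noncomputable def toSub (H : Subgroup G) (N : Submodule k (G ⧸ H → k)) (hN : Stab G N) :
    Submodule (MonoidAlgebra k G) (PermMod k H) where
  carrier := {m | permEquiv H m ∈ N}
  add_mem' := by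
    intro a b ha hb
    simpa using! N.add_mem ha hb
  zero_mem' := by simp
  smul_mem' := by
    intro c m hm
    induction c using MonoidAlgebra.induction_linear with
    | zero => simp
    | add f g hf hg =>
      rw [add_smul]
      simpa using! N.add_mem hf hg
    | single g t =>
      have : permEquiv H (MonoidAlgebra.single g t • m)
          = t • (fun x => permEquiv H m (g⁻¹ • x)) := by
        ext x; rw [permEquiv_single_smul]; rfl
      change permEquiv H (MonoidAlgebra.single g t • m) ∈ N
      rw [this]
      exact N.smul_mem _ (hN _ _ hm)

lemma mem_toSub (H : Subgroup G) (N : Submodule k (G ⧸ H → k)) (hN : Stab G N) (m) :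
    m ∈ toSub H N hN ↔ permEquiv H m ∈ N := Iff.rfl

/-- Submodules as stable function spaces. -/
noncomputable def ofSub (H : Subgroup G) (M : Submodule (MonoidAlgebra k G) (PermMod k H)) :
    Submodule k (G ⧸ H → k) where
  carrier := {f | (permEquiv H).symm f ∈ M}
  add_mem' := by
    intro a b ha hb
    simpa using! M.add_mem ha hb
  zero_mem' := by simp
  smul_mem' := by
    intro c f hf
    change (permEquiv H).symm (c • f) ∈ M
    rw [map_smul, ← algebraMap_smul (MonoidAlgebra k G)]
    exact M.smul_mem _ hf

lemma mem_ofSub (H : Subgroup G) (M : Submodule (MonoidAlgebra k G) (PermMod k H)) (f) :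
    f ∈ ofSub H M ↔ (permEquiv H).symm f ∈ M := Iff.rfl

lemma stab_ofSub (H : Subgroup G) (M : Submodule (MonoidAlgebra k G) (PermMod k H)) :
    Stab G (ofSub H M) := by
  intro g f hf
  rw [mem_ofSub] at hf ⊢
  have : (permEquiv H).symm (fun x => f (g • x))
      = MonoidAlgebra.single g⁻¹ (1 : k) • (permEquiv H).symm f := by
    apply (permEquiv H).injective
    ext x
    rw [permEquiv_single_smul]
    simp
  rw [this]
  exact M.smul_mem _ hf

lemma indec_iff (H : Subgroup G) :
    IsIndecomposableModule (MonoidAlgebra k G) (PermMod k H) ↔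
    ∀ N N' : Submodule k (G ⧸ H → k), Stab G N → Stab G N' → IsCompl N N' → N = ⊥ ∨ N' = ⊥ := by
  constructor
  · rintro ⟨-, h⟩ N N' hN hN' hc
    have hc' : IsCompl (toSub H N hN) (toSub H N' hN') := by
      constructor
      · rw [Submodule.disjoint_def]
        intro x hx hx'
        have := (Submodule.disjoint_def.1 hc.1) _ hx hx'
        simpa using this
      · rw [codisjoint_iff, eq_top_iff]
        intro x _
        have hx : permEquiv H x ∈ N ⊔ N' := by
          rw [codisjoint_iff.1 hc.2]; trivial
        obtain ⟨y, hy, z, hz, hyz⟩ := Submodule.mem_sup.1 hx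
        refine Submodule.mem_sup.2 ⟨(permEquiv H).symm y, by simpa [mem_toSub] using hy,
          (permEquiv H).symm z, by simpa [mem_toSub] using hz, ?_⟩
        rw [← map_add, hyz]; simp
    have key : ∀ (N : Submodule k (G ⧸ H → k)) (hN : Stab G N), toSub H N hN = ⊥ → N = ⊥ := by
      intro N hN hb
      rw [Submodule.eq_bot_iff] at hb ⊢
      intro x hx
      have := hb ((permEquiv H).symm x) (by simpa [mem_toSub] using hx)
      simpa using this
    rcases h _ _ hc' with h1 | h1
    · exact Or.inl (key _ _ h1)
    · exact Or.inr (key _ _ h1)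
  · intro h
    refine ⟨(permEquiv H).toEquiv.nontrivial, ?_⟩
    intro M M' hc
    have hc' : IsCompl (ofSub H M) (ofSub H M') := by
      constructor
      · rw [Submodule.disjoint_def]
        intro x hx hx'
        have := (Submodule.disjoint_def.1 hc.1) _ hx hx'
        simpa using this
      · rw [codisjoint_iff, eq_top_iff]
        intro x _
        have hx : (permEquiv H).symm x ∈ M ⊔ M' := by
          rw [codisjoint_iff.1 hc.2]; trivial
        obtain ⟨y, hy, z, hz, hyz⟩ := Submodule.mem_sup.1 hx
        refine Submodule.mem_sup.2 ⟨(permEquiv H) y, by simpa [mem_ofSub] using hy,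
          (permEquiv H) z, by simpa [mem_ofSub] using hz, ?_⟩
        rw [← map_add, hyz]; simp
    have key : ∀ (M : Submodule (MonoidAlgebra k G) (PermMod k H)), ofSub H M = ⊥ → M = ⊥ := by
      intro M hb
      rw [Submodule.eq_bot_iff] at hb ⊢
      intro x hx
      have := hb (permEquiv H x) (by simpa [mem_ofSub] using hx)
      simpa using this
    rcases h _ _ (stab_ofSub H M) (stab_ofSub H M') hc' with h1 | h1
    · exact Or.inl (key _ h1)
    · exact Or.inr (key _ h1)

/-- Equivariance of a linear map between function spaces. -/
def Equi (G : Type*) [Group G] {X Y : Type*} [MulAction G X] [MulAction G Y]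
    (φ : (X → k) →ₗ[k] (Y → k)) : Prop :=
  ∀ (g : G) (f : X → k) (y : Y), φ (fun x => f (g • x)) y = φ f (g • y)

lemma core {p : ℕ} {H : Subgroup G} [Fintype (G ⧸ H)] (hH : HasIp k p H)
    (φ : (G ⧸ H → k) →ₗ[k] (G ⧸ H → k)) (hφ : Equi G φ)
    (haug : ∀ f, ∑ x, φ f x = ∑ x, f x) : Function.Bijective φ := by
  classical
  have hpow : ∀ n : ℕ, Equi G (φ ^ n) := by
    intro n
    induction n with
    | zero => intro g f y; simp
    | succ n ih =>
      intro g f y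
      rw [pow_succ, Module.End.mul_apply, Module.End.mul_apply]
      have : φ (fun x => f (g • x)) = fun x => φ f (g • x) := by
        ext y; exact hφ g f y
      rw [this, ih]
  have haugpow : ∀ n : ℕ, ∀ f, ∑ x, (φ ^ n) f x = ∑ x, f x := by
    intro n
    induction n with
    | zero => intro f; simp
    | succ n ih =>
      intro f
      rw [pow_succ, Module.End.mul_apply, ih, haug]
  obtain ⟨n, hn⟩ := ((φ.eventually_isCompl_ker_pow_range_pow).and
    (Filter.eventually_ge_atTop 1)).exists
  obtain ⟨hc, hn1⟩ := hn
  have h1 : Stab G (LinearMap.ker (φ ^ n)) := by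
    intro g f hf
    rw [LinearMap.mem_ker] at hf ⊢
    ext y
    rw [hpow n g f y, hf]; rfl
  have h2 : Stab G (LinearMap.range (φ ^ n)) := by
    rintro g _ ⟨f, rfl⟩
    exact ⟨fun x => f (g • x), by ext y; rw [hpow n g f y]⟩
  have hinj : LinearMap.ker (φ ^ n) = ⊥ := by
    rcases (indec_iff H).1 hH.2 _ _ h1 h2 hc with h | h
    · exact h
    · exfalso
      rw [LinearMap.range_eq_bot] at h
      have := haugpow n (Pi.single (QuotientGroup.mk 1) 1)
      rw [h] at this
      simp at this
  have hinj' : Function.Injective φ := by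
    have h3 : Function.Injective (φ ^ n) := LinearMap.ker_eq_bot.1 hinj
    obtain ⟨m, rfl⟩ : ∃ m, n = m + 1 := ⟨n - 1, by omega⟩
    rw [pow_succ] at h3
    exact Function.Injective.of_comp (f := (φ ^ m)) h3
  exact ⟨hinj', LinearMap.injective_iff_surjective.1 hinj'⟩

/-- The equivariant map determined by an `H`-invariant function. -/
noncomputable def indMap (H : Subgroup G) [Fintype (G ⧸ H)] {Y : Type*} [MulAction G Y]
    (a : Y → k) :
    (G ⧸ H → k) →ₗ[k] (Y → k) where
  toFun f := fun y => ∑ x, f x * a ((Quotient.out x)⁻¹ • y)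
  map_add' := by
    intro f g; ext y; simp [add_mul, Finset.sum_add_distrib]
  map_smul' := by
    intro c f; ext y; simp [Finset.mul_sum, mul_assoc]

lemma inv_out {Y : Type*} [MulAction G Y] {H : Subgroup G} {a : Y → k}
    (ha : ∀ h ∈ H, ∀ y, a (h • y) = a y) (g g' : G) (hg : (g : G ⧸ H) = g') (y : Y) :
    a (g⁻¹ • y) = a (g'⁻¹ • y) := by
  have : g⁻¹ * g' ∈ H := QuotientGroup.eq.1 hg
  rw [← ha _ this (g'⁻¹ • y)]
  congr 1
  rw [smul_smul]; congr 1; group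

lemma indMap_equi (H : Subgroup G) [Fintype (G ⧸ H)] {Y : Type*} [MulAction G Y]
    (a : Y → k) (ha : ∀ h ∈ H, ∀ y, a (h • y) = a y) : Equi G (indMap H a) := by
  intro g f y
  simp only [indMap, LinearMap.coe_mk, AddHom.coe_mk]
  refine Fintype.sum_equiv (MulAction.toPerm g) _ _ ?_
  intro x
  simp only [MulAction.toPerm_apply]
  congr 1
  have h1 : ((g * Quotient.out x : G) : G ⧸ H) = (Quotient.out (g • x) : G) := by
    rw [QuotientGroup.out_eq']
    conv_rhs => rw [← QuotientGroup.out_eq' x]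
    rfl
  rw [← inv_out ha _ _ h1, smul_smul]
  congr 2
  group

lemma indMap_aug (H : Subgroup G) [Fintype (G ⧸ H)] {Y : Type*} [MulAction G Y] [Fintype Y]
    (a : Y → k) (f : G ⧸ H → k) : ∑ y, indMap H a f y = (∑ x, f x) * ∑ y, a y := by
  simp only [indMap, LinearMap.coe_mk, AddHom.coe_mk]
  rw [Finset.sum_comm, Finset.sum_mul]
  refine Finset.sum_congr rfl fun x _ => ?_
  rw [← Finset.mul_sum]
  congr 1
  exact Fintype.sum_equiv (MulAction.toPerm (Quotient.out x)⁻¹) _ _ (fun _ => rfl)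

/-- averaging -/
lemma exists_avg {p : ℕ} [CharP k p] {H : Subgroup G} (hp : ¬ p ∣ Nat.card H) {Y : Type*}
    [MulAction G Y] [Fintype Y] (N : Submodule k (Y → k)) (hN : Stab G N)
    (r : Y → k) (hr : r ∈ N) (haug : ∑ y, r y ≠ 0) :
    ∃ r' ∈ N, (∀ h ∈ H, ∀ y, r' (h • y) = r' y) ∧ ∑ y, r' y = 1 := by
  classical
  have : Fintype H := Fintype.ofFinite _
  set s := ∑ y, r y with hs
  have hc : (Fintype.card H : k) ≠ 0 := by
    rw [Ne, CharP.cast_eq_zero_iff k p, ← Nat.card_eq_fintype_card]; exact hp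
  refine ⟨(Fintype.card H * s : k)⁻¹ • ∑ h : H, (fun y => r ((h : G) • y)), ?_, ?_, ?_⟩
  · exact N.smul_mem _ (N.sum_mem fun h _ => hN _ _ hr)
  · intro h hh y
    simp only [Pi.smul_apply, Finset.sum_apply]
    congr 1
    refine Fintype.sum_equiv (Equiv.mulRight ⟨h, hh⟩) _ _ ?_
    intro x
    simp [mul_smul]
  · simp only [Pi.smul_apply, Finset.sum_apply, smul_eq_mul]
    rw [← Finset.mul_sum, Finset.sum_comm]
    have : ∀ h : H, ∑ y, r ((h : G) • y) = s := fun h =>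
      Fintype.sum_equiv (MulAction.toPerm (h : G)) _ _ (fun _ => rfl)
    simp only [this, Finset.sum_const, Finset.card_univ, nsmul_eq_mul]
    exact inv_mul_cancel₀ (mul_ne_zero hc haug)

/-- Tool T1. -/
lemma exists_functional {p : ℕ} [CharP k p] {H : Subgroup G} (hH : HasIp k p H)
    {W : Type*} [AddCommGroup W] [Module k W] (v : G ⧸ H → W) (ρ : G → (W →ₗ[k] W))
    (hv : ∀ g x, v (g • x) = ρ g (v x)) (x0 : G ⧸ H) (hx0 : v x0 ≠ 0) :
    ∃ l : W →ₗ[k] k, ∀ x, l (v x) = 1 := by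
  classical
  have : Fintype (G ⧸ H) := Fintype.ofFinite _
  let A : (G ⧸ H → k) →ₗ[k] W :=
    { toFun := fun f => ∑ x, f x • v x
      map_add' := by intro f g; simp [add_smul, Finset.sum_add_distrib]
      map_smul' := by intro c f; simp [Finset.smul_sum, mul_smul] }
  have hA : ∀ f, A f = ∑ x, f x • v x := fun _ => rfl
  have hAs : ∀ x, A (Pi.single x 1) = v x := by
    intro x; rw [hA]; simp [Pi.single_apply]
  let aug : (G ⧸ H → k) →ₗ[k] k :=
    { toFun := fun f => ∑ x, f x
      map_add' := by intro f g; simp [Finset.sum_add_distrib]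
      map_smul' := by intro c f; simp [Finset.mul_sum] }
  have haug : ∀ f, aug f = ∑ x, f x := fun _ => rfl
  by_cases hker : LinearMap.ker A ≤ LinearMap.ker aug
  · have : aug ∈ LinearMap.range A.dualMap := by
      rw [LinearMap.range_dualMap_eq_dualAnnihilator_ker, Submodule.mem_dualAnnihilator]
      intro w hw
      exact hker hw
    obtain ⟨l, hl⟩ := this
    refine ⟨l, fun x => ?_⟩
    have := LinearMap.congr_fun hl (Pi.single x 1)
    rw [LinearMap.dualMap_apply, hAs] at this
    rw [this, haug]
    simp
  · exfalso
    obtain ⟨r, hr, hr2⟩ := SetLike.not_le_iff_exists.1 hker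
    have hst : Stab G (LinearMap.ker A) := by
      intro g f hf
      rw [LinearMap.mem_ker] at hf ⊢
      have : A (fun x => f (g • x)) = ρ g⁻¹ (A f) := by
        rw [hA, hA, map_sum]
        refine Fintype.sum_equiv (MulAction.toPerm g) _ _ ?_
        intro x
        simp only [MulAction.toPerm_apply]
        rw [map_smul, ← hv, inv_smul_smul]
      rw [this, hf, map_zero]
    obtain ⟨r', hr', hinv, hsum⟩ := exists_avg hH.1 _ hst r hr
      (by rw [LinearMap.mem_ker, haug] at hr2; exact hr2)
    have hb := core hH (indMap H r') (indMap_equi H r' hinv)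
      (by intro f; rw [indMap_aug, hsum, mul_one])
    have hz : ∀ f, A (indMap H r' f) = 0 := by
      intro f
      have : indMap H r' f = ∑ x : G ⧸ H, f x • (fun y => r' ((Quotient.out x)⁻¹ • y)) := by
        ext y; simp [indMap]
      rw [this, ← LinearMap.mem_ker]
      exact Submodule.sum_mem _ fun x _ => Submodule.smul_mem _ _ (hst _ _ hr')
    obtain ⟨f, hf⟩ := hb.2 (Pi.single x0 1)
    have := hz f
    rw [hf, hAs] at this
    exact hx0 this

/-- Tool T2. -/
lemma exists_maps {p : ℕ} [CharP k p] {H L : Subgroup G} [Fintype (G ⧸ H)] [Fintype (G ⧸ L)]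
    (hH : HasIp k p H) (hL : ¬ p ∣ Nat.card L) :
    ∃ (α : (G ⧸ H → k) →ₗ[k] (G ⧸ L → k)) (β : (G ⧸ L → k) →ₗ[k] (G ⧸ H → k)),
      Equi G α ∧ Equi G β ∧ Function.Injective α ∧ Function.Surjective β := by
  classical
  obtain ⟨a, -, ha, ha1⟩ := exists_avg (k := k) hH.1 (⊤ : Submodule k (G ⧸ L → k))
    (fun _ _ _ => trivial) (Pi.single (QuotientGroup.mk 1) 1) trivial (by simp)
  obtain ⟨b, -, hb, hb1⟩ := exists_avg (k := k) hL (⊤ : Submodule k (G ⧸ H → k))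
    (fun _ _ _ => trivial) (Pi.single (QuotientGroup.mk 1) 1) trivial (by simp)
  have h1 := indMap_equi H a ha
  have h2 := indMap_equi L b hb
  have hbij := core hH ((indMap L b).comp (indMap H a))
    (by
      intro g f y
      simp only [LinearMap.comp_apply]
      rw [← h2]
      have : indMap H a (fun x => f (g • x)) = fun x => indMap H a f (g • x) := by
        ext z
        exact h1 g f z
      rw [this])
    (by intro f; simp only [LinearMap.comp_apply]; rw [indMap_aug, indMap_aug, ha1, hb1]; ring)
  refine ⟨indMap H a, indMap L b, h1, h2, ?_, ?_⟩
  · exact Function.Injective.of_comp (f := indMap L b) hbij.1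
  · exact Function.Surjective.of_comp (g := indMap H a) hbij.2

lemma index_le {p : ℕ} [CharP k p] {H L : Subgroup G}
    (hH : HasIp k p H) (hL : ¬ p ∣ Nat.card L) : H.index ≤ L.index := by
  classical
  have : Fintype (G ⧸ H) := Fintype.ofFinite _
  have : Fintype (G ⧸ L) := Fintype.ofFinite _
  obtain ⟨α, β, -, -, h, -⟩ := exists_maps hH hL
  have := LinearMap.finrank_le_finrank_of_injective h
  simpa [Subgroup.index, Nat.card_eq_fintype_card] using this

lemma card_le {p : ℕ} [CharP k p] {H L : Subgroup G}
    (hH : HasIp k p H) (hL : ¬ p ∣ Nat.card L) : Nat.card L ≤ Nat.card H := by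
  have h := index_le hH hL
  have h1 := H.index_mul_card
  have h2 := L.index_mul_card
  have h3 : 0 < L.index := Nat.pos_of_ne_zero L.index_ne_zero_of_finite
  by_contra hlt
  push Not at hlt
  have : H.index * Nat.card H < L.index * Nat.card L := by
    calc H.index * Nat.card H ≤ L.index * Nat.card H := Nat.mul_le_mul_right _ h
      _ < _ := Nat.mul_lt_mul_of_pos_left hlt h3
  omega

lemma hasIp_of_card_eq {p : ℕ} [CharP k p] {H L : Subgroup G}
    (hH : HasIp k p H) (hc : Nat.card L = Nat.card H) : HasIp k p L := by
  classical
  have : Fintype (G ⧸ H) := Fintype.ofFinite _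
  have : Fintype (G ⧸ L) := Fintype.ofFinite _
  have hL : ¬ p ∣ Nat.card L := hc ▸ hH.1
  refine ⟨hL, ?_⟩
  obtain ⟨α, β, hα, -, hinj, -⟩ := exists_maps hH hL
  have hidx : H.index = L.index := by
    have h1 := H.index_mul_card
    have h2 := L.index_mul_card
    rw [hc, ← h1] at h2
    exact (Nat.eq_of_mul_eq_mul_right Nat.card_pos h2).symm
  have hfr : Module.finrank k (G ⧸ H → k) = Module.finrank k (G ⧸ L → k) := by
    simpa [Subgroup.index, Nat.card_eq_fintype_card] using hidx
  have hsurj : Function.Surjective α :=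
    (LinearMap.injective_iff_surjective_of_finrank_eq_finrank hfr).1 hinj
  rw [indec_iff]
  intro N N' hN hN' hcompl
  let e := LinearEquiv.ofBijective α ⟨hinj, hsurj⟩
  have hst : ∀ N : Submodule k (G ⧸ L → k), Stab G N → Stab G (N.comap α) := by
    intro N hN g f hf
    rw [Submodule.mem_comap] at hf ⊢
    have : α (fun x => f (g • x)) = fun x => α f (g • x) := by ext y; exact hα g f y
    rw [this]; exact hN _ _ hf
  have hc2 : IsCompl (N.comap α) (N'.comap α) := by
    have := (Submodule.orderIsoMapComap e).symm.isCompl hcompl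
    simpa using! this
  have key : ∀ N : Submodule k (G ⧸ L → k), N.comap α = ⊥ → N = ⊥ := by
    intro N h
    rw [Submodule.eq_bot_iff] at h ⊢
    intro x hx
    obtain ⟨y, rfl⟩ := hsurj x
    rw [h y hx, map_zero]
  rcases (indec_iff H).1 hH.2 _ _ (hst N hN) (hst N' hN') hc2 with h | h
  · exact Or.inl (key _ h)
  · exact Or.inr (key _ h)

/-- Criterion for property `(I_p)`, in terms of functions on a group `S` mapping onto `G`. -/
lemma hasIp_of_const {S : Type*} [Group S] (π : S →* G) (hπ : Function.Surjective π)
    {p : ℕ} {H : Subgroup G} (hp : ¬ p ∣ Nat.card H)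
    (h : ∀ N : Submodule k (S → k), N ≠ ⊥ → (∀ s : S, ∀ f ∈ N, (fun x => f (s * x)) ∈ N) →
      (∀ f ∈ N, ∀ s h : S, π h ∈ H → f (s * h) = f s) → (fun _ => 1) ∈ N) : HasIp k p H := by
  refine ⟨hp, ?_⟩
  rw [indec_iff]
  let P : (G ⧸ H → k) →ₗ[k] (S → k) := LinearMap.funLeft k k (fun s => (π s : G ⧸ H))
  have hP : ∀ f s, P f s = f (π s : G ⧸ H) := fun _ _ => rfl
  have key : ∀ N : Submodule k (G ⧸ H → k), Stab G N → N ≠ ⊥ → (fun _ => 1) ∈ N := by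
    intro N hN hne
    have hinj : Function.Injective P := by
      apply LinearMap.funLeft_injective_of_surjective
      intro x
      obtain ⟨g, rfl⟩ := QuotientGroup.mk_surjective x
      obtain ⟨s, rfl⟩ := hπ g
      exact ⟨s, rfl⟩
    have := h (N.map P) ?_ ?_ ?_
    · obtain ⟨f, hf, hf1⟩ := this
      have : f = fun _ => 1 := by
        apply hinj
        rw [hf1]; rfl
      exact this ▸ hf
    · intro hb
      apply hne
      rw [Submodule.eq_bot_iff] at hb ⊢
      intro x hx
      have := hb (P x) (Submodule.mem_map_of_mem hx)
      exact hinj (by rw [this, map_zero])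
    · rintro s _ ⟨f, hf, rfl⟩
      refine ⟨fun x => f (π s • x), hN _ _ hf, ?_⟩
      ext x
      simp only [hP, map_mul]
      rfl
    · rintro _ ⟨f, hf, rfl⟩ s t ht
      rw [hP, hP]
      congr 1
      rw [map_mul]
      exact QuotientGroup.mk_mul_of_mem _ ht
  intro N N' hN hN' hc
  by_contra hcon
  push Not at hcon
  have h1 := key N hN hcon.1
  have h2 := key N' hN' hcon.2
  have := Submodule.disjoint_def.1 hc.1 _ h1 h2
  have := congrFun this (QuotientGroup.mk 1)
  simp at this

end Generic

/-- A `p`-group acting on a vector space of characteristic `p` has nonzero fixed vectors. -/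
lemma exists_fixed_aux {p : ℕ} [Fact p.Prime] {P : Type*} [Group P] [Finite P] (hP : IsPGroup p P)
    {W : Type*} [AddCommGroup W] [DistribMulAction P W] [Module (ZMod p) W]
    (w : W) (hw : w ≠ 0) :
    ∃ w' ∈ AddSubgroup.closure (MulAction.orbit P w), w' ≠ 0 ∧ ∀ g : P, g • w' = w' := by
  classical
  let M : Submodule (ZMod p) W := Submodule.span (ZMod p) (MulAction.orbit P w)
  have hfin : (MulAction.orbit P w).Finite := Set.finite_range _
  have hfd := Module.Finite.span_of_finite (ZMod p) hfin
  have hMf : Finite (Submodule.span (ZMod p) (MulAction.orbit P w)) :=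
    Module.finite_of_finite (ZMod p)
  have hMc : M.toAddSubgroup = AddSubgroup.closure (MulAction.orbit P w) := by
    apply le_antisymm
    · intro x hx
      change x ∈ Submodule.span (ZMod p) (MulAction.orbit P w) at hx
      induction hx using Submodule.span_induction with
      | mem x h => exact AddSubgroup.subset_closure h
      | zero => exact zero_mem _
      | add x y _ _ h1 h2 => exact add_mem h1 h2
      | smul a x _ h =>
        have : a • x = a.val • x := by
          conv_lhs => rw [← ZMod.natCast_zmod_val a]
          rw [Nat.cast_smul_eq_nsmul]
        rw [this]
        exact AddSubgroup.nsmul_mem _ h _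
    · rw [AddSubgroup.closure_le]
      exact Submodule.subset_span
  have hstab : ∀ (g : P) (x : W), x ∈ M.toAddSubgroup → g • x ∈ M.toAddSubgroup := by
    intro g x hx
    rw [hMc] at hx ⊢
    induction hx using AddSubgroup.closure_induction with
    | mem x h =>
      apply AddSubgroup.subset_closure
      obtain ⟨h', rfl⟩ := h
      exact ⟨g * h', mul_smul g h' w⟩
    | zero => rw [smul_zero]; exact zero_mem _
    | add x y _ _ h1 h2 => rw [smul_add]; exact add_mem h1 h2
    | neg x _ h => rw [smul_neg]; exact neg_mem h
  letI : MulAction P M :=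
    { smul := fun g x => ⟨g • (x : W), hstab g x x.2⟩
      one_smul := fun x => Subtype.ext (one_smul P (x : W))
      mul_smul := fun g h x => Subtype.ext (mul_smul g h (x : W)) }
  have hcoe : ∀ (g : P) (x : M), ((g • x : M) : W) = g • (x : W) := fun _ _ => rfl
  have hwM : w ∈ M := Submodule.subset_span (MulAction.mem_orbit_self w)
  have hdvd : p ∣ Nat.card M := by
    rw [Module.natCard_eq_pow_finrank (K := ZMod p), Nat.card_zmod]
    apply dvd_pow_self
    intro h0
    have := (Module.finrank_zero_iff.1 h0).elim (⟨w, hwM⟩ : M) 0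
    exact hw (congrArg Subtype.val this)
  obtain ⟨b, hb, hb0⟩ := hP.exists_fixed_point_of_prime_dvd_card_of_fixed_point M hdvd
    (a := 0) (by intro g; apply Subtype.ext; rw [hcoe]; simp)
  refine ⟨b, hMc ▸ b.2, ?_, ?_⟩
  · intro h; exact hb0 (Subtype.ext h).symm
  · intro g
    have := hb g
    rw [← hcoe, this]

lemma exists_fixed {p : ℕ} [Fact p.Prime] {P : Type*} [Group P] [Finite P] (hP : IsPGroup p P)
    {W : Type*} [AddCommGroup W] [DistribMulAction P W] (hW : ∀ w : W, p • w = 0)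
    (w : W) (hw : w ≠ 0) :
    ∃ w' ∈ AddSubgroup.closure (MulAction.orbit P w), w' ≠ 0 ∧ ∀ g : P, g • w' = w' :=
  @exists_fixed_aux p _ P _ _ hP W _ _ (AddCommGroup.zmodModule hW) w hw

end Ip
namespace Ip

/-- `SL_2(F)`. -/
abbrev SL := Matrix.SpecialLinearGroup (Fin 2) F

/-- projection to `PSL_2(F)`. -/
abbrev pr : SL F →* PSL2 F := QuotientGroup.mk' (Subgroup.center (SL F))

section Basic

variable {F}

lemma det1 (s : SL F) : s 0 0 * s 1 1 - s 0 1 * s 1 0 = 1 := by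
  have := s.2
  rwa [Matrix.det_fin_two] at this

lemma sl_ext {s t : SL F} (h00 : s 0 0 = t 0 0) (h01 : s 0 1 = t 0 1) (h10 : s 1 0 = t 1 0)
    (h11 : s 1 1 = t 1 1) : s = t := by
  apply Subtype.ext
  ext i j
  fin_cases i <;> fin_cases j <;> assumption

/-- constructor -/
def mk4 (a b c d : F) (h : a * d - b * c = 1) : SL F :=
  ⟨!![a, b; c, d], by rw [Matrix.det_fin_two_of]; exact h⟩

@[simp] lemma mk4_00 (a b c d : F) (h) : (mk4 a b c d h) 0 0 = a := rfl
@[simp] lemma mk4_01 (a b c d : F) (h) : (mk4 a b c d h) 0 1 = b := rfl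
@[simp] lemma mk4_10 (a b c d : F) (h) : (mk4 a b c d h) 1 0 = c := rfl
@[simp] lemma mk4_11 (a b c d : F) (h) : (mk4 a b c d h) 1 1 = d := rfl

lemma mul00 (s t : SL F) : (s * t) 0 0 = s 0 0 * t 0 0 + s 0 1 * t 1 0 := by
  simp [Matrix.mul_apply, Fin.sum_univ_two]
lemma mul01 (s t : SL F) : (s * t) 0 1 = s 0 0 * t 0 1 + s 0 1 * t 1 1 := by
  simp [Matrix.mul_apply, Fin.sum_univ_two]
lemma mul10 (s t : SL F) : (s * t) 1 0 = s 1 0 * t 0 0 + s 1 1 * t 1 0 := by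
  simp [Matrix.mul_apply, Fin.sum_univ_two]
lemma mul11 (s t : SL F) : (s * t) 1 1 = s 1 0 * t 0 1 + s 1 1 * t 1 1 := by
  simp [Matrix.mul_apply, Fin.sum_univ_two]
lemma inv00 (s : SL F) : (s⁻¹) 0 0 = s 1 1 := by
  rw [Matrix.SpecialLinearGroup.coe_inv, Matrix.adjugate_fin_two]; rfl
lemma inv01 (s : SL F) : (s⁻¹) 0 1 = - s 0 1 := by
  rw [Matrix.SpecialLinearGroup.coe_inv, Matrix.adjugate_fin_two]; rfl
lemma inv10 (s : SL F) : (s⁻¹) 1 0 = - s 1 0 := by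
  rw [Matrix.SpecialLinearGroup.coe_inv, Matrix.adjugate_fin_two]; rfl
lemma inv11 (s : SL F) : (s⁻¹) 1 1 = s 0 0 := by
  rw [Matrix.SpecialLinearGroup.coe_inv, Matrix.adjugate_fin_two]; rfl
lemma one00 : (1 : SL F) 0 0 = 1 := by simp
lemma one01 : (1 : SL F) 0 1 = 0 := by simp
lemma one10 : (1 : SL F) 1 0 = 0 := by simp
lemma one11 : (1 : SL F) 1 1 = 1 := by simp

lemma mem_center (s : SL F) : s ∈ Subgroup.center (SL F) ↔
    s 0 1 = 0 ∧ s 1 0 = 0 ∧ s 0 0 = s 1 1 := by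
  constructor
  · intro h
    rw [Subgroup.mem_center_iff] at h
    have h1 := h (mk4 1 1 0 1 (by ring))
    have h2 := h (mk4 1 0 1 1 (by ring))
    have h3 := congrArg (fun s : SL F => s 0 0) h1
    have h4 := congrArg (fun s : SL F => s 0 1) h1
    have h5 := congrArg (fun s : SL F => s 0 0) h2
    simp only [mul00, mul01, mk4_00, mk4_01, mk4_10, mk4_11] at h3 h4 h5
    refine ⟨by linear_combination -h5, by linear_combination h3, by linear_combination -h4⟩
  · rintro ⟨h1, h2, h3⟩
    rw [Subgroup.mem_center_iff]
    intro g
    apply sl_ext <;> simp only [mul00, mul01, mul10, mul11, h1, h2, h3] <;> ring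

lemma center_sq {s : SL F} (h : s ∈ Subgroup.center (SL F)) : s 0 0 ^ 2 = 1 := by
  obtain ⟨h1, h2, h3⟩ := (mem_center s).1 h
  have := det1 s
  rw [h1, ← h3] at this
  linear_combination this

/-- upper unipotent -/
def U (t : F) : SL F := mk4 1 t 0 1 (by ring)
/-- torus -/
def T (a : Fˣ) : SL F := mk4 a 0 0 (a⁻¹ : Fˣ) (by simp)
/-- Weyl element -/
def w0 : SL F := mk4 0 (-1) 1 0 (by ring)

lemma U_mul (s t : F) : U s * U t = U (s + t) := by
  apply sl_ext <;> simp [mul00, mul01, mul10, mul11, U]; ring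
lemma U_zero : (U 0 : SL F) = 1 := by
  apply sl_ext <;> simp [U]
lemma T_mul (a b : Fˣ) : T a * T b = T (a * b) := by
  apply sl_ext <;> simp [mul00, mul01, mul10, mul11, T]; ring

lemma U00 (t : F) : (U t) 0 0 = 1 := rfl
lemma U01 (t : F) : (U t) 0 1 = t := rfl
lemma U10 (t : F) : (U t) 1 0 = 0 := rfl
lemma U11 (t : F) : (U t) 1 1 = 1 := rfl
lemma T00 (a : Fˣ) : (T a) 0 0 = a := rfl
lemma T01 (a : Fˣ) : (T a) 0 1 = 0 := rfl
lemma T10 (a : Fˣ) : (T a) 1 0 = 0 := rfl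
lemma T11 (a : Fˣ) : (T a) 1 1 = (a⁻¹ : Fˣ) := rfl
lemma w00 : (w0 : SL F) 0 0 = 0 := rfl
lemma w01 : (w0 : SL F) 0 1 = -1 := rfl
lemma w10 : (w0 : SL F) 1 0 = 1 := rfl
lemma w11 : (w0 : SL F) 1 1 = 0 := rfl

lemma mem_borel (s : SL F) : s ∈ slBorel F ↔ s 1 0 = 0 := Iff.rfl

lemma borel_inv {s : SL F} (h : s 1 0 = 0) : s 1 1 = (s 0 0)⁻¹ ∧ s 0 0 ≠ 0 := by
  have := det1 s
  rw [h, mul_zero, sub_zero] at this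
  exact ⟨(inv_eq_of_mul_eq_one_right this).symm, left_ne_zero_of_mul_eq_one this⟩

/-- existence of an element with a given first column -/
lemma exists_col (x y : F) (h : x ≠ 0 ∨ y ≠ 0) : ∃ s : SL F, s 0 0 = x ∧ s 1 0 = y := by
  by_cases hx : x = 0
  · have hy : y ≠ 0 := by tauto
    exact ⟨mk4 x (-y⁻¹) y 0 (by field_simp; simp), rfl, rfl⟩
  · exact ⟨mk4 x 0 y x⁻¹ (by field_simp; simp), rfl, rfl⟩

/-- first column as pair -/
lemma col_ne (s : SL F) : s 0 0 ≠ 0 ∨ s 1 0 ≠ 0 := by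
  by_contra h
  push Not at h
  have := det1 s
  rw [h.1, h.2] at this
  simp at this

/-- `SL_2(F)` in bijection with first column and a parameter -/
noncomputable def slEquiv [DecidableEq F] : SL F ≃ {v : F × F // v ≠ 0} × F where
  toFun s := (⟨(s 0 0, s 1 0), by
    intro h
    have h1 := congrArg Prod.fst h
    have h2 := congrArg Prod.snd h
    rcases col_ne s with h3 | h3
    · exact h3 h1
    · exact h3 h2⟩, if s 0 0 = 0 then s 1 1 else s 0 1)
  invFun x := if h : x.1.1.1 = 0 then
      mk4 x.1.1.1 (-(x.1.1.2)⁻¹) x.1.1.2 x.2 (by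
        have : x.1.1.2 ≠ 0 := fun h2 => x.1.2 (Prod.ext h h2)
        rw [h]; field_simp; simp)
    else mk4 x.1.1.1 x.2 x.1.1.2 ((1 + x.2 * x.1.1.2) / x.1.1.1) (by field_simp; ring)
  left_inv s := by
    have hd := det1 s
    by_cases h : s 0 0 = 0
    · have h1 : s 1 0 ≠ 0 := by
        rcases col_ne s with h3 | h3
        · exact absurd h h3
        · exact h3
      simp only [h, dif_pos, if_pos]
      apply sl_ext
      · simp [h]
      · simp only [mk4_01]
        rw [h] at hd
        field_simp
        linear_combination hd
      · rfl
      · rfl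
    · simp only [h, dif_neg, if_neg, not_false_iff]
      apply sl_ext
      · rfl
      · rfl
      · rfl
      · simp only [mk4_11]
        field_simp
        linear_combination -hd
  right_inv x := by
    obtain ⟨⟨⟨x, y⟩, hv⟩, t⟩ := x
    by_cases h : x = 0
    · subst h; simp
    · simp [h]

lemma card_SL [Fintype F] : Nat.card (SL F) = (Fintype.card F ^ 2 - 1) * Fintype.card F := by
  classical
  rw [Nat.card_congr slEquiv, Nat.card_prod, Nat.card_eq_fintype_card, Nat.card_eq_fintype_card,
    Fintype.card_subtype_compl, Fintype.card_prod]
  simp [sq]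

/-- order of the center -/
noncomputable abbrev dd (F : Type) [Field F] : ℕ := Nat.card (Subgroup.center (SL F))

lemma card_pow_one [Fintype F] (m : ℕ) :
    Nat.card {a : Fˣ // a ^ m = 1} = Nat.gcd (Fintype.card F - 1) m := by
  classical
  have := IsCyclic.card_powMonoidHom_ker (G := Fˣ) m
  rw [Nat.card_eq_fintype_card (α := Fˣ), Fintype.card_units] at this
  rw [← this]
  exact Nat.card_congr (Equiv.subtypeEquivRight fun a => by
    rw [MonoidHom.mem_ker]; rfl)

lemma center_card [Fintype F] : dd F = Nat.gcd 2 (Fintype.card F - 1) := by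
  classical
  have e : Subgroup.center (SL F) ≃ {a : Fˣ // a ^ 2 = 1} :=
    { toFun := fun s => ⟨⟨s.1 0 0, s.1 0 0, by have := center_sq s.2; rwa [sq] at this,
        by have := center_sq s.2; rwa [sq] at this⟩, by
          ext; exact center_sq s.2⟩
      invFun := fun a => ⟨T a.1, by
        rw [mem_center]
        refine ⟨rfl, rfl, ?_⟩
        rw [T00, T11]
        congr 1
        exact eq_inv_of_mul_eq_one_left (by rw [← sq]; exact a.2)⟩
      left_inv := by
        rintro ⟨s, hs⟩
        apply Subtype.ext
        obtain ⟨h1, h2, h3⟩ := (mem_center s).1 hs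
        apply sl_ext
        · rfl
        · rw [T01]; exact h1.symm
        · rw [T10]; exact h2.symm
        · rw [T11]; exact h3
      right_inv := by
        rintro ⟨a, ha⟩
        apply Subtype.ext
        ext; rfl }
  rw [dd, Nat.card_congr e, card_pow_one, Nat.gcd_comm]

lemma pr_surj : Function.Surjective (pr F) := QuotientGroup.mk'_surjective _

lemma pr_eq_one (s : SL F) : pr F s = 1 ↔ s ∈ Subgroup.center (SL F) :=
  QuotientGroup.eq_one_iff s

lemma card_PSL [Fintype F] : dd F * Nat.card (PSL2 F) =
    (Fintype.card F ^ 2 - 1) * Fintype.card F := by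
  rw [← card_SL, mul_comm]
  exact (Subgroup.card_eq_card_quotient_mul_card_subgroup _).symm

/-- preimage of a subgroup -/
abbrev lift (H : Subgroup (PSL2 F)) : Subgroup (SL F) := H.comap (pr F)

lemma card_lift [Fintype F] (H : Subgroup (PSL2 F)) :
    Nat.card (lift H) = dd F * Nat.card H := by
  have h1 : (lift H).index = H.index := Subgroup.index_comap_of_surjective _ pr_surj
  have h2 := (lift H).index_mul_card
  have h3 := H.index_mul_card
  have h4 : dd F * Nat.card (PSL2 F) = Nat.card (SL F) := by rw [card_PSL, card_SL]
  rw [← h4, ← h3, h1] at h2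
  have : 0 < H.index := Nat.pos_of_ne_zero H.index_ne_zero_of_finite
  apply Nat.eq_of_mul_eq_mul_left this
  rw [h2]; ring

lemma center_le_lift (H : Subgroup (PSL2 F)) : Subgroup.center (SL F) ≤ lift H := by
  intro s hs
  rw [Subgroup.mem_comap, (pr_eq_one s).2 hs]
  exact H.one_mem

lemma card_map_pr [Fintype F] (K : Subgroup (SL F)) (h : Subgroup.center (SL F) ≤ K) :
    dd F * Nat.card (K.map (pr F)) = Nat.card K := by
  rw [← card_lift]
  congr 1
  have : lift (K.map (pr F)) = K := by
    rw [lift, Subgroup.comap_map_eq, QuotientGroup.ker_mk', sup_eq_left.2 h]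
  rw [this]

lemma pslBorel_lift : lift (pslBorel F) = slBorel F := by
  rw [lift, pslBorel, Subgroup.comap_map_eq, QuotientGroup.ker_mk', sup_eq_left]
  intro s hs
  exact ((mem_center s).1 hs).2.1

/-- Borel as a product -/
def borelEquiv : slBorel F ≃ Fˣ × F where
  toFun s := (⟨s.1 0 0, s.1 1 1, by
      have h := det1 s.1
      have h0 : s.1 1 0 = 0 := s.2
      rw [h0] at h; linear_combination h, by
      have h := det1 s.1
      have h0 : s.1 1 0 = 0 := s.2
      rw [h0] at h; linear_combination h⟩, s.1 0 1)
  invFun x := ⟨mk4 x.1 x.2 0 (x.1⁻¹ : Fˣ) (by simp), rfl⟩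
  left_inv s := by
    apply Subtype.ext
    apply sl_ext
    · rfl
    · rfl
    · exact (s.2 : s.1 1 0 = 0).symm
    · rfl
  right_inv x := by
    ext <;> rfl

lemma card_borel [Fintype F] : Nat.card (slBorel F) = (Fintype.card F - 1) * Fintype.card F := by
  classical
  rw [Nat.card_congr borelEquiv, Nat.card_prod, Nat.card_eq_fintype_card, Fintype.card_units,
    Nat.card_eq_fintype_card]

/-- T1 for functions on an `SL`-set. -/
lemma exists_weights {k : Type*} [Field k] [Fintype F] {p : ℕ} [CharP k p] {H : Subgroup (PSL2 F)}
    (hH : HasIp k p H) {Y : Type*} [Fintype Y] [MulAction (SL F) Y] (f : Y → k)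
    (hf : ∀ h ∈ lift H, ∀ y, f (h • y) = f y) (hne : f ≠ 0) :
    ∃ w : Y → k, ∀ s : SL F, ∑ y, w y * f (s • y) = 1 := by
  classical
  let lf : PSL2 F ⧸ H → SL F := fun x => Quotient.out (Quotient.out x)
  have hlf : ∀ x, ((pr F (lf x) : PSL2 F) : PSL2 F ⧸ H) = x := by
    intro x
    have h1 : pr F (lf x) = Quotient.out x := QuotientGroup.out_eq' _
    rw [h1]; exact QuotientGroup.out_eq' _
  have hindep : ∀ s t : SL F, ((pr F s : PSL2 F) : PSL2 F ⧸ H) = ((pr F t : PSL2 F)) →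
      ∀ y, f (s⁻¹ • y) = f (t⁻¹ • y) := by
    intro s t hst y
    have h1 : s⁻¹ * t ∈ lift H := by
      rw [Subgroup.mem_comap, map_mul, map_inv]
      exact QuotientGroup.eq.1 hst
    rw [← hf _ h1 (t⁻¹ • y), smul_smul]
    congr 2
    group
  let v : PSL2 F ⧸ H → (Y → k) := fun x y => f ((lf x)⁻¹ • y)
  let ρ : PSL2 F → ((Y → k) →ₗ[k] (Y → k)) := fun g =>
    LinearMap.funLeft k k (fun y => (Quotient.out g : SL F)⁻¹ • y)
  obtain ⟨y0, hy0⟩ := Function.ne_iff.1 hne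
  obtain ⟨l, hl⟩ := exists_functional hH v ρ (by
    intro g x
    ext y
    change f ((lf (g • x))⁻¹ • y) = f ((lf x)⁻¹ • (Quotient.out g : SL F)⁻¹ • y)
    rw [smul_smul, ← _root_.mul_inv_rev]
    apply hindep
    rw [hlf, map_mul]
    have h1 : pr F (Quotient.out g) = g := QuotientGroup.out_eq' _
    rw [h1]
    conv_lhs => rw [← hlf x]
    rfl) (((pr F 1 : PSL2 F)) : PSL2 F ⧸ H) (by
    intro h
    apply hy0
    have := congrFun h y0
    change f ((lf _)⁻¹ • y0) = 0 at this
    rw [hindep _ 1 (hlf _)] at this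
    simpa using this)
  refine ⟨fun y => l (Pi.single y 1), fun s => ?_⟩
  have h2 := hl (((pr F s⁻¹ : PSL2 F)) : PSL2 F ⧸ H)
  have h3 : v (((pr F s⁻¹ : PSL2 F)) : PSL2 F ⧸ H) = ∑ y, f (s • y) • Pi.single y 1 := by
    ext y
    change f ((lf _)⁻¹ • y) = _
    rw [hindep _ s⁻¹ (hlf _), inv_inv]
    simp [Finset.sum_apply, Pi.single_apply]
  rw [h3, map_sum] at h2
  refine Eq.trans ?_ h2
  refine Finset.sum_congr rfl fun y _ => ?_
  rw [map_smul, smul_eq_mul, mul_comm]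

end Basic

end Ip
namespace Ip

section IfBorel

variable {F}

lemma exists_fixed_fun {k : Type*} [Field k] {p : ℕ} [Fact p.Prime] [CharP k p]
    {S : Type*} [Group S] [Finite S] (P : Subgroup S) (hP : IsPGroup p P) (N : Submodule k (S → k))
    (hN : ∀ g ∈ P, ∀ f ∈ N, (fun x => f (g * x)) ∈ N) (hne : N ≠ ⊥) :
    ∃ f ∈ N, f ≠ 0 ∧ ∀ g ∈ P, ∀ x, f (g * x) = f x := by
  obtain ⟨f, hf, hf0⟩ := Submodule.exists_mem_ne_zero_of_ne_bot hne
  let act : DistribMulAction P (S → k) :=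
    { smul := fun g f x => f ((g : S)⁻¹ * x)
      one_smul := by
        intro f
        ext x
        change f (((1 : P) : S)⁻¹ * x) = f x
        simp
      mul_smul := by
        intro g h f
        ext x
        change f (((g * h : P) : S)⁻¹ * x) = f ((h : S)⁻¹ * ((g : S)⁻¹ * x))
        simp [mul_assoc]
      smul_zero := fun g => rfl
      smul_add := fun g f f' => rfl }
  have hact : ∀ (g : P) (f : S → k) (x : S), (g • f) x = f ((g : S)⁻¹ * x) := fun _ _ _ => rfl
  obtain ⟨f', hf', hne', hfix⟩ := exists_fixed hP (W := S → k) (by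
    intro w; ext x; simp) f hf0
  refine ⟨f', ?_, hne', ?_⟩
  · have : AddSubgroup.closure (MulAction.orbit P f) ≤ N.toAddSubgroup := by
      rw [AddSubgroup.closure_le]
      rintro _ ⟨g, rfl⟩
      exact hN _ (P.inv_mem g.2) f hf
    exact this hf'
  · intro g hg x
    have := congrFun (hfix ⟨g, hg⟩⁻¹) x
    rw [hact] at this
    simpa using this

/-- Upper triangular matrices with `a ^ m = 1`. -/
def Lm (F : Type) [Field F] (m : ℕ) : Subgroup (SL F) where
  carrier := {s | s 1 0 = 0 ∧ s 0 0 ^ m = 1}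
  one_mem' := ⟨one10, by rw [one00, one_pow]⟩
  mul_mem' := by
    rintro s t ⟨h1, h2⟩ ⟨h3, h4⟩
    refine ⟨by rw [mul10, h1, h3]; ring, ?_⟩
    rw [mul00, h3, mul_zero, add_zero, mul_pow, h2, h4, one_mul]
  inv_mem' := by
    rintro s ⟨h1, h2⟩
    refine ⟨by rw [inv10, h1, neg_zero], ?_⟩
    rw [inv00, (borel_inv h1).1, inv_pow, h2, inv_one]

lemma mem_Lm {m : ℕ} {s : SL F} : s ∈ Lm F m ↔ s 1 0 = 0 ∧ s 0 0 ^ m = 1 := Iff.rfl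

lemma card_Lm [Fintype F] (m : ℕ) :
    Nat.card (Lm F m) = Nat.gcd (Fintype.card F - 1) m * Fintype.card F := by
  rw [← card_pow_one, ← Nat.card_eq_fintype_card (α := F), ← Nat.card_prod]
  refine Nat.card_congr
    { toFun := fun s => (⟨(borelEquiv ⟨s.1, s.2.1⟩).1, by
        ext; exact s.2.2⟩, s.1 0 1)
      invFun := fun x => ⟨(borelEquiv.symm (x.1.1, x.2)).1, ⟨(borelEquiv.symm (x.1.1, x.2)).2, by
        have := congrArg Units.val x.1.2
        simpa using! this⟩⟩
      left_inv := by
        intro s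
        apply Subtype.ext
        have := congrArg Subtype.val (borelEquiv.symm_apply_apply ⟨s.1, s.2.1⟩)
        exact this
      right_inv := by
        rintro ⟨⟨a, ha⟩, b⟩
        rfl }

lemma Lm_conj {m : ℕ} {b l : SL F} (hb : b ∈ slBorel F) (hl : l ∈ Lm F m) :
    b⁻¹ * l * b ∈ Lm F m := by
  rw [mem_borel] at hb
  obtain ⟨h1, h2⟩ := hl
  obtain ⟨h3, h4⟩ := borel_inv hb
  refine ⟨?_, ?_⟩
  · rw [mul10, mul10, mul11, inv10, inv11, hb, h1]; ring
  · have : (b⁻¹ * l * b) 0 0 = l 0 0 := by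
      rw [mul00, mul00, mul01, inv00, inv01, hb, h1, h3]; field_simp; ring
    rw [this, h2]

lemma hasIp_borel {k : Type*} [Field k] [Fintype F] {p : ℕ} [Fact p.Prime] [CharP k p] (m e : ℕ)
    (hm : Fintype.card F - 1 = m * p ^ e) (hpm : ¬ p ∣ m * Fintype.card F)
    (hq : (Fintype.card F : k) = -1) {H : Subgroup (PSL2 F)} (hpH : ¬ p ∣ Nat.card H)
    (hH : Lm F m ≤ lift H) : HasIp k p H := by
  classical
  refine hasIp_of_const (pr F) pr_surj hpH ?_
  intro N hne hst hinv
  have hinv' : ∀ f ∈ N, ∀ s : SL F, ∀ h ∈ Lm F m, f (s * h) = f s :=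
    fun f hf s h hh => hinv f hf s h (hH hh)
  have hcL : Nat.card (Lm F m) = m * Fintype.card F := by
    rw [card_Lm, hm, Nat.gcd_eq_right (Dvd.intro _ rfl)]
  let I : Submodule k (SL F → k) :=
    { carrier := {f | ∀ l ∈ Lm F m, ∀ x, f (l * x) = f x}
      add_mem' := by
        intro f g hf hg l hl x
        simp [hf l hl x, hg l hl x]
      zero_mem' := by intro l hl x; rfl
      smul_mem' := by intro c f hf l hl x; simp [hf l hl x] }
  have hNI : N ⊓ I ≠ ⊥ := by
    obtain ⟨f, hf, hf0⟩ := Submodule.exists_mem_ne_zero_of_ne_bot hne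
    obtain ⟨s0, hs0⟩ := Function.ne_iff.1 hf0
    let f2 : SL F → k := ∑ l : Lm F m, fun x => f (s0 * ((l : SL F) * x))
    have hf2 : ∀ x, f2 x = ∑ l : Lm F m, f (s0 * ((l : SL F) * x)) := by
      intro x; simp [f2, Finset.sum_apply]
    have h1 : f2 ∈ N ⊓ I := by
      refine ⟨N.sum_mem fun l _ => hst l _ (hst s0 _ hf), ?_⟩
      intro l hl x
      rw [hf2, hf2]
      refine Fintype.sum_equiv (Equiv.mulRight ⟨l, hl⟩) _ _ ?_
      intro y
      simp [mul_assoc]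
    intro hb
    rw [hb, Submodule.mem_bot] at h1
    have h2 := congrFun h1 1
    rw [hf2] at h2
    have h3 : ∀ l : Lm F m, f (s0 * ((l : SL F) * 1)) = f s0 := by
      intro l
      rw [mul_one, hinv' f hf s0 l l.2]
    simp only [h3, Finset.sum_const, Finset.card_univ, nsmul_eq_mul, Pi.zero_apply,
      mul_eq_zero] at h2
    rcases h2 with h2 | h2
    · rw [CharP.cast_eq_zero_iff k p, ← Nat.card_eq_fintype_card, hcL] at h2
      exact hpm h2
    · exact hs0 h2
  let P0 : Sylow p (slBorel F) := default
  let P : Subgroup (SL F) := P0.toSubgroup.map (slBorel F).subtype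
  have hPB : P ≤ slBorel F := Subgroup.map_subtype_le _
  have hPp : IsPGroup p P := P0.2.map _
  obtain ⟨f, hf, hf0, hfix⟩ := exists_fixed_fun P hPp (N ⊓ I) (by
    rintro g hg f ⟨h1, h2⟩
    refine ⟨hst g f h1, ?_⟩
    intro l hl x
    have h3 := h2 (g * l * g⁻¹) (by
      have := Lm_conj (inv_mem (hPB hg)) hl
      rwa [inv_inv] at this) (g * x)
    simp only
    rw [← h3]
    congr 1
    group) hNI
  let Stb : Subgroup (SL F) :=
    { carrier := {s | ∀ x, f (s * x) = f x}
      one_mem' := by intro x; simp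
      mul_mem' := by
        intro a b ha hb x
        rw [mul_assoc, ha, hb]
      inv_mem' := by
        intro a ha x
        rw [← ha (a⁻¹ * x), mul_inv_cancel_left] }
  have hBS : slBorel F ≤ Stb := by
    have h1 : Lm F m ≤ Stb ⊓ slBorel F := le_inf (fun l hl x => hf.2 l hl x) (fun l hl => hl.1)
    have h2 : P ≤ Stb ⊓ slBorel F := le_inf (fun l hl x => hfix l hl x) hPB
    have h3 := Subgroup.card_dvd_of_le h1
    have h4 := Subgroup.card_dvd_of_le h2
    have hq0 : 0 < Fintype.card F := Fintype.card_pos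
    have hcP : Nat.card P = p ^ e := by
      have h5 : Nat.card P = Nat.card P0 :=
        (Nat.card_congr (Subgroup.equivMapOfInjective _ _
          (Subgroup.subtype_injective _)).toEquiv).symm
      rw [h5, P0.card_eq_multiplicity, card_borel, hm]
      congr 1
      have h7 : m * p ^ e * Fintype.card F = p ^ e * (m * Fintype.card F) := by ring
      have h8 : m * Fintype.card F ≠ 0 := fun h => hpm (h ▸ dvd_zero p)
      rw [h7, Nat.factorization_mul (pow_ne_zero _ (Fact.out : p.Prime).ne_zero) h8,
        Finsupp.add_apply, Nat.factorization_eq_zero_of_not_dvd hpm,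
        (Fact.out : p.Prime).factorization_pow]
      simp
    rw [hcP] at h4
    rw [hcL] at h3
    have hcop : Nat.Coprime (m * Fintype.card F) (p ^ e) :=
      (((Fact.out : p.Prime).coprime_iff_not_dvd.2 hpm).pow_left e).symm
    have h6 := hcop.mul_dvd_of_dvd_of_dvd h3 h4
    have h9 : Nat.card (slBorel F) ∣ Nat.card (Stb ⊓ slBorel F : Subgroup (SL F)) := by
      rw [card_borel, hm]
      convert h6 using 1; ring
    have h10 : Stb ⊓ slBorel F = slBorel F :=
      Subgroup.eq_of_le_of_card_ge inf_le_right (Nat.le_of_dvd Nat.card_pos h9)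
    exact inf_eq_right.1 h10
  have hfB : ∀ b ∈ slBorel F, ∀ x, f (b * x) = f x := hBS
  have hU : ∀ (t : F) (s : SL F), f (s * U t) = f s := by
    intro t s
    apply hinv' f hf.1
    exact ⟨rfl, by rw [U00, one_pow]⟩
  have hval1 : ∀ s : SL F, s 1 0 = 0 → f s = f 1 := by
    intro s hs
    have := hfB s hs 1
    rwa [mul_one] at this
  have hval2 : ∀ s : SL F, s 1 0 ≠ 0 → f s = f w0 := by
    intro s hs
    rw [← hU (-(s 1 1 / s 1 0)) s]
    have h1 : (s * U (-(s 1 1 / s 1 0))) * w0⁻¹ ∈ slBorel F := by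
      rw [mem_borel, mul10, mul10, mul11, inv00, inv10, U00, U01, U10, U11, w11, w10]
      field_simp
      ring
    have := hfB _ h1 w0
    rw [← this]
    congr 1
    group
  have hF1 : (∑ t : F, fun x => f (w0 * (U t * x))) + f = (f 1 - f w0) • (fun _ => (1 : k)) := by
    ext s
    simp only [Pi.add_apply, Finset.sum_apply, Pi.smul_apply, smul_eq_mul, mul_one]
    have h10 : ∀ t, (w0 * (U t * s) : SL F) 1 0 = s 0 0 + t * s 1 0 := by
      intro t
      rw [mul10, mul00, mul10, w10, w11, U00, U01, U10, U11]; ring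
    by_cases hs : s 1 0 = 0
    · have : ∀ t, f (w0 * (U t * s)) = f w0 := by
        intro t
        apply hval2
        rw [h10, hs, mul_zero, add_zero]
        exact (borel_inv hs).2
      simp only [this, Finset.sum_const, Finset.card_univ, nsmul_eq_mul, hq, hval1 s hs]
      ring
    · have : ∀ t, f (w0 * (U t * s)) = (if t = -(s 0 0 / s 1 0) then f 1 - f w0 else 0) + f w0 := by
        intro t
        split_ifs with h
        · rw [hval1 _ (by rw [h10, h]; field_simp; ring)]; ring
        · rw [hval2, zero_add]
          rw [h10]
          intro h2
          apply h
          field_simp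
          linear_combination h2
      simp only [this, Finset.sum_add_distrib, Finset.sum_const, Finset.card_univ, nsmul_eq_mul, hq,
        hval2 s hs, Finset.sum_ite_eq', Finset.mem_univ, if_true]
      ring
  by_cases hAB : f 1 - f w0 = 0
  · have hc : f = f 1 • (fun _ => (1 : k)) := by
      ext s
      by_cases hs : s 1 0 = 0
      · simp [hval1 s hs]
      · simp [hval2 s hs, sub_eq_zero.1 hAB]
    have h1 : f 1 ≠ 0 := by
      intro h
      rw [h, zero_smul] at hc
      exact hf0 hc
    have := N.smul_mem (f 1)⁻¹ hf.1
    rwa [hc, smul_smul, Pi.smul_apply, smul_eq_mul, mul_one, inv_mul_cancel₀ h1, one_smul] at this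
  · have h1 : (f 1 - f w0) • (fun _ => (1 : k)) ∈ N := by
      rw [← hF1]
      exact N.add_mem (N.sum_mem fun t _ => hst (U t) _ (hst w0 _ hf.1)) hf.1
    have := N.smul_mem (f 1 - f w0)⁻¹ h1
    rwa [smul_smul, inv_mul_cancel₀ hAB, one_smul] at this

end IfBorel

end Ip
namespace Ip

section ProjLine

variable {F}

/-- The projective line. -/
abbrev P1 (F : Type) [Field F] := SL F ⧸ slBorel F

lemma P1_eq (s t : SL F) : (s : P1 F) = (t : P1 F) ↔ s 0 0 * t 1 0 = s 1 0 * t 0 0 := by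
  rw [QuotientGroup.eq, mem_borel, mul10, inv10, inv11]
  constructor <;> intro h <;> linear_combination h

lemma smul_P1_eq (s g t : SL F) : s • (g : P1 F) = (t : P1 F) ↔
    (s 0 0 * g 0 0 + s 0 1 * g 1 0) * t 1 0 = (s 1 0 * g 0 0 + s 1 1 * g 1 0) * t 0 0 := by
  change ((s * g : SL F) : P1 F) = t ↔ _
  rw [P1_eq, mul00, mul10]

/-- Points of the projective line. -/
def pt : Option F → P1 F
  | none => ((1 : SL F) : P1 F)
  | some t => ((U t * w0 : SL F) : P1 F)

lemma Uw00 (t : F) : (U t * w0 : SL F) 0 0 = t := by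
  rw [mul00, U00, U01, w00, w10]; ring
lemma Uw10 (t : F) : (U t * w0 : SL F) 1 0 = 1 := by
  rw [mul10, U10, U11, w00, w10]; ring

lemma pt_bij : Function.Bijective (pt (F := F)) := by
  constructor
  · rintro (_ | t) (_ | t') h
    · rfl
    · simp only [pt, P1_eq, Uw00, Uw10, one00, one10] at h
      simp at h
    · simp only [pt, P1_eq, Uw00, Uw10, one00, one10] at h
      simp at h
    · simp only [pt, P1_eq, Uw00, Uw10, one00, one10] at h
      simp at h
      rw [h]
  · intro x
    induction x using QuotientGroup.induction_on with
    | H s =>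
      by_cases h : s 1 0 = 0
      · refine ⟨none, ?_⟩
        simp only [pt, P1_eq, one00, one10, h]; ring
      · refine ⟨some (s 0 0 / s 1 0), ?_⟩
        simp only [pt, P1_eq, Uw00, Uw10]
        field_simp

/-- The projective line is `F` with a point at infinity. -/
noncomputable def ptEquiv : Option F ≃ P1 F := Equiv.ofBijective pt pt_bij

noncomputable instance [Fintype F] : Fintype (P1 F) := by
  classical exact Fintype.ofEquiv _ ptEquiv

lemma card_P1 [Fintype F] : Fintype.card (P1 F) = Fintype.card F + 1 := by
  classical
  rw [← Fintype.card_congr ptEquiv, Fintype.card_option]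

lemma sum_P1 [Fintype F] {M : Type*} [AddCommMonoid M] (f : P1 F → M) :
    ∑ x, f x = f (pt none) + ∑ t : F, f (pt (some t)) := by
  classical
  rw [← Equiv.sum_comp (ptEquiv (F := F)) f, Fintype.sum_option]
  rfl

lemma smul_pt_none (s : SL F) : s • (pt none : P1 F) = pt none ↔ s 1 0 = 0 := by
  simp only [pt]
  rw [smul_P1_eq, one00, one10]
  simp [eq_comm]

lemma smul_pt_some (s : SL F) (t : F) : s • pt (some t) = pt (some t) ↔
    s 0 0 * t + s 0 1 = (s 1 0 * t + s 1 1) * t := by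
  simp only [pt]
  rw [smul_P1_eq, Uw00, Uw10]
  simp

lemma U_smul_some (s t : F) : U s • pt (some t) = pt (some (s + t)) := by
  simp only [pt]
  change ((U s * (U t * w0) : SL F) : P1 F) = _
  rw [← mul_assoc, U_mul]

lemma U_smul_none (s : F) : U s • (pt none : P1 F) = pt none := by
  rw [smul_pt_none, U10]

/-- The conjugate of a subgroup. -/
abbrev cj (g : PSL2 F) (H : Subgroup (PSL2 F)) : Subgroup (PSL2 F) :=
  H.map (MulAut.conj g).toMonoidHom

lemma mem_cj {g x : PSL2 F} {H : Subgroup (PSL2 F)} : x ∈ cj g H ↔ g⁻¹ * x * g ∈ H := by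
  constructor
  · rintro ⟨y, hy, rfl⟩
    simpa [mul_assoc] using hy
  · intro h
    exact ⟨_, h, by simp [mul_assoc]⟩

lemma mem_lift_cj {g x : SL F} {H : Subgroup (PSL2 F)} :
    x ∈ lift (cj (pr F g) H) ↔ g⁻¹ * x * g ∈ lift H := by
  rw [Subgroup.mem_comap, mem_cj, Subgroup.mem_comap, map_mul, map_mul, map_inv]

lemma card_cj (g : PSL2 F) (H : Subgroup (PSL2 F)) : Nat.card (cj g H) = Nat.card H :=
  (Nat.card_congr (Subgroup.equivMapOfInjective H _ (MulAut.conj g).injective).toEquiv).symm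

lemma cj_cj (g g' : PSL2 F) (H : Subgroup (PSL2 F)) : cj g (cj g' H) = cj (g * g') H := by
  ext x
  rw [mem_cj, mem_cj, mem_cj]
  constructor <;> intro h <;> convert h using 1 <;> group

lemma cj_one (H : Subgroup (PSL2 F)) : cj 1 H = H := by
  ext x
  rw [mem_cj]; simp

lemma cj_mono {g : PSL2 F} {H L : Subgroup (PSL2 F)} (h : H ≤ L) : cj g H ≤ cj g L :=
  Subgroup.map_mono h

/-- The unipotent subgroup. -/
def Ug (F : Type) [Field F] : Subgroup (SL F) where
  carrier := Set.range U
  one_mem' := ⟨0, U_zero⟩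
  mul_mem' := by
    rintro _ _ ⟨s, rfl⟩ ⟨t, rfl⟩
    exact ⟨s + t, (U_mul s t).symm⟩
  inv_mem' := by
    rintro _ ⟨s, rfl⟩
    refine ⟨-s, ?_⟩
    rw [eq_inv_iff_mul_eq_one, U_mul, neg_add_cancel, U_zero]

lemma U_inj : Function.Injective (U : F → SL F) := by
  intro s t h
  have := congrArg (fun x : SL F => x 0 1) h
  exact this

lemma card_Ug : Nat.card (Ug F) = Nat.card F :=
  (Nat.card_congr (Equiv.ofInjective U U_inj)).symm

lemma exists_prime [Fintype F] : ∃ p0 f : ℕ, p0.Prime ∧ 0 < f ∧ CharP F p0 ∧ Fintype.card F = p0 ^ f := by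
  obtain ⟨p0, hp0⟩ := CharP.exists F
  obtain ⟨n, h1, h2⟩ := FiniteField.card F p0
  exact ⟨p0, n, h1, n.2, hp0, h2⟩

lemma coprime_q [Fintype F] {p0 f : ℕ} (hp0 : p0.Prime) (hf : 0 < f)
    (hq : Fintype.card F = p0 ^ f) : ¬ p0 ∣ Fintype.card F ^ 2 - 1 := by
  have h1 : p0 ∣ Fintype.card F ^ 2 := by
    rw [hq, ← pow_mul]
    exact dvd_pow_self _ (by omega)
  have h2 : 1 ≤ Fintype.card F ^ 2 := Nat.one_le_pow _ _ Fintype.card_pos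
  intro h
  have := (Nat.dvd_sub_iff_right h2 h1).1 h
  exact hp0.one_lt.ne' (Nat.dvd_one.1 this)

lemma exists_conj_U [Fintype F] {H : Subgroup (PSL2 F)} (h : Fintype.card F ∣ Nat.card (lift H)) :
    ∃ g : PSL2 F, Ug F ≤ lift (cj g H) := by
  classical
  obtain ⟨p0, f, hp, hf, hc, hq⟩ := exists_prime (F := F)
  haveI : Fact p0.Prime := ⟨hp⟩
  rw [hq] at h
  obtain ⟨Q, hQ⟩ := Sylow.exists_subgroup_card_pow_prime p0 h
  let Q' : Subgroup (SL F) := Q.map (lift H).subtype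
  have hQ' : Nat.card Q' = p0 ^ f := by
    rw [← hQ]
    exact (Nat.card_congr (Subgroup.equivMapOfInjective _ _
          (Subgroup.subtype_injective _)).toEquiv).symm
  have hfac : (Nat.card (SL F)).factorization p0 = f := by
    have h8 : Fintype.card F ^ 2 - 1 ≠ 0 := by
      intro h
      exact coprime_q hp hf hq (h ▸ dvd_zero _)
    rw [card_SL, Nat.factorization_mul h8 Fintype.card_ne_zero, Finsupp.add_apply,
      Nat.factorization_eq_zero_of_not_dvd (coprime_q hp hf hq), hq, hp.factorization_pow]
    simp
  let P : Sylow p0 (SL F) := Sylow.ofCard (Ug F) (by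
    rw [hfac, card_Ug, Nat.card_eq_fintype_card, hq])
  let P' : Sylow p0 (SL F) := Sylow.ofCard Q' (by rw [hfac, hQ'])
  obtain ⟨g, hg⟩ := MulAction.exists_smul_eq (SL F) P' P
  refine ⟨pr F g, ?_⟩
  intro u hu
  rw [mem_lift_cj]
  have h1 : u ∈ (P : Subgroup (SL F)) := hu
  rw [← hg, Sylow.coe_subgroup_smul, Subgroup.mem_pointwise_smul_iff_inv_smul_mem] at h1
  have h2 : g⁻¹ * u * g ∈ Q' := by
    simpa [MulAut.smul_def] using! h1
  exact Subgroup.map_subtype_le _ h2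

lemma trans_of_U {K : Subgroup (SL F)} (hU : Ug F ≤ K) (hK : ¬ K ≤ slBorel F) :
    MulAction.IsPretransitive K (P1 F) := by
  rw [SetLike.not_le_iff_exists] at hK
  obtain ⟨s, hs, hs'⟩ := hK
  rw [mem_borel] at hs'
  have hn : ∃ t0 : F, s • (pt none : P1 F) = pt (some t0) := by
    obtain ⟨x, hx⟩ := pt_bij.2 (s • (pt none : P1 F))
    rcases x with _ | t
    · exact absurd ((smul_pt_none s).1 hx.symm) hs'
    · exact ⟨t, hx.symm⟩
  obtain ⟨t0, ht0⟩ := hn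
  have key : ∀ x : P1 F, ∃ h ∈ K, h • (pt none : P1 F) = x := by
    intro x
    obtain ⟨y, rfl⟩ := pt_bij.2 x
    rcases y with _ | t
    · exact ⟨1, K.one_mem, one_smul _ _⟩
    · refine ⟨U (t - t0) * s, K.mul_mem (hU ⟨_, rfl⟩) hs, ?_⟩
      rw [mul_smul, ht0, U_smul_some, sub_add_cancel]
  refine ⟨fun x y => ?_⟩
  obtain ⟨h, hh, rfl⟩ := key x
  obtain ⟨h', hh', rfl⟩ := key y
  refine ⟨⟨h' * h⁻¹, K.mul_mem hh' (K.inv_mem hh)⟩, ?_⟩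
  change (h' * h⁻¹) • h • (pt none : P1 F) = h' • (pt none : P1 F)
  rw [mul_smul, inv_smul_smul]

lemma dvd_of_trans [Fintype F] {K : Subgroup (SL F)} (hK : MulAction.IsPretransitive K (P1 F)) :
    Fintype.card F + 1 ∣ Nat.card K := by
  classical
  have := MulAction.card_orbit_mul_card_stabilizer_eq_card_group K (pt none : P1 F)
  rw [Nat.card_eq_fintype_card, ← this]
  have h2 : Fintype.card (MulAction.orbit K (pt none : P1 F)) = Fintype.card F + 1 := by
    rw [← card_P1]
    apply Fintype.card_congr
    rw [MulAction.orbit_eq_univ]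
    exact Equiv.Set.univ _
  rw [h2]
  exact Dvd.intro _ rfl

lemma conj_le_borel [Fintype F] {H : Subgroup (PSL2 F)} {c : ℕ}
    (h : Nat.card (lift H) = c * Fintype.card F) (hc : c < Fintype.card F + 1) :
    ∃ g : PSL2 F, Ug F ≤ lift (cj g H) ∧ lift (cj g H) ≤ slBorel F := by
  obtain ⟨g, hg⟩ := exists_conj_U (H := H) ⟨c, by rw [h, mul_comm]⟩
  refine ⟨g, hg, ?_⟩
  by_contra hcon
  have h1 := dvd_of_trans (trans_of_U hg hcon)
  rw [card_lift, card_cj, ← card_lift, h] at h1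
  have h2 : Nat.Coprime (Fintype.card F + 1) (Fintype.card F) := by simp
  have h3 := h2.dvd_of_dvd_mul_right h1
  have h4 : 0 < c := by
    rcases Nat.eq_zero_or_pos c with rfl | h
    · rw [zero_mul] at h
      exact absurd h Nat.card_pos.ne'
    · exact h
  exact absurd (Nat.le_of_dvd h4 h3) (by omega)

end ProjLine

end Ip
namespace Ip

section BorelCases

variable {F}

lemma card_pslBorel [Fintype F] : dd F * Nat.card (pslBorel F) =
    (Fintype.card F - 1) * Fintype.card F := by
  rw [← card_lift, pslBorel_lift, card_borel]

lemma dd_pos [Fintype F] : 0 < dd F := Nat.card_pos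

lemma index_card (H : Subgroup (PSL2 F)) [Fintype F] :
    dd F * (H.index * Nat.card H) = (Fintype.card F - 1) * (Fintype.card F + 1) * Fintype.card F := by
  rw [Subgroup.index_mul_card, card_PSL]
  congr 1
  have := Nat.sq_sub_sq (Fintype.card F) 1
  rw [one_pow] at this
  rw [this, mul_comm]

lemma hasIp_pslBorel {k : Type*} [Field k] [Fintype F] {p : ℕ} [Fact p.Prime] [CharP k p]
    (hp : Odd p) (hpq : p ∣ Fintype.card F + 1) : HasIp k p (pslBorel F) := by
  have hpp : p.Prime := Fact.out
  have hq1 : 1 < Fintype.card F := Fintype.one_lt_card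
  have hnd : ¬ p ∣ (Fintype.card F - 1) * Fintype.card F := by
    intro h
    rcases hpp.dvd_mul.1 h with h | h
    · have h1 := Nat.dvd_sub hpq h
      have h2 : Fintype.card F + 1 - (Fintype.card F - 1) = 2 := by omega
      rw [h2] at h1
      have h3 := (Nat.prime_dvd_prime_iff_eq hpp Nat.prime_two).1 h1
      rw [h3] at hp
      exact absurd hp (by decide)
    · have h1 := Nat.dvd_sub hpq h
      have h2 : Fintype.card F + 1 - Fintype.card F = 1 := by omega
      rw [h2] at h1
      exact hpp.one_lt.ne' (Nat.dvd_one.1 h1)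
  refine hasIp_borel (Fintype.card F - 1) 0 (by simp) hnd ?_ ?_ ?_
  · have := (CharP.cast_eq_zero_iff k p (Fintype.card F + 1)).2 hpq
    push_cast at this
    linear_combination this
  · intro h
    exact hnd (card_pslBorel (F := F) ▸ Dvd.dvd.mul_left h _)
  · rw [pslBorel_lift]
    intro s hs
    exact hs.1

lemma case1 {k : Type*} [Field k] [Fintype F] {p : ℕ} [Fact p.Prime] [CharP k p]
    (hp : Odd p) (hpq : p ∣ Fintype.card F + 1) (H : Subgroup (PSL2 F)) :
    HasIp k p H ↔ (∃ g : PSL2 F, H = (pslBorel F).map (MulAut.conj g).toMonoidHom) ∧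
        Nat.card H = Fintype.card F * (Fintype.card F - 1) / Nat.gcd 2 (Fintype.card F - 1) ∧
        H.index = Fintype.card F + 1 := by
  have hB := hasIp_pslBorel (F := F) (k := k) hp hpq
  have hq1 : 1 < Fintype.card F := Fintype.one_lt_card
  constructor
  · intro hH
    have hc : Nat.card H = Nat.card (pslBorel F) :=
      le_antisymm (card_le hB hH.1) (card_le hH hB.1)
    have hc2 : dd F * Nat.card H = (Fintype.card F - 1) * Fintype.card F := by
      rw [hc, card_pslBorel]
    obtain ⟨g, -, hg⟩ := conj_le_borel (H := H) (c := Fintype.card F - 1)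
      (by rw [card_lift, hc2]) (by omega)
    refine ⟨⟨g⁻¹, ?_⟩, ?_, ?_⟩
    · have h1 : cj g H ≤ pslBorel F := by
        rw [← pslBorel_lift] at hg
        exact (Subgroup.comap_le_comap_of_surjective pr_surj).1 hg
      have h2 : cj g H = pslBorel F :=
        Subgroup.eq_of_le_of_card_ge h1 (by rw [card_cj, hc])
      change H = cj g⁻¹ _
      rw [← h2, cj_cj, inv_mul_cancel, cj_one]
    · rw [← center_card]
      symm
      apply Nat.div_eq_of_eq_mul_right dd_pos
      rw [hc2, mul_comm]
    · have := index_card H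
      have h3 : (dd F * Nat.card H) * H.index = (dd F * Nat.card H) * (Fintype.card F + 1) := by
        rw [hc2]
        rw [← mul_assoc, mul_right_comm, hc2] at this
        rw [this]; ring
      apply Nat.eq_of_mul_eq_mul_left _ h3
      rw [hc2]
      apply Nat.mul_pos <;> omega
  · rintro ⟨⟨g, rfl⟩, -, -⟩
    exact hasIp_of_card_eq hB (card_cj g _)

lemma borel_pow {s : SL F} (hs : s 1 0 = 0) (n : ℕ) : (s ^ n) 1 0 = 0 ∧ (s ^ n) 0 0 = s 0 0 ^ n := by
  induction n with
  | zero => rw [pow_zero, one10, one00, pow_zero]; exact ⟨rfl, rfl⟩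
  | succ n ih =>
    rw [pow_succ, mul10, mul00, ih.1, ih.2, hs]
    constructor <;> ring

lemma odd_mem_Lm [Fintype F] {m e : ℕ} (hm : Fintype.card F - 1 = 2 ^ e * m)
    {s : SL F} (hs : s ∈ slBorel F) (ho : ¬ 2 ∣ orderOf (pr F s)) : s ∈ Lm F (2 * m) := by
  rw [mem_borel] at hs
  refine ⟨hs, ?_⟩
  set r := orderOf (pr F s) with hr
  have h1 : s ^ r ∈ Subgroup.center (SL F) := by
    rw [← pr_eq_one, map_pow, hr, pow_orderOf_eq_one]
  have h2 := center_sq h1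
  rw [(borel_pow hs r).2, ← pow_mul] at h2
  have h3 : s 0 0 ^ (Fintype.card F - 1) = 1 :=
    FiniteField.pow_card_sub_one_eq_one _ (borel_inv hs).2
  rw [← orderOf_dvd_iff_pow_eq_one] at h2 h3 ⊢
  have h4 := Nat.dvd_gcd h3 h2
  have h5 := h4.trans (Nat.gcd_mul_right_dvd_mul_gcd _ _ _)
  rw [mul_comm] at h5
  refine h5.trans (mul_dvd_mul (Nat.gcd_dvd_right _ _) ?_)
  · have : Nat.gcd (Fintype.card F - 1) r ∣ 2 ^ e * m := hm ▸ Nat.gcd_dvd_left _ _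
    refine Nat.Coprime.dvd_of_dvd_mul_left ?_ this
    apply Nat.Coprime.pow_right
    apply Nat.Coprime.coprime_dvd_left (Nat.gcd_dvd_right _ _)
    exact ((Nat.prime_two.coprime_iff_not_dvd).2 ho).symm

lemma center_le_Lm {m : ℕ} : Subgroup.center (SL F) ≤ Lm F (2 * m) := by
  intro s hs
  exact ⟨((mem_center s).1 hs).2.1, by rw [pow_mul, center_sq hs, one_pow]⟩

lemma case3 {k : Type*} [Field k] [Fintype F] [CharP k 2]
    (hq : Odd (Fintype.card F)) (H : Subgroup (PSL2 F)) :
    HasIp k 2 H ↔ (∃ (g : PSL2 F) (B : Subgroup (PSL2 F)),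
          B = (pslBorel F).map (MulAut.conj g).toMonoidHom ∧
          H = Subgroup.map B.subtype (Op 2 ↥B)) ∧
        Nat.card H = Fintype.card F * ((Fintype.card F - 1) / 2 ^ ((Fintype.card F - 1).factorization 2)) ∧
        H.index = 2 ^ ((Fintype.card F - 1).factorization 2) * (Fintype.card F + 1) / 2 := by
  haveI : Fact (Nat.Prime 2) := ⟨Nat.prime_two⟩
  have hq1 : 1 < Fintype.card F := Fintype.one_lt_card
  set e := (Fintype.card F - 1).factorization 2 with he
  set m := (Fintype.card F - 1) / 2 ^ e with hmdef
  have hm : 2 ^ e * m = Fintype.card F - 1 := Nat.ordProj_mul_ordCompl_eq_self _ 2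
  have hm2 : ¬ 2 ∣ m := Nat.not_dvd_ordCompl Nat.prime_two (by omega)
  obtain ⟨c, hc⟩ := hq
  have he1 : 1 ≤ e := by
    by_contra h
    have : e = 0 := by omega
    rw [this] at hm
    omega
  have h2m : 2 * m ∣ Fintype.card F - 1 := by
    rw [← hm]
    exact mul_dvd_mul (dvd_pow_self 2 (by omega)) dvd_rfl
  have hm0 : 0 < m := by
    rcases Nat.eq_zero_or_pos m with h | h
    · rw [h] at hm2; simp at hm2
    · exact h
  have hd : dd F = 2 := by
    rw [center_card, hc]
    simp
  have hcL : Nat.card (Lm F (2 * m)) = 2 * m * Fintype.card F := by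
    rw [card_Lm, Nat.gcd_eq_right h2m]
  set L : Subgroup (PSL2 F) := (Lm F (2 * m)).map (pr F) with hL
  have hLc : Nat.card L = Fintype.card F * m := by
    have := card_map_pr (Lm F (2 * m)) center_le_Lm
    rw [hd, hcL] at this
    have h3 : 2 * Nat.card L = 2 * (Fintype.card F * m) := by rw [hL, this]; ring
    omega
  have hodd : ¬ 2 ∣ Fintype.card F * m := by
    rw [Nat.prime_two.dvd_mul]
    omega
  have hIpL : HasIp k 2 L := by
    refine hasIp_borel m e (by rw [← hm, mul_comm]) (by rwa [mul_comm]) ?_ (by rwa [hLc]) ?_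
    · have h3 : ((Fintype.card F + 1 : ℕ) : k) = 0 := (CharP.cast_eq_zero_iff k 2 _).2 (by omega)
      push_cast at h3
      linear_combination h3
    · intro s hs
      refine ⟨s, ⟨hs.1, ?_⟩, rfl⟩
      rw [mul_comm, pow_mul, hs.2, one_pow]
  constructor
  · intro hH
    have hcH : Nat.card H = Fintype.card F * m := by
      rw [← hLc]
      exact le_antisymm (card_le hIpL hH.1) (card_le hH hIpL.1)
    have hcl : Nat.card (lift H) = 2 * m * Fintype.card F := by
      rw [card_lift, hd, hcH]; ring
    obtain ⟨g, -, hg⟩ := conj_le_borel (H := H) (c := 2 * m) hcl (by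
      have := Nat.le_of_dvd (by omega) h2m
      omega)
    have h1 : cj g H ≤ pslBorel F := by
      rw [← pslBorel_lift] at hg
      exact (Subgroup.comap_le_comap_of_surjective pr_surj).1 hg
    have hle : lift (cj g H) ≤ Lm F (2 * m) := by
      intro s hs
      refine odd_mem_Lm hm.symm (hg hs) ?_
      have h4 : pr F s ∈ cj g H := hs
      have h5 := Subgroup.orderOf_dvd_natCard _ h4
      rw [card_cj, hcH] at h5
      exact fun h => hodd (h.trans h5)
    have heq : lift (cj g H) = Lm F (2 * m) := by
      apply Subgroup.eq_of_le_of_card_ge hle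
      rw [hcL, card_lift, card_cj, ← card_lift, hcl]
    refine ⟨⟨g⁻¹, _, rfl, ?_⟩, hcH, ?_⟩
    · have hHB : H ≤ cj g⁻¹ (pslBorel F) := by
        have := cj_mono (g := g⁻¹) h1
        rwa [cj_cj, inv_mul_cancel, cj_one] at this
      apply le_antisymm
      · intro x hx
        refine ⟨⟨x, hHB hx⟩, Subgroup.subset_closure ?_, rfl⟩
        change ¬ 2 ∣ orderOf _
        rw [Subgroup.orderOf_mk]
        have h5 := Subgroup.orderOf_dvd_natCard _ hx
        rw [hcH] at h5
        exact fun h => hodd (h.trans h5)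
      · rw [Subgroup.map_le_iff_le_comap, Op, Subgroup.closure_le]
        rintro ⟨b, hb⟩ hob
        change ¬ 2 ∣ orderOf _ at hob
        rw [Subgroup.orderOf_mk] at hob
        change b ∈ H
        have hb2 := mem_cj.1 hb
        rw [inv_inv] at hb2
        obtain ⟨s, hs, hs2⟩ := hb2
        change pr F s = _ at hs2
        have ho : orderOf (pr F s) = orderOf b := by
          rw [hs2]
          exact (orderOf_injective (MulAut.conj g).toMonoidHom (MulAut.conj g).injective b)
        have h6 := odd_mem_Lm hm.symm hs (by rwa [ho])
        rw [← heq, Subgroup.mem_comap, hs2, mem_cj] at h6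
        simpa [mul_assoc] using h6
    · have h7 := index_card H
      rw [hd, hcH, ← hm] at h7
      symm
      apply Nat.div_eq_of_eq_mul_right (by norm_num)
      have h8 : (Fintype.card F * m) * (2 ^ e * (Fintype.card F + 1)) =
          (Fintype.card F * m) * (2 * H.index) := by
        linear_combination -h7
      exact Nat.eq_of_mul_eq_mul_left (Nat.mul_pos (by omega) hm0) h8
  · rintro ⟨-, hcH, -⟩
    exact hasIp_of_card_eq hIpL (by rw [hcH, hLc])

end BorelCases

end Ip
namespace Ip

section Comp

variable {F}

lemma hasIp_of_index {k : Type*} [Field k] {G : Type*} [Group G] [Finite G] {p : ℕ} [Fact p.Prime]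
    [CharP k p] {H : Subgroup G} (hpH : ¬ p ∣ Nat.card H) {n : ℕ} (hi : H.index = p ^ n) :
    HasIp k p H := by
  have hpp : p.Prime := Fact.out
  refine hasIp_of_const (MonoidHom.id G) Function.surjective_id hpH ?_
  intro N hne hst hinv
  let P : Sylow p G := default
  obtain ⟨f, hf, hf0, hfix⟩ := exists_fixed_fun (P : Subgroup G) P.2 N (fun g _ => hst g) hne
  have hcP : Nat.card P = p ^ n := by
    rw [P.card_eq_multiplicity, ← Subgroup.index_mul_card H, hi,
      Nat.factorization_mul (pow_ne_zero _ hpp.ne_zero) Nat.card_pos.ne', Finsupp.add_apply,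
      Nat.factorization_eq_zero_of_not_dvd hpH, hpp.factorization_pow]
    simp
  have hcomp : Subgroup.IsComplement' (P : Subgroup G) H := by
    apply Subgroup.isComplement'_of_coprime
    · rw [← Subgroup.index_mul_card H, hi]
      congr 1
    · change Nat.Coprime (Nat.card P) _
      rw [hcP]
      exact ((hpp.coprime_iff_not_dvd).2 hpH).pow_left n
  have hc : ∀ x, f x = f 1 := by
    intro x
    obtain ⟨⟨u, h⟩, hx⟩ := hcomp.2 x
    have hx' : (u : G) * (h : G) = x := hx
    rw [← hx', hfix u u.2]
    have := hinv f hf 1 h h.2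
    rwa [one_mul] at this
  have h1 : f 1 ≠ 0 := by
    intro h
    apply hf0
    ext x
    rw [hc, h]; rfl
  have h2 : (fun _ => (1 : k)) = (f 1)⁻¹ • f := by
    ext x
    rw [Pi.smul_apply, hc x, smul_eq_mul, inv_mul_cancel₀ h1]
  rw [h2]
  exact N.smul_mem _ hf

end Comp

end Ip
namespace Ip

section Case6

variable {F}

lemma exists_emb (F : Type) [Field F] [Finite F] (k : Type*) [Field k] [IsAlgClosed k] (p : ℕ)
    [Fact p.Prime] [CharP F p] [CharP k p] : Nonempty (F →+* k) := by
  letI := ZMod.algebra F p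
  letI := ZMod.algebra k p
  exact ⟨(IsAlgClosed.lift (R := ZMod p) (S := F) (M := k)).toRingHom⟩

open Polynomial in
lemma coeff_sq_two {R : Type*} [CommRing R] [CharP R 2] (P : R[X]) (n : ℕ) :
    (P ^ 2).coeff n = if 2 ∣ n then P.coeff (n / 2) ^ 2 else 0 := by
  haveI : Fact (Nat.Prime 2) := ⟨Nat.prime_two⟩
  haveI : ExpChar R 2 := ExpChar.prime Nat.prime_two
  rw [← Polynomial.map_frobenius_expand (p := 2), coeff_map, coeff_expand two_pos]
  split_ifs <;> simp [frobenius_def]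

open Polynomial in
lemma coeff_central {R : Type*} [CommRing R] [CharP R 2] (a c : R) (i : ℕ) :
    ((C c + X + C a * X ^ 2) ^ i : R[X]).coeff i = 1 := by
  induction i using Nat.strong_induction_on with
  | _ i ih =>
    rcases Nat.even_or_odd' i with ⟨j, rfl | rfl⟩
    · rcases Nat.eq_zero_or_pos j with rfl | hj
      · simp
      · rw [mul_comm 2 j, pow_mul, coeff_sq_two, if_pos (Dvd.intro_left _ rfl),
          Nat.mul_div_cancel _ two_pos, ih j (by omega), one_pow]
    · have hstep : ∀ Q : R[X], Q * (C c + X + C a * X ^ 2) = Q * C c + Q * X + C a * (Q * X ^ 2) := by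
        intro Q; ring
      rw [pow_succ, hstep, coeff_add, coeff_add, coeff_mul_C, coeff_mul_X, coeff_C_mul]
      have h1 : ((C c + X + C a * X ^ 2) ^ (2 * j) : R[X]).coeff (2 * j + 1) = 0 := by
        rw [mul_comm 2 j, pow_mul, coeff_sq_two, if_neg (by omega)]
      have h2 : ((C c + X + C a * X ^ 2) ^ (2 * j) * X ^ 2 : R[X]).coeff (2 * j + 1) = 0 := by
        rcases Nat.eq_zero_or_pos j with rfl | hj
        · simp [coeff_X_pow]
        · have h3 : 2 * j + 1 = (2 * j - 1) + 2 := by omega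
          rw [h3, coeff_mul_X_pow, mul_comm 2 j, pow_mul, coeff_sq_two, if_neg (by omega)]
      have h4 : ((C c + X + C a * X ^ 2) ^ (2 * j) : R[X]).coeff (2 * j) = 1 := by
        rcases Nat.eq_zero_or_pos j with rfl | hj
        · simp
        · exact ih (2 * j) (by omega)
      rw [h1, h2, h4]; ring

open Polynomial in
lemma sum_central [Fintype F] [DecidableEq F] [CharP F 2] (a c : F) {i : ℕ} (hi : i + 2 ≤ Fintype.card F) :
    ∑ z : Fˣ, ((z⁻¹ : Fˣ) : F) ^ i * (a * z ^ 2 + z + c) ^ i = 1 := by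
  have hP : ∀ z : Fˣ, ((z⁻¹ : Fˣ) : F) ^ i * (a * z ^ 2 + z + c) ^ i =
      ∑ j ∈ Finset.range (2 * i + 1), ((C c + X + C a * X ^ 2) ^ i : F[X]).coeff j *
        ((z ^ (j + (Fintype.card F - 1 - i)) : Fˣ) : F) := by
    intro z
    have h1 : (a * (z : F) ^ 2 + z + c) ^ i = ((C c + X + C a * X ^ 2) ^ i : F[X]).eval (z : F) := by
      simp; ring
    have hdeg : ((C c + X + C a * X ^ 2) ^ i : F[X]).natDegree < 2 * i + 1 := by
      have : (C c + X + C a * X ^ 2 : F[X]).natDegree ≤ 2 := by compute_degree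
      have h2 := natDegree_pow_le_of_le i this
      omega
    have hz : ((z⁻¹ : Fˣ) : F) ^ i = ((z ^ (Fintype.card F - 1 - i) : Fˣ) : F) := by
      rw [← Units.val_pow_eq_pow_val]
      congr 1
      rw [inv_pow, inv_eq_iff_mul_eq_one, ← pow_add]
      have : i + (Fintype.card F - 1 - i) = Fintype.card Fˣ := by
        rw [Fintype.card_units]; omega
      rw [this, pow_card_eq_one]
    rw [h1, eval_eq_sum_range' hdeg, Finset.mul_sum, hz]
    refine Finset.sum_congr rfl fun j _ => ?_
    rw [pow_add]
    push_cast
    ring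
  simp_rw [hP]
  rw [Finset.sum_comm]
  simp_rw [← Finset.mul_sum]
  have hs : ∀ j ∈ Finset.range (2 * i + 1),
      ((C c + X + C a * X ^ 2) ^ i : F[X]).coeff j *
        (∑ z : Fˣ, ((z ^ (j + (Fintype.card F - 1 - i)) : Fˣ) : F)) = if j = i then 1 else 0 := by
    intro j hj
    rw [Finset.mem_range] at hj
    simp only [Units.val_pow_eq_pow_val]
    rw [FiniteField.sum_pow_units]
    split_ifs with h1 h2 h2
    · rw [h2, coeff_central, one_mul]
      exact neg_eq_of_add_eq_zero_left (CharTwo.add_self_eq_zero 1)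
    · exfalso
      obtain ⟨r, hr⟩ := h1
      have hr1 : r = 1 := by
        have h3 : r < 2 := by
          by_contra h
          have : (Fintype.card F - 1) * 2 ≤ (Fintype.card F - 1) * r :=
            Nat.mul_le_mul_left _ (by omega)
          omega
        have h4 : r ≠ 0 := by
          rintro rfl
          omega
        omega
      subst hr1
      omega
    · exfalso
      apply h1
      rw [h2]
      have : i + (Fintype.card F - 1 - i) = Fintype.card F - 1 := by omega
      rw [this]
    · rw [mul_zero]
  rw [Finset.sum_congr rfl hs, Finset.sum_ite_eq', if_pos]
  rw [Finset.mem_range]; omega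

lemma T_mul_U (c : Fˣ) (t : F) : T c * U t = U (c ^ 2 * t) * T c := by
  apply sl_ext
  · simp only [mul00, U00, U01, U10, U11, T00, T01, T10, T11]; ring
  · simp only [mul01, U00, U01, U10, U11, T00, T01, T10, T11]
    have : (c : F) * ((c⁻¹ : Fˣ) : F) = 1 := by simp
    linear_combination -(c : F) * t * this
  · simp only [mul10, U00, U01, U10, U11, T00, T01, T10, T11]; ring
  · simp only [mul11, U00, U01, U10, U11, T00, T01, T10, T11]; ring

lemma borel_eq {s : SL F} (hs : s 1 0 = 0) : ∃ (t : F) (a : Fˣ), s = U t * T a ∧ s 0 0 = a := by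
  obtain ⟨h1, h2⟩ := borel_inv hs
  refine ⟨s 0 1 * s 0 0, Units.mk0 _ h2, ?_, rfl⟩
  apply sl_ext
  · simp [mul00, U00, U01, T00, T10]
  · rw [mul01, U00, U01, T01, T11]
    simp [h2]
  · simp [mul10, U10, U11, T00, T10, hs]
  · simp [mul11, U10, U11, T01, T11, h1]

lemma dd_even [Fintype F] (hq : Even (Fintype.card F)) : dd F = 1 := by
  rw [center_card]
  have h0 := Fintype.card_pos (α := F)
  obtain ⟨c, hc⟩ := hq
  have : ¬ 2 ∣ Fintype.card F - 1 := by omega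
  exact (Nat.prime_two.coprime_iff_not_dvd).2 this

lemma charTwo_of_even [Fintype F] (hq : Even (Fintype.card F)) : CharP F 2 := by
  obtain ⟨p0, f, h1, h2, h3, h4⟩ := exists_prime (F := F)
  have : 2 ∣ p0 ^ f := by rw [← h4]; exact hq.two_dvd
  have h5 := Nat.prime_two.dvd_of_dvd_pow this
  rw [(Nat.prime_dvd_prime_iff_eq Nat.prime_two h1).1 h5]
  exact h3

lemma borel_complement [Fintype F] (hq : Even (Fintype.card F)) {K : Subgroup (SL F)}
    (hK : Nat.card K = Fintype.card F + 1) : Subgroup.IsComplement' (slBorel F) K := by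
  have h0 := Fintype.one_lt_card (α := F)
  obtain ⟨c, hc⟩ := hq
  apply Subgroup.isComplement'_of_coprime
  · rw [card_borel, hK, card_SL]
    have := Nat.sq_sub_sq (Fintype.card F) 1
    rw [one_pow] at this
    rw [this]; ring
  · rw [card_borel, hK]
    apply Nat.Coprime.mul_left
    · have h2 : Fintype.card F + 1 = Fintype.card F - 1 + 2 := by omega
      rw [h2, Nat.coprime_self_add_right]
      exact ((Nat.prime_two.coprime_iff_not_dvd).2 (by omega)).symm
    · simp

end Case6

end Ip
namespace Ip

section Case6If

variable {F}

/-- The invariant quadratic form, evaluated at the first column of a matrix. -/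
noncomputable def Rf (K : Subgroup (SL F)) [Fintype K] (s : SL F) : F :=
  ∑ h : K, ((h : SL F) * s) 0 0 * ((h : SL F) * s) 1 0

lemma Rf_inv (K : Subgroup (SL F)) [Fintype K] {h : SL F} (hh : h ∈ K) (s : SL F) :
    Rf K (h * s) = Rf K s := by
  unfold Rf
  refine Fintype.sum_equiv (Equiv.mulRight ⟨h, hh⟩) _ _ ?_
  intro x
  simp [mul_assoc]

lemma Rf_eq [CharP F 2] (K : Subgroup (SL F)) [Fintype K] (hK : Odd (Nat.card K)) :
    ∃ A C : F, ∀ s, Rf K s = A * s 0 0 ^ 2 + s 0 0 * s 1 0 + C * s 1 0 ^ 2 := by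
  refine ⟨∑ h : K, (h : SL F) 0 0 * (h : SL F) 1 0, ∑ h : K, (h : SL F) 0 1 * (h : SL F) 1 1, ?_⟩
  intro s
  unfold Rf
  have h1 : ∀ h : K, ((h : SL F) * s) 0 0 * ((h : SL F) * s) 1 0 =
      (h : SL F) 0 0 * (h : SL F) 1 0 * s 0 0 ^ 2 + s 0 0 * s 1 0 +
      (h : SL F) 0 1 * (h : SL F) 1 1 * s 1 0 ^ 2 := by
    intro h
    rw [mul00, mul10]
    have := det1 (h : SL F)
    have h2 : (2 : F) = 0 := CharTwo.two_eq_zero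
    linear_combination (s 0 0 * s 1 0) * this + (h : SL F) 0 1 * (h : SL F) 1 0 * s 0 0 * s 1 0 * h2
  simp_rw [h1]
  rw [Finset.sum_add_distrib, Finset.sum_add_distrib, Finset.sum_const, Finset.card_univ,
    ← Finset.sum_mul, ← Finset.sum_mul, nsmul_eq_mul]
  have h3 : ((Fintype.card K : ℕ) : F) = 1 := by
    rw [Nat.card_eq_fintype_card] at hK
    obtain ⟨c, hc⟩ := hK
    rw [hc]
    push_cast
    rw [CharTwo.two_eq_zero]; ring
  rw [h3, one_mul]

lemma hasIp_case6 {k : Type*} [Field k] [IsAlgClosed k] [Fintype F] [CharP k 2]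
    (hq : Even (Fintype.card F)) {H : Subgroup (PSL2 F)}
    (hcH : Nat.card H = Fintype.card F + 1) : HasIp k 2 H := by
  classical
  haveI : Fact (Nat.Prime 2) := ⟨Nat.prime_two⟩
  haveI := charTwo_of_even hq
  have hq1 := Fintype.one_lt_card (α := F)
  obtain ⟨ι⟩ := exists_emb F k 2
  set K := lift H with hKdef
  have hcK : Nat.card K = Fintype.card F + 1 := by rw [card_lift, dd_even hq, one_mul, hcH]
  have hodd : Odd (Nat.card K) := by rw [hcK]; exact hq.add_one
  have hcomp := borel_complement hq hcK
  have hdec : ∀ g : SL F, ∃ b ∈ slBorel F, ∃ h ∈ K, g = b * h := by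
    intro g
    obtain ⟨⟨b, h⟩, hx⟩ := hcomp.2 g
    exact ⟨b, b.2, h, h.2, hx.symm⟩
  refine hasIp_of_const (pr F) pr_surj (by rw [hcH]; exact hq.add_one.not_two_dvd_nat) ?_
  intro N hne hst hinv
  obtain ⟨A, C, hR⟩ := Rf_eq K hodd
  have hpU : IsPGroup 2 (Ug F) := by
    obtain ⟨n, hn1, hn2⟩ := FiniteField.card F 2
    apply IsPGroup.of_card (n := n)
    rw [card_Ug, Nat.card_eq_fintype_card, hn2]
  obtain ⟨f, hf, hf0, hfix⟩ := exists_fixed_fun (Ug F) hpU N (fun g _ => hst g) hne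
  -- weight projections
  let fi : ℕ → SL F → k := fun i => ∑ c : Fˣ, (ι c ^ 2) ^ i • fun x => f (T c * x)
  have hfi : ∀ i x, fi i x = ∑ c : Fˣ, (ι c ^ 2) ^ i * f (T c * x) := by
    intro i x
    simp [fi, Finset.sum_apply]
  have hfiN : ∀ i, fi i ∈ N := fun i =>
    N.sum_mem fun c _ => N.smul_mem _ (hst (T c) f hf)
  have hex : ∃ i, i + 2 ≤ Fintype.card F ∧ fi i ≠ 0 := by
    by_contra hcon
    push Not at hcon
    apply hf0
    ext x
    have h1 : ∑ i ∈ Finset.range (Fintype.card F - 1), fi i x = 0 := by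
      apply Finset.sum_eq_zero
      intro i hi
      rw [Finset.mem_range] at hi
      rw [hcon i (by omega)]; rfl
    simp_rw [hfi] at h1
    rw [Finset.sum_comm] at h1
    simp_rw [← Finset.sum_mul] at h1
    have h2 : ∀ c : Fˣ, (∑ i ∈ Finset.range (Fintype.card F - 1), (ι c ^ 2) ^ i) =
        if c = 1 then 1 else 0 := by
      intro c
      split_ifs with h
      · rw [h]
        simp only [Units.val_one, map_one, one_pow, Finset.sum_const, Finset.card_range, nsmul_eq_mul,
          mul_one]
        have h3 : ((Fintype.card F - 1 + 1 : ℕ) : k) = 0 := by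
          rw [CharP.cast_eq_zero_iff k 2]
          obtain ⟨c, hc⟩ := hq
          omega
        push_cast at h3
        rw [← sub_eq_zero, ← h3]
        have : (2 : k) = 0 := CharTwo.two_eq_zero
        linear_combination -this
      · have h3 : ι c ^ 2 ≠ 1 := by
          rw [← map_pow, ← map_one ι]
          intro h4
          have h5 := ι.injective h4
          apply h
          ext
          have h6 : ((c : F) - 1) ^ 2 = 0 := by
            rw [sub_sq, h5]
            have : (2 : F) = 0 := CharTwo.two_eq_zero
            linear_combination (1 - (c : F)) * this
          simpa using sub_eq_zero.1 (pow_eq_zero_iff (two_ne_zero) |>.1 h6)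
        rw [geom_sum_eq h3]
        have h7 : (ι (c : F) ^ 2) ^ (Fintype.card F - 1) = 1 := by
          rw [← map_pow, ← map_pow, ← pow_mul, mul_comm, pow_mul,
            FiniteField.pow_card_sub_one_eq_one _ c.ne_zero, one_pow, map_one]
        rw [h7, sub_self, zero_div]
    simp_rw [h2] at h1
    simp only [ite_mul, one_mul, zero_mul, Finset.sum_ite_eq', Finset.mem_univ, if_true] at h1
    have hT1 : (T 1 : SL F) = 1 := by
      apply sl_ext <;> simp [T00, T01, T10, T11]
    rwa [hT1, one_mul] at h1
  obtain ⟨i, hi, hfi0⟩ := hex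
  have hval : ∀ (t : F) (a : Fˣ), ∀ h ∈ K, (ι a ^ 2) ^ i * fi i (U t * T a * h) = fi i 1 := by
    intro t a h hh
    have e1 : fi i (U t * T a * h) = fi i (U t * T a) := hinv _ (hfiN i) _ h hh
    rw [e1, hfi, hfi, Finset.mul_sum]
    refine Fintype.sum_equiv (Equiv.mulRight a) _ _ ?_
    intro c
    simp only [Equiv.coe_mulRight, mul_one]
    rw [← mul_assoc (T c), T_mul_U, mul_assoc, T_mul, hfix _ ⟨_, rfl⟩]
    push_cast
    rw [map_mul]
    ring
  have hRval : ∀ (t : F) (a : Fˣ), ∀ h ∈ K, (a : F) ^ 2 * Rf K (U t * T a * h)⁻¹ = A := by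
    intro t a h hh
    rw [_root_.mul_inv_rev, Rf_inv K (K.inv_mem hh), hR, inv00, inv10, mul10, mul11, U10, U11, T10, T11, T01]
    have : (a : F) * ((a⁻¹ : Fˣ) : F) = 1 := by simp
    linear_combination A * ((a : F) * ((a⁻¹ : Fˣ) : F) + 1) * this
  have hA : A ≠ 0 := by
    intro hA
    have hz : ∀ g : SL F, Rf K g⁻¹ = 0 := by
      intro g
      obtain ⟨b, hb, h, hh, rfl⟩ := hdec g
      obtain ⟨t, a, rfl, -⟩ := borel_eq hb
      have := hRval t a h hh
      rw [hA] at this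
      exact (mul_eq_zero.1 this).resolve_left (pow_ne_zero _ a.ne_zero)
    have h1 := hz w0⁻¹
    have h2 := hz (U 1 * w0)⁻¹
    rw [inv_inv, hR, w00, w10, hA] at h1
    rw [inv_inv, hR, Uw00, Uw10, hA] at h2
    have h3 : (1 : F) = 0 := by linear_combination h2 - h1
    exact one_ne_zero h3
  have hprop : ∀ g, ι A ^ i * fi i g = fi i 1 * ι (Rf K g⁻¹) ^ i := by
    intro g
    obtain ⟨b, hb, h, hh, rfl⟩ := hdec g
    obtain ⟨t, a, rfl, -⟩ := borel_eq hb
    rw [← hRval t a h hh, ← hval t a h hh, map_mul, map_pow]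
    ring
  have hf1 : fi i 1 ≠ 0 := by
    intro h
    apply hfi0
    ext g
    have := hprop g
    rw [h, zero_mul] at this
    refine (mul_eq_zero.1 this).resolve_left (pow_ne_zero _ ?_)
    exact (map_ne_zero ι).2 hA
  have hψ : (fun g => ι (Rf K g⁻¹) ^ i) ∈ N := by
    have : (fun g => ι (Rf K g⁻¹) ^ i) = ((fi i 1)⁻¹ * ι A ^ i) • fi i := by
      ext g
      rw [Pi.smul_apply, smul_eq_mul, mul_assoc, hprop, inv_mul_cancel_left₀ hf1]
    rw [this]
    exact N.smul_mem _ (hfiN i)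
  have hfin : (∑ z : Fˣ, ι ((z⁻¹ : Fˣ) : F) ^ i •
      fun g => ι (Rf K ((U (z : F) * w0)⁻¹ * g)⁻¹) ^ i) = fun _ => (1 : k) := by
    ext g
    rw [Finset.sum_apply]
    simp only [Pi.smul_apply, smul_eq_mul]
    set y := g⁻¹ with hy
    have h1 : ∀ z : Fˣ, ι ((z⁻¹ : Fˣ) : F) ^ i * ι (Rf K ((U (z : F) * w0)⁻¹ * g)⁻¹) ^ i =
        ι (((z⁻¹ : Fˣ) : F) ^ i * ((A * y 0 0 ^ 2 + y 0 0 * y 1 0 + C * y 1 0 ^ 2) * z ^ 2 + z +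
          (A * y 0 1 ^ 2 + y 0 1 * y 1 1 + C * y 1 1 ^ 2)) ^ i) := by
      intro z
      rw [map_mul, map_pow, map_pow]
      congr 3
      rw [_root_.mul_inv_rev, inv_inv, hR, ← hy, mul00 y, mul10 y, Uw00, Uw10]
      have := det1 y
      have h2 : (2 : F) = 0 := CharTwo.two_eq_zero
      linear_combination (z : F) * this + ((z : F) * (y 0 1 * y 1 0 + A * y 0 0 * y 0 1 + C * y 1 0 * y 1 1)) * h2
    simp_rw [h1]
    rw [← map_sum, sum_central _ _ hi, map_one]
  rw [← hfin]
  exact N.sum_mem fun z _ => N.smul_mem _ (hst _ _ hψ)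

end Case6If

end Ip
namespace Ip

section Case2If

variable {F}

lemma zmod2_add : ∀ a b : ZMod 2, (a + b = 0 ↔ (a = 0 ↔ b = 0)) := by decide

lemma exists_char2 (F : Type) [Field F] [CharP F 2] (k : Type*) [Field k] (h2 : (2 : k) ≠ 0) :
    ∃ ψ : F → k, (∀ x y, ψ (x + y) = ψ x * ψ y) ∧ ψ 0 = 1 ∧ ∃ x, ψ x ≠ 1 := by
  haveI : Fact (Nat.Prime 2) := ⟨Nat.prime_two⟩
  letI := ZMod.algebra F 2
  obtain ⟨l, hl⟩ := Module.Projective.exists_dual_ne_zero (ZMod 2) (one_ne_zero : (1 : F) ≠ 0)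
  refine ⟨fun x => if l x = 0 then 1 else -1, ?_, by simp, 1, ?_⟩
  · intro x y
    have h : ∀ a b : ZMod 2, (if a + b = 0 then (1 : k) else -1) =
        (if a = 0 then 1 else -1) * (if b = 0 then 1 else -1) := by
      intro a b
      by_cases ha : a = 0 <;> by_cases hb : b = 0 <;> simp [zmod2_add, ha, hb]
    simp only [map_add]
    exact h _ _
  · simp only [hl, if_false]
    intro h
    apply h2
    linear_combination -h

lemma sqrt_two [Fintype F] [CharP F 2] (x : F) : ∃ y, y ^ 2 = x := by
  obtain ⟨y, hy⟩ := FiniteField.isSquare_of_char_two (ringChar.eq F 2) x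
  exact ⟨y, by rw [hy, sq]⟩

set_option maxHeartbeats 2000000 in
lemma hasIp_case2 {k : Type*} [Field k] [Fintype F] {p : ℕ} [Fact p.Prime] [CharP k p]
    (hq : Even (Fintype.card F)) (hq4 : 4 ≤ Fintype.card F)
    (hp : p = Fintype.card F - 1) {H : Subgroup (PSL2 F)} {N0 : Subgroup (SL F)}
    (hN0 : N0 ≤ lift H) (hcN : Nat.card N0 = Fintype.card F + 1)
    (hcH : Nat.card H = 2 * (Fintype.card F + 1)) : HasIp k p H := by
  classical
  have hpp : p.Prime := Fact.out
  haveI := charTwo_of_even hq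
  obtain ⟨c, hc⟩ := id hq
  set K := lift H with hKdef
  have hcK : Nat.card K = 2 * (Fintype.card F + 1) := by rw [card_lift, dd_even hq, one_mul, hcH]
  have hpK : ¬ p ∣ 2 * (Fintype.card F + 1) := by
    intro h
    rcases hpp.dvd_mul.1 h with h | h
    · have := Nat.le_of_dvd two_pos h
      omega
    · have h1 : p ∣ 2 := by
        have := Nat.dvd_sub h (dvd_refl p)
        have h2 : Fintype.card F + 1 - p = 2 := by omega
        rwa [h2] at this
      have := Nat.le_of_dvd two_pos h1
      omega
  have hpH : ¬ p ∣ Nat.card H := by rwa [hcH]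
  have h2k : (2 : k) ≠ 0 := by
    intro h
    have := (CharP.cast_eq_zero_iff k p 2).1 (by exact_mod_cast h)
    exact hpK (Dvd.dvd.mul_right this _)
  obtain ⟨ψ, hψ, hψ0, x1, hx1⟩ := exists_char2 F k h2k
  have hcomp := borel_complement hq hcN
  have hdec : ∀ g : SL F, ∃ b ∈ slBorel F, ∃ h ∈ N0, g = b * h := by
    intro g
    obtain ⟨⟨b, h⟩, hx⟩ := hcomp.2 g
    exact ⟨b, b.2, h, h.2, hx.symm⟩
  obtain ⟨A, C, hR⟩ := Rf_eq N0 (by rw [hcN]; exact hq.add_one)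
  -- squares of invariant linear forms vanish
  have hlin : ∀ α γ : F, (∀ h ∈ N0, ∀ s : SL F, α * (h * s) 0 0 ^ 2 + γ * (h * s) 1 0 ^ 2 =
      α * s 0 0 ^ 2 + γ * s 1 0 ^ 2) → α = 0 ∧ γ = 0 := by
    intro α γ hinv
    have hval : ∀ s : SL F, ∃ a : F, a ≠ 0 ∧ α * s 0 0 ^ 2 + γ * s 1 0 ^ 2 = α * a ^ 2 := by
      intro s
      obtain ⟨b, hb, h, hh, hs⟩ := hdec s⁻¹
      obtain ⟨h1, h2⟩ := borel_inv ((mem_borel _).1 (inv_mem hb))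
      refine ⟨b⁻¹ 0 0, h2, ?_⟩
      have hs' : s = h⁻¹ * b⁻¹ := by rw [← _root_.mul_inv_rev, ← hs, inv_inv]
      rw [hs', hinv _ (inv_mem hh), (mem_borel _).1 (inv_mem hb)]
      ring
    have hα : α = 0 := by
      by_contra hα
      obtain ⟨x, hx⟩ := sqrt_two γ
      obtain ⟨y, hy⟩ := sqrt_two α
      have hy0 : y ≠ 0 := by rintro rfl; exact hα (by rw [← hy]; ring)
      obtain ⟨s, hs1, hs2⟩ := exists_col x y (Or.inr hy0)
      obtain ⟨a, ha, h3⟩ := hval s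
      rw [hs1, hs2, ← hx, ← hy] at h3
      have h4 : (2 : F) = 0 := CharTwo.two_eq_zero
      have h5 : y ^ 2 * a ^ 2 = 0 := by linear_combination -h3 + x ^ 2 * y ^ 2 * h4
      rcases mul_eq_zero.1 h5 with h | h
      · exact hy0 (pow_eq_zero_iff two_ne_zero |>.1 h)
      · exact ha (pow_eq_zero_iff two_ne_zero |>.1 h)
    refine ⟨hα, ?_⟩
    obtain ⟨a, ha, h3⟩ := hval w0
    rw [hα, w00, w10] at h3
    linear_combination h3
  have hA : A ≠ 0 := by
    intro hA
    have hz : ∀ s : SL F, Rf N0 s = 0 := by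
      intro s
      obtain ⟨b, hb, h, hh, hs⟩ := hdec s⁻¹
      have hs' : s = h⁻¹ * b⁻¹ := by rw [← _root_.mul_inv_rev, ← hs, inv_inv]
      rw [hs', Rf_inv _ (inv_mem hh), hR, hA, (mem_borel _).1 (inv_mem hb)]
      ring
    have h1 := hz w0
    have h2 := hz (U 1 * w0)
    rw [hR, w00, w10, hA] at h1
    rw [hR, Uw00, Uw10, hA] at h2
    have h3 : (1 : F) = 0 := by linear_combination h2 - h1
    exact one_ne_zero h3
  -- expansion of the form
  have hexp : ∀ y s : SL F, Rf N0 (y * s) =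
      Rf N0 y * s 0 0 ^ 2 + s 0 0 * s 1 0 + Rf N0 (y * w0) * s 1 0 ^ 2 := by
    intro y s
    rw [hR, hR, hR, mul00 y s, mul10 y s, mul00 y w0, mul10 y w0, w00, w10]
    have := det1 y
    have h2 : (2 : F) = 0 := CharTwo.two_eq_zero
    linear_combination (s 0 0 * s 1 0) * this +
      (s 0 0 * s 1 0 * (y 0 1 * y 1 0 + A * y 0 0 * y 0 1 + C * y 1 0 * y 1 1)) * h2
  have hnorm : ∀ s ∈ K, ∀ n ∈ N0, s⁻¹ * n * s ∈ N0 := by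
    intro s hs n hn
    have hidx : (N0.subgroupOf K).index = 2 := by
      have h1 := Subgroup.index_mul_card (N0.subgroupOf K)
      rw [Nat.card_congr (Subgroup.subgroupOfEquivOfLe hN0).toEquiv, hcN, hcK] at h1
      exact Nat.eq_of_mul_eq_mul_right (by omega) h1
    have hnor := Subgroup.normal_of_index_eq_two hidx
    have := hnor.conj_mem ⟨n, hN0 hn⟩ hn ⟨s, hs⟩⁻¹
    simpa [Subgroup.mem_subgroupOf] using this
  have hRK : ∀ h ∈ K, ∀ s, Rf N0 (h * s) = Rf N0 s := by
    intro h hh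
    have h1 := hlin (Rf N0 h - A) (Rf N0 (h * w0) - C) (by
      intro n hn s
      have e1 : Rf N0 (h * (n * s)) = Rf N0 (h * s) := by
        have : h * (n * s) = (h⁻¹⁻¹ * n * h⁻¹) * (h * s) := by group
        rw [this, Rf_inv _ (hnorm _ (inv_mem hh) n hn)]
      have e2 : Rf N0 (n * s) = Rf N0 s := Rf_inv _ hn s
      rw [hexp h (n * s), hexp h s] at e1
      rw [hR (n * s), hR s] at e2
      linear_combination e1 - e2)
    intro s
    rw [hexp h s, hR s, sub_eq_zero.1 h1.1, sub_eq_zero.1 h1.2]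
  -- the stabilizer
  have hStab : ∀ g : SL F, (∀ s, Rf N0 (g * s) = Rf N0 s) → g ∈ K := by
    let St : Subgroup (SL F) :=
      { carrier := {g | ∀ s, Rf N0 (g * s) = Rf N0 s}
        one_mem' := by intro s; rw [one_mul]
        mul_mem' := by
          intro a b ha hb s
          rw [mul_assoc, ha, hb]
        inv_mem' := by
          intro a ha s
          rw [← ha (a⁻¹ * s), mul_inv_cancel_left] }
    have hKS : K ≤ St := fun h hh => hRK h hh
    have hcard : Nat.card St ≤ 2 * (Fintype.card F + 1) := by
      have hs2 : ∀ g : St, ∃ x : (({U 0, U A⁻¹} : Finset (SL F))) × N0,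
          (x.1 : SL F) * (x.2 : SL F) = g := by
        rintro ⟨g, hg⟩
        obtain ⟨b, hb, n, hn, rfl⟩ := hdec g
        have hbS : b ∈ St := by
          have := St.mul_mem hg (St.inv_mem (hKS (hN0 hn)))
          rwa [mul_inv_cancel_right] at this
        obtain ⟨t, a, rfl, -⟩ := borel_eq hb
        have e1 : Rf N0 (U t * T a * 1) = Rf N0 1 := hbS 1
        have e2 : Rf N0 (U t * T a * w0) = Rf N0 w0 := hbS w0
        rw [mul_one, hR, hR, mul00, mul10, U00, U01, U10, U11, T00, T10, one00, one10] at e1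
        have ha1 : a = 1 := by
          ext
          have h6 : ((a : F) - 1) ^ 2 = 0 := by
            have h7 : A * (((a : F)) ^ 2 - 1) = 0 := by linear_combination e1
            have h8 := (mul_eq_zero.1 h7).resolve_left hA
            have : (2 : F) = 0 := CharTwo.two_eq_zero
            linear_combination h8 + (1 - (a : F)) * this
          simpa using sub_eq_zero.1 (pow_eq_zero_iff (two_ne_zero) |>.1 h6)
        have hT1 : (T 1 : SL F) = 1 := by
          apply sl_ext <;> simp [T00, T01, T10, T11]
        rw [ha1, hT1, mul_one] at e2
        simp only [ha1, hT1, mul_one]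
        rw [hR, hR, Uw00, Uw10, w00, w10] at e2
        have h9 : t * (A * t + 1) = 0 := by linear_combination e2
        refine ⟨⟨⟨U t, ?_⟩, ⟨n, hn⟩⟩, rfl⟩
        rw [Finset.mem_insert, Finset.mem_singleton]
        rcases mul_eq_zero.1 h9 with h | h
        · left; rw [h]
        · right
          congr 1
          field_simp
          have : (2 : F) = 0 := CharTwo.two_eq_zero
          linear_combination h - this
      choose φ hφ using hs2
      have hinj : Function.Injective (fun g : St => φ g) := by
        intro g g' h
        apply Subtype.ext
        rw [← hφ g, ← hφ g']
        simp only at h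
        rw [h]
      have h1 := Nat.card_le_card_of_injective _ hinj
      rw [Nat.card_prod, hcN] at h1
      refine h1.trans (Nat.mul_le_mul_right _ ?_)
      rw [Nat.card_eq_fintype_card, Fintype.card_coe]
      exact Finset.card_le_two
    have : K = St := Subgroup.eq_of_le_of_card_ge hKS (by rw [hcK]; exact hcard)
    intro g hg
    rw [this]
    exact hg
  refine hasIp_of_const (pr F) pr_surj hpH ?_
  intro N hne hst hinv
  have hinvK : ∀ f ∈ N, ∀ s : SL F, ∀ h ∈ K, f (s * h) = f s := fun f hf s h hh => hinv f hf s h hh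
  -- some value of the transform is nonzero
  have hTh : ∀ f ∈ N, f ≠ 0 → ∃ x z : F,
      ∑ g : SL F, f g * ψ (Rf N0 g⁻¹ * x ^ 2 + x * z + Rf N0 (g⁻¹ * w0) * z ^ 2) ≠ 0 := by
    intro f hf hf0
    by_contra hcon
    push Not at hcon
    apply hf0
    let χ : F × F → (Multiplicative (F × F) →* k) := fun c =>
      { toFun := fun v => ψ (c.1 * v.toAdd.1 ^ 2 + c.2 * v.toAdd.2 ^ 2)
        map_one' := by simp [hψ0]
        map_mul' := by
          intro v w
          rw [← hψ]
          congr 1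
          simp only [toAdd_mul, Prod.fst_add, Prod.snd_add]
          have : (2 : F) = 0 := CharTwo.two_eq_zero
          linear_combination (c.1 * v.toAdd.1 * w.toAdd.1 + c.2 * v.toAdd.2 * w.toAdd.2) * this }
    have hχ : Function.Injective χ := by
      have key : ∀ a b : F, (∀ x, ψ (a * x ^ 2) = ψ (b * x ^ 2)) → a = b := by
        intro a b h
        by_contra hab
        have hab' : a - b ≠ 0 := sub_ne_zero.2 hab
        obtain ⟨x, hx⟩ := sqrt_two (x1 / (a - b))
        apply hx1
        have e1 : x1 = a * x ^ 2 + b * x ^ 2 := by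
          rw [hx]
          have h2 : (2 : F) = 0 := CharTwo.two_eq_zero
          field_simp
          linear_combination -x1 * b * h2
        rw [e1, hψ, h x, ← hψ, CharTwo.add_self_eq_zero, hψ0]
      intro c c' h
      ext
      · apply key
        intro x
        have := DFunLike.congr_fun h (Multiplicative.ofAdd ((x, 0) : F × F))
        simpa [χ] using this
      · apply key
        intro x
        have := DFunLike.congr_fun h (Multiplicative.ofAdd ((0, x) : F × F))
        simpa [χ] using this
    have hli := (linearIndependent_monoidHom (Multiplicative (F × F)) k).comp χ hχ
    rw [Fintype.linearIndependent_iff] at hli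
    let cf : SL F → F × F := fun g => (Rf N0 g⁻¹, Rf N0 (g⁻¹ * w0))
    have h0 := hli (fun c => ∑ g : SL F with cf g = c, f g) (by
      ext v
      rw [Finset.sum_apply]
      simp only [Function.comp, Pi.smul_apply, smul_eq_mul, Pi.zero_apply, Finset.sum_mul]
      have h1 : ∀ c : F × F, ∀ g ∈ Finset.univ.filter (fun g => cf g = c),
          f g * (χ c) v = f g * (χ (cf g)) v := by
        intro c g hg
        rw [(Finset.mem_filter.1 hg).2]
      rw [Finset.sum_congr rfl (fun c _ => Finset.sum_congr rfl (h1 c))]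
      rw [Finset.sum_fiberwise]
      have h2 := hcon v.toAdd.1 v.toAdd.2
      have h3 : ∀ g : SL F, f g * ψ (Rf N0 g⁻¹ * v.toAdd.1 ^ 2 + v.toAdd.1 * v.toAdd.2 +
          Rf N0 (g⁻¹ * w0) * v.toAdd.2 ^ 2) =
          (f g * (χ (cf g)) v) * ψ (v.toAdd.1 * v.toAdd.2) := by
        intro g
        rw [mul_assoc]
        congr 1
        change _ = ψ (Rf N0 g⁻¹ * v.toAdd.1 ^ 2 + Rf N0 (g⁻¹ * w0) * v.toAdd.2 ^ 2) * _
        rw [← hψ]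
        congr 1
        ring
      simp_rw [h3] at h2
      rw [← Finset.sum_mul] at h2
      refine (mul_eq_zero.1 h2).resolve_right ?_
      intro h4
      have h5 := hψ (v.toAdd.1 * v.toAdd.2) (v.toAdd.1 * v.toAdd.2)
      rw [CharTwo.add_self_eq_zero, hψ0, h4] at h5
      simp at h5)
    ext g0
    have h1 := h0 (cf g0)
    have hiff : ∀ g, cf g = cf g0 ↔ g0⁻¹ * g ∈ K := by
      intro g
      constructor
      · intro h
        have e1 : Rf N0 g⁻¹ = Rf N0 g0⁻¹ := congrArg Prod.fst h
        have e2 : Rf N0 (g⁻¹ * w0) = Rf N0 (g0⁻¹ * w0) := congrArg Prod.snd h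
        rw [← inv_mem_iff]
        apply hStab
        intro s
        have e3 : Rf N0 (g⁻¹ * (g0 * s)) = Rf N0 (g0⁻¹ * (g0 * s)) := by
          rw [hexp, hexp g0⁻¹, e1, e2]
        rw [inv_mul_cancel_left] at e3
        rw [← e3]
        congr 1
        group
      · intro h
        have hg : g⁻¹ = (g0⁻¹ * g)⁻¹ * g0⁻¹ := by group
        ext
        · change Rf N0 g⁻¹ = _
          rw [hg, hRK _ (inv_mem h)]
        · change Rf N0 (g⁻¹ * w0) = _
          rw [hg, mul_assoc, hRK _ (inv_mem h)]
    have h2 : ∑ g : SL F with cf g = cf g0, f g = (Nat.card K : k) * f g0 := by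
      have h3 : ∀ g ∈ Finset.univ.filter (fun g => cf g = cf g0), f g = f g0 := by
        intro g hg
        have := (hiff g).1 (Finset.mem_filter.1 hg).2
        rw [← hinvK f hf g0 _ this, mul_inv_cancel_left]
      rw [Finset.sum_congr rfl h3, Finset.sum_const, nsmul_eq_mul]
      congr 2
      rw [Nat.card_eq_fintype_card, ← Finset.card_univ]
      symm
      refine Finset.card_bij (fun (h : K) _ => g0 * (h : SL F)) ?_ ?_ ?_
      · intro h _
        rw [Finset.mem_filter]
        refine ⟨Finset.mem_univ _, (hiff _).2 ?_⟩
        rw [inv_mul_cancel_left]; exact h.2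
      · intro h _ h' _ he
        exact Subtype.ext (mul_left_cancel he)
      · intro g hg
        exact ⟨⟨_, (hiff g).1 (Finset.mem_filter.1 hg).2⟩, Finset.mem_univ _, mul_inv_cancel_left _ _⟩
    rw [h2] at h1
    refine (mul_eq_zero.1 h1).resolve_left ?_
    rw [hcK]
    intro h
    exact hpK ((CharP.cast_eq_zero_iff k p _).1 h)
  obtain ⟨f, hf, hf0⟩ := Submodule.exists_mem_ne_zero_of_ne_bot hne
  obtain ⟨x, z, hxz⟩ := hTh f hf hf0
  by_cases hv : x ≠ 0 ∨ z ≠ 0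
  swap
  · push Not at hv
    rw [hv.1, hv.2] at hxz
    simp only [ne_eq, OfNat.ofNat_ne_zero, not_false_eq_true, zero_pow, mul_zero, add_zero, hψ0,
      mul_one] at hxz
    have h1 : (∑ s : SL F, fun y => f (s * y)) = (∑ g : SL F, f g) • fun _ => (1 : k) := by
      ext y
      rw [Finset.sum_apply]
      simp only [Pi.smul_apply, smul_eq_mul, mul_one]
      exact Fintype.sum_equiv (Equiv.mulRight y) _ _ (fun s => rfl)
    have h2 : (∑ s : SL F, fun y => f (s * y)) ∈ N := N.sum_mem fun s _ => hst s f hf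
    rw [h1] at h2
    have h3 := N.smul_mem (∑ g : SL F, f g)⁻¹ h2
    rwa [smul_smul, inv_mul_cancel₀ hxz, one_smul] at h3
  obtain ⟨s0, hs1, hs2⟩ := exists_col x z hv
  have hxz2 : ∑ g : SL F, f (s0 * g) * ψ (Rf N0 g⁻¹) ≠ 0 := by
    intro h
    apply hxz
    rw [← h]
    refine Fintype.sum_equiv (Equiv.mulLeft s0⁻¹) _ _ ?_
    intro g
    simp only [Equiv.coe_mulLeft]
    rw [mul_inv_cancel_left, _root_.mul_inv_rev, inv_inv, hexp g⁻¹ s0, hs1, hs2]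
  -- unipotent average
  let f2 : SL F → k := ∑ t : F, fun y => f (s0 * (U t * y))
  have hf2 : ∀ y, f2 y = ∑ t : F, f (s0 * (U t * y)) := by
    intro y; simp [f2, Finset.sum_apply]
  let N' : Submodule k (SL F → k) := N ⊓
    { carrier := {f | ∀ t : F, ∀ y, f (U t * y) = f y}
      add_mem' := by
        intro f g hf hg t y
        simp [hf t y, hg t y]
      zero_mem' := by intro t y; rfl
      smul_mem' := by intro c f hf t y; simp [hf t y] }
  have hf2N : f2 ∈ N' := by
    refine ⟨N.sum_mem fun t _ => hst (U t) _ (hst s0 f hf), ?_⟩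
    intro t y
    rw [hf2, hf2]
    refine Fintype.sum_equiv (Equiv.addRight t) _ _ ?_
    intro u
    simp only [Equiv.coe_addRight]
    rw [← mul_assoc (U u), U_mul]
  have hf20 : f2 ≠ 0 := by
    intro h
    have h1 : ∑ g : SL F, f2 g * ψ (Rf N0 g⁻¹) = 0 := by rw [h]; simp
    simp_rw [hf2, Finset.sum_mul] at h1
    rw [Finset.sum_comm] at h1
    have h2 : ∀ t : F, ∑ g : SL F, f (s0 * (U t * g)) * ψ (Rf N0 g⁻¹) =
        ∑ g : SL F, f (s0 * g) * ψ (Rf N0 g⁻¹) := by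
      intro t
      refine Fintype.sum_equiv (Equiv.mulLeft (U t)) _ _ ?_
      intro g
      simp only [Equiv.coe_mulLeft]
      congr 2
      rw [hR, hR, _root_.mul_inv_rev, mul00, mul10, inv00 (U t), inv10 (U t), U11, U10]
      ring
    simp_rw [h2] at h1
    rw [Finset.sum_const, Finset.card_univ, nsmul_eq_mul] at h1
    rcases mul_eq_zero.1 h1 with h3 | h3
    · have h4 := (CharP.cast_eq_zero_iff k p _).1 h3
      have h5 : p ∣ 1 := by
        have := Nat.dvd_sub h4 (dvd_refl p)
        have h6 : Fintype.card F - p = 1 := by omega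
        rwa [h6] at this
      exact hpp.one_lt.ne' (Nat.dvd_one.1 h5)
    · exact hxz2 h3
  let Tg : Subgroup (SL F) :=
    { carrier := Set.range T
      one_mem' := ⟨1, by apply sl_ext <;> simp [T00, T01, T10, T11]⟩
      mul_mem' := by
        rintro _ _ ⟨s, rfl⟩ ⟨t, rfl⟩
        exact ⟨s * t, (T_mul s t).symm⟩
      inv_mem' := by
        rintro _ ⟨s, rfl⟩
        refine ⟨s⁻¹, ?_⟩
        rw [eq_inv_iff_mul_eq_one, T_mul, inv_mul_cancel]
        apply sl_ext <;> simp [T00, T01, T10, T11] }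
  have hTp : IsPGroup p Tg := by
    apply IsPGroup.of_card (n := 1)
    have hTi : Function.Injective (T : Fˣ → SL F) := by
      intro a b h
      ext
      exact congrArg (fun x : SL F => x 0 0) h
    have h1 : Nat.card Tg = Nat.card Fˣ := (Nat.card_congr (Equiv.ofInjective T hTi)).symm
    rw [h1, Nat.card_eq_fintype_card, Fintype.card_units, pow_one, hp]
  obtain ⟨f3, hf3, hf30, hfix⟩ := exists_fixed_fun Tg hTp N' (by
    rintro _ ⟨a, rfl⟩ g ⟨hg1, hg2⟩
    refine ⟨hst _ _ hg1, ?_⟩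
    intro t y
    simp only
    rw [← mul_assoc, T_mul_U, mul_assoc]
    exact hg2 _ _) (by
    intro h
    rw [h, Submodule.mem_bot] at hf2N
    exact hf20 hf2N)
  have hconst : ∀ g, f3 g = f3 1 := by
    intro g
    obtain ⟨b, hb, h, hh, rfl⟩ := hdec g
    obtain ⟨t, a, rfl, -⟩ := borel_eq hb
    rw [mul_assoc, hf3.2 t, hfix _ ⟨a, rfl⟩]
    have := hinvK f3 hf3.1 1 h (hN0 hh)
    rwa [one_mul] at this
  have h1 : f3 1 ≠ 0 := by
    intro h
    apply hf30
    ext y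
    rw [hconst, h]; rfl
  have h2 : (fun _ => (1 : k)) = (f3 1)⁻¹ • f3 := by
    ext y
    rw [Pi.smul_apply, hconst y, smul_eq_mul, inv_mul_cancel₀ h1]
  rw [h2]
  exact N.smul_mem _ hf3.1

end Case2If

end Ip
namespace Ip

section Trans

variable {F}

lemma sum_U_smul [Fintype F] {M : Type*} [AddCommMonoid M] (f : P1 F → M) {x : P1 F}
    (hx : x ≠ pt none) : ∑ t : F, f (U t • x) = ∑ t : F, f (pt (some t)) := by
  obtain ⟨o, rfl⟩ := pt_bij.2 x
  cases o with
  | none => exact absurd rfl hx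
  | some s =>
    refine Fintype.sum_equiv (Equiv.addRight s) _ _ ?_
    intro t
    rw [U_smul_some]; rfl

lemma no_inv_fun {k : Type*} [Field k] [Fintype F] {p : ℕ} [CharP k p] {H : Subgroup (PSL2 F)}
    (hH : HasIp k p H) (hpq : ¬ p ∣ Fintype.card F + 1) (Φ : P1 F → k)
    (hΦ : ∀ h ∈ lift H, ∀ y, Φ (h • y) = Φ y) (hsum : ∑ y, Φ y = 0) : Φ = 0 := by
  classical
  by_contra hne
  obtain ⟨w, hw⟩ := exists_weights hH Φ hΦ hne
  obtain ⟨y0, hy0⟩ : ∃ y, Φ y ≠ 0 := by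
    by_contra h
    push Not at h
    exact hne (funext h)
  obtain ⟨g0, rfl⟩ := QuotientGroup.mk_surjective y0
  have hg0 : g0 • (pt none : P1 F) = (g0 : P1 F) := by
    change ((g0 * 1 : SL F) : P1 F) = _
    rw [mul_one]
  have hq1 : ((Fintype.card F : k) + 1) ≠ 0 := by
    intro h
    apply hpq
    rw [← CharP.cast_eq_zero_iff k p]
    exact_mod_cast h
  have key : ∀ g : SL F, Φ (g0 : P1 F) * (((Fintype.card F : k) + 1) * w (g : P1 F) - ∑ y, w y)
      = Fintype.card F := by
    intro g
    have h1 : ∑ t : F, ∑ y, w y * Φ ((g0 * U t * g⁻¹) • y) = Fintype.card F := by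
      simp_rw [hw]
      simp
    rw [Finset.sum_comm] at h1
    refine Eq.trans ?_ h1
    have h2 : ∀ y, ∑ t : F, w y * Φ ((g0 * U t * g⁻¹) • y) =
        Φ (g0 : P1 F) * ((if y = (g : P1 F) then (Fintype.card F + 1) * w y else 0) - w y) := by
      intro y
      rw [← Finset.mul_sum]
      have h3 : ∀ t : F, Φ ((g0 * U t * g⁻¹) • y) = (fun z => Φ (g0 • z)) (U t • (g⁻¹ • y)) := by
        intro t
        simp only [mul_smul]
      simp_rw [h3]
      split_ifs with hy
      · have h4 : g⁻¹ • y = pt none := by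
          rw [hy]
          change ((g⁻¹ * g : SL F) : P1 F) = _
          rw [inv_mul_cancel]; rfl
        simp only [h4, U_smul_none, hg0, Finset.sum_const, Finset.card_univ, nsmul_eq_mul]
        ring
      · have h4 : g⁻¹ • y ≠ pt none := by
          intro h
          apply hy
          rw [inv_smul_eq_iff] at h
          rw [h]
          change ((g * 1 : SL F) : P1 F) = _
          rw [mul_one]
        have h5 := sum_U_smul (fun z => Φ (g0 • z)) h4
        rw [h5]
        have h6 : ∑ z : P1 F, Φ (g0 • z) = 0 := by
          rw [← hsum]
          exact Fintype.sum_equiv (MulAction.toPerm g0) _ _ (fun _ => rfl)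
        rw [sum_P1, hg0] at h6
        rw [eq_neg_of_add_eq_zero_right h6]
        ring
    simp_rw [h2]
    rw [← Finset.mul_sum, Finset.sum_sub_distrib, Finset.sum_ite_eq' Finset.univ (g : P1 F)]
    simp
  have hconst : ∀ y, w y = w (g0 : P1 F) := by
    intro y
    obtain ⟨g, rfl⟩ := QuotientGroup.mk_surjective y
    have h1 := (key g).trans (key g0).symm
    have h2 := mul_left_cancel₀ hy0 h1
    have h3 : ((Fintype.card F : k) + 1) * w (g : P1 F) = ((Fintype.card F : k) + 1) * w (g0 : P1 F) := by
      linear_combination h2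
    exact mul_left_cancel₀ hq1 h3
  have h1 := hw 1
  simp only [one_smul, hconst] at h1
  rw [← Finset.mul_sum, hsum, mul_zero] at h1
  exact zero_ne_one h1

lemma isTrans {k : Type*} [Field k] [Fintype F] {p : ℕ} [CharP k p] {H : Subgroup (PSL2 F)}
    (hH : HasIp k p H) (hpq : ¬ p ∣ Fintype.card F + 1) :
    MulAction.IsPretransitive (lift H) (P1 F) := by
  classical
  have hq1 : ((Fintype.card F : k) + 1) ≠ 0 := by
    intro h
    apply hpq
    rw [← CharP.cast_eq_zero_iff k p]
    exact_mod_cast h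
  have key : ∀ x : P1 F, MulAction.orbit (lift H) x = Set.univ := by
    intro x
    let O : Finset (P1 F) := Finset.univ.filter (fun y => y ∈ MulAction.orbit (lift H) x)
    have hz := no_inv_fun hH hpq
      (fun y => ((Fintype.card F : k) + 1) * (if y ∈ MulAction.orbit (lift H) x then 1 else 0)
        - O.card) (by
        intro h hh y
        have : h • y ∈ MulAction.orbit (lift H) x ↔ y ∈ MulAction.orbit (lift H) x := by
          have e := MulAction.smul_orbit (⟨h, hh⟩ : lift H) x
          conv_lhs => rw [← e]
          exact Set.smul_mem_smul_set_iff (a := (⟨h, hh⟩ : lift H)) (x := y)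
        simp only [this]) (by
        rw [Finset.sum_sub_distrib, ← Finset.mul_sum, Finset.sum_boole, Finset.sum_const,
          Finset.card_univ, card_P1, nsmul_eq_mul]
        push_cast
        ring)
    have h1 := congrFun hz x
    simp only [MulAction.mem_orbit_self, if_true, Pi.zero_apply] at h1
    ext y
    simp only [Set.mem_univ, iff_true]
    by_contra hy
    have h2 := congrFun hz y
    simp only [hy, if_false, Pi.zero_apply] at h2
    apply hq1
    linear_combination h1 - h2
  refine ⟨fun x y => ?_⟩
  have : y ∈ MulAction.orbit (lift H) x := by rw [key]; trivial
  exact this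

end Trans

end Ip
namespace Ip

section Poles

variable {F}

/-- non-rational points of the projective line over the algebraic closure -/
abbrev Np (F : Type) [Field F] := {z : AlgebraicClosure F // z ∉ Set.range (algebraMap F (AlgebraicClosure F))}

/-- coefficient embedding -/
noncomputable abbrev ac (x : F) : AlgebraicClosure F := algebraMap F (AlgebraicClosure F) x

lemma ac_lin (z : Np F) {c d : F} (h : ac c * z.1 + ac d = 0) : c = 0 ∧ d = 0 := by
  by_cases hc : c = 0
  · refine ⟨hc, ?_⟩
    rw [hc] at h
    simpa [ac] using h
  · exfalso
    apply z.2
    refine ⟨-d / c, ?_⟩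
    have : ac c ≠ 0 := by simpa [ac] using hc
    simp only [ac] at this h
    rw [map_div₀, map_neg]
    field_simp
    linear_combination -h

/-- denominator of the Moebius action -/
noncomputable def den (s : SL F) (z : Np F) : AlgebraicClosure F := ac (s 1 0) * z.1 + ac (s 1 1)

/-- numerator of the Moebius action -/
noncomputable def num (s : SL F) (z : Np F) : AlgebraicClosure F := ac (s 0 0) * z.1 + ac (s 0 1)

lemma den_ne (s : SL F) (z : Np F) : den s z ≠ 0 := by
  intro h
  obtain ⟨h1, h2⟩ := ac_lin z h
  have := det1 s
  rw [h1, h2] at this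
  simp at this

lemma ac_det (s : SL F) : ac (s 0 0) * ac (s 1 1) - ac (s 0 1) * ac (s 1 0) = 1 := by
  have := congrArg (algebraMap F (AlgebraicClosure F)) (det1 s)
  simpa [ac] using this

lemma moeb_np (s : SL F) (z : Np F) :
    num s z / den s z ∉ Set.range (algebraMap F (AlgebraicClosure F)) := by
  rintro ⟨r, hr⟩
  have h := den_ne s z
  rw [eq_div_iff h] at hr
  have h2 : ac (s 0 0 - r * s 1 0) * z.1 + ac (s 0 1 - r * s 1 1) = 0 := by
    simp only [ac, map_sub, map_mul]
    simp only [num, den, ac] at hr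
    linear_combination -hr
  obtain ⟨h3, h4⟩ := ac_lin z h2
  have := det1 s
  have h5 : (1 : F) = 0 := by
    linear_combination -this + s 1 1 * h3 - s 1 0 * h4
  exact one_ne_zero h5

noncomputable instance npAction : MulAction (SL F) (Np F) where
  smul s z := ⟨num s z / den s z, moeb_np s z⟩
  one_smul z := by
    apply Subtype.ext
    change num 1 z / den 1 z = z.1
    simp [num, den, ac]
  mul_smul s t z := by
    apply Subtype.ext
    change num (s * t) z / den (s * t) z = num s ⟨num t z / den t z, moeb_np t z⟩ /
      den s ⟨num t z / den t z, moeb_np t z⟩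
    have h1 := den_ne (s * t) z
    have h2 := den_ne t z
    have h3 := den_ne s ⟨num t z / den t z, moeb_np t z⟩
    rw [div_eq_div_iff h1 h3]
    simp only [num, den, ac, mul00, mul01, mul10, mul11, map_add, map_mul] at *
    field_simp
    ring

lemma smul_np (s : SL F) (z : Np F) : (s • z : Np F).1 = num s z / den s z := rfl

lemma smul_np_eq (s : SL F) (z : Np F) : s • z = z ↔ num s z = den s z * z.1 := by
  rw [Subtype.ext_iff, smul_np, div_eq_iff (den_ne s z), mul_comm]

lemma smul_np_quad (s : SL F) (z : Np F) : s • z = z ↔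
    ac (s 1 0) * z.1 ^ 2 + ac (s 1 1 - s 0 0) * z.1 - ac (s 0 1) = 0 := by
  rw [smul_np_eq]
  simp only [num, den, ac, map_sub]
  constructor
  · intro h; linear_combination -h
  · intro h; linear_combination -h

lemma center_smul_np {s : SL F} (hs : s ∈ Subgroup.center (SL F)) (z : Np F) : s • z = z := by
  obtain ⟨h1, h2, h3⟩ := (mem_center s).1 hs
  rw [smul_np_quad, h1, h2, h3]
  simp [ac]

lemma center_smul_P1 {s : SL F} (hs : s ∈ Subgroup.center (SL F)) (x : P1 F) : s • x = x := by
  obtain ⟨h1, h2, h3⟩ := (mem_center s).1 hs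
  obtain ⟨o, rfl⟩ := pt_bij.2 x
  cases o with
  | none => rw [smul_pt_none, h2]
  | some t => rw [smul_pt_some, h1, h2, h3]; ring

open Classical in
/-- number of fixed points -/
lemma fixed_count {s : SL F} (hs : s ∉ Subgroup.center (SL F)) :
    {x : P1 F | s • x = x}.Finite ∧ {z : Np F | s • z = z}.Finite ∧
    {x : P1 F | s • x = x}.ncard + {z : Np F | s • z = z}.ncard +
      (if (s 0 0 + s 1 1) ^ 2 = 4 then 1 else 0) = 2 ∧
      (s 1 0 = 0 → ∀ z : Np F, s • z ≠ z) := by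
  have hdet := det1 s
  by_cases hc : s 1 0 = 0
  · have htr : (s 0 0 + s 1 1) ^ 2 = 4 ↔ s 1 1 - s 0 0 = 0 := by
      rw [← pow_eq_zero_iff (two_ne_zero)]
      rw [hc] at hdet
      constructor
      · intro h; linear_combination h - 4 * hdet
      · intro h; linear_combination h + 4 * hdet
    have hnp : ∀ z : Np F, s • z ≠ z := by
      intro z hz
      rw [smul_np_quad, hc] at hz
      have h1 : ac (s 1 1 - s 0 0) * z.1 + ac (- s 0 1) = 0 := by
        simp only [ac, map_neg, map_zero] at hz ⊢
        linear_combination hz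
      obtain ⟨h2, h3⟩ := ac_lin z h1
      exact hs ((mem_center s).2 ⟨neg_eq_zero.1 h3, hc, (sub_eq_zero.1 h2).symm⟩)
    have hnpe : {z : Np F | s • z = z} = ∅ := by
      ext z
      simpa using hnp z
    have hinf : s • (pt none : P1 F) = pt none := (smul_pt_none s).2 hc
    by_cases had : s 1 1 - s 0 0 = 0
    · have hb : s 0 1 ≠ 0 := fun h => hs ((mem_center s).2 ⟨h, hc, (sub_eq_zero.1 had).symm⟩)
      have hP : {x : P1 F | s • x = x} = {pt none} := by
        ext x
        obtain ⟨o, rfl⟩ := pt_bij.2 x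
        cases o with
        | none => simp [hinf]
        | some t =>
          simp only [Set.mem_setOf_eq, smul_pt_some, hc, Set.mem_singleton_iff, pt_bij.1.eq_iff,
            reduceCtorEq, iff_false]
          intro h
          apply hb
          linear_combination h + t * had
      rw [hP, hnpe, if_pos (htr.2 had)]
      refine ⟨Set.finite_singleton _, Set.finite_empty, ?_, fun _ => hnp⟩
      simp
    · have hP : {x : P1 F | s • x = x} = {pt none, pt (some (s 0 1 / (s 1 1 - s 0 0)))} := by
        ext x
        obtain ⟨o, rfl⟩ := pt_bij.2 x
        cases o with
        | none => simp [hinf]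
        | some t =>
          simp only [Set.mem_setOf_eq, smul_pt_some, hc, Set.mem_insert_iff, Set.mem_singleton_iff,
            pt_bij.1.eq_iff, reduceCtorEq, false_or, Option.some_inj]
          rw [eq_div_iff had]
          constructor
          · intro h; linear_combination -h
          · intro h; linear_combination -h
      rw [hP, hnpe, if_neg (fun h => had (htr.1 h))]
      refine ⟨Set.toFinite _, Set.finite_empty, ?_, fun _ => hnp⟩
      rw [Set.ncard_pair]
      · simp
      · rw [ne_eq, pt_bij.1.eq_iff]; simp
  · have hcE : ac (s 1 0) ≠ 0 := by simpa [ac] using hc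
    obtain ⟨z1, hz1⟩ := IsAlgClosed.exists_root
      (Polynomial.C (ac (s 1 0)) * Polynomial.X ^ 2 + Polynomial.C (ac (s 1 1 - s 0 0)) *
        Polynomial.X + Polynomial.C (- ac (s 0 1))) (by
        rw [Polynomial.degree_quadratic hcE]; decide)
    simp only [Polynomial.IsRoot.def, Polynomial.eval_add, Polynomial.eval_mul, Polynomial.eval_C,
      Polynomial.eval_pow, Polynomial.eval_X] at hz1
    let z2 := ac (s 0 0 - s 1 1) / ac (s 1 0) - z1
    have hz2 : ac (s 1 0) * z2 = ac (s 0 0 - s 1 1) - ac (s 1 0) * z1 := by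
      simp only [z2]
      field_simp
    have hfac : ∀ y : AlgebraicClosure F, ac (s 1 0) * y ^ 2 + ac (s 1 1 - s 0 0) * y - ac (s 0 1) = 0
        ↔ y ∈ ({z1, z2} : Set (AlgebraicClosure F)) := by
      intro y
      have h1 : ac (s 1 0) * y ^ 2 + ac (s 1 1 - s 0 0) * y - ac (s 0 1) =
          ac (s 1 0) * ((y - z1) * (y - z2)) := by
        simp only [ac, map_sub] at hz1 hz2 ⊢
        linear_combination hz1 + (y - z1) * hz2
      rw [h1, mul_eq_zero, or_iff_right hcE, mul_eq_zero, sub_eq_zero, sub_eq_zero]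
      simp
    have htr : (s 0 0 + s 1 1) ^ 2 = 4 ↔ z1 = z2 := by
      have h1 : (ac (s 1 0) * (z1 - z2)) ^ 2 = ac ((s 0 0 + s 1 1) ^ 2 - 4) := by
        have hd := ac_det s
        simp only [ac, map_sub, map_add, map_pow, map_ofNat] at hz1 hz2 hd ⊢
        linear_combination 4 * algebraMap F (AlgebraicClosure F) (s 1 0) * hz1 -
          (algebraMap F (AlgebraicClosure F) (s 1 0) * z1 - algebraMap F (AlgebraicClosure F) (s 1 0) * z2 +
            (2 * algebraMap F (AlgebraicClosure F) (s 1 0) * z1 - (algebraMap F (AlgebraicClosure F) (s 0 0) - algebraMap F (AlgebraicClosure F) (s 1 1)))) * hz2 - 4 * hd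
      rw [← sub_eq_zero, ← (map_eq_zero (algebraMap F (AlgebraicClosure F))), ← sub_eq_zero (a := z1)]
      change ac _ = 0 ↔ _
      rw [← h1, pow_eq_zero_iff two_ne_zero, mul_eq_zero, or_iff_right hcE]
    have hRc : ({z1, z2} : Set (AlgebraicClosure F)).ncard +
        (if (s 0 0 + s 1 1) ^ 2 = 4 then 1 else 0) = 2 := by
      split_ifs with h
      · rw [htr.1 h]; simp
      · rw [Set.ncard_pair (fun h' => h (htr.2 h'))]
    have hP : {x : P1 F | s • x = x} = (fun t => pt (some t)) '' {t : F | ac t ∈ ({z1, z2} : Set (AlgebraicClosure F))} := by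
      ext x
      obtain ⟨o, rfl⟩ := pt_bij.2 x
      cases o with
      | none =>
        simp only [Set.mem_setOf_eq, smul_pt_none, hc, false_iff]
        rintro ⟨t, -, ht⟩
        simpa using pt_bij.1 ht
      | some t =>
        have h1 : (pt (some t) : P1 F) ∈ (fun t => pt (some t)) '' {t : F | ac t ∈ ({z1, z2} : Set (AlgebraicClosure F))}
            ↔ t ∈ {t : F | ac t ∈ ({z1, z2} : Set (AlgebraicClosure F))} :=
          Function.Injective.mem_set_image (f := fun t : F => (pt (some t) : P1 F))
            (fun a b h => Option.some_inj.1 (pt_bij.1 h))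
        rw [h1]
        simp only [Set.mem_setOf_eq, smul_pt_some]
        rw [← hfac]
        have h2 : ac (s 1 0) * ac t ^ 2 + ac (s 1 1 - s 0 0) * ac t - ac (s 0 1) =
          ac ((s 1 0 * t + s 1 1) * t - (s 0 0 * t + s 0 1)) := by
          simp only [ac, map_sub, map_mul, map_add]
          ring
        rw [h2]
        simp only [ac, map_eq_zero]
        rw [sub_eq_zero, eq_comm]
    have hN : {z : Np F | s • z = z} = {z : Np F | z.1 ∈ ({z1, z2} : Set (AlgebraicClosure F))} := by
      ext z
      simp only [Set.mem_setOf_eq, smul_np_quad, hfac]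
    have hRf : ({z1, z2} : Set (AlgebraicClosure F)).Finite := Set.toFinite _
    have acinj : Function.Injective (ac : F → AlgebraicClosure F) := (algebraMap F (AlgebraicClosure F)).injective
    have hf1 : {t : F | ac t ∈ ({z1, z2} : Set (AlgebraicClosure F))}.Finite :=
      hRf.preimage acinj.injOn
    have hf2 : {z : Np F | z.1 ∈ ({z1, z2} : Set (AlgebraicClosure F))}.Finite :=
      hRf.preimage Subtype.val_injective.injOn
    have hc1 : {x : P1 F | s • x = x}.ncard =
        (({z1, z2} : Set (AlgebraicClosure F)) ∩ Set.range (algebraMap F (AlgebraicClosure F))).ncard := by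
      rw [hP, Set.ncard_image_of_injective _ (f := fun t : F => (pt (some t) : P1 F))
            (fun a b h => Option.some_inj.1 (pt_bij.1 h)), ← Set.ncard_image_of_injective _ acinj]
      congr 1
      ext y
      constructor
      · rintro ⟨t, ht, rfl⟩
        exact ⟨ht, t, rfl⟩
      · rintro ⟨hy, t, rfl⟩
        exact ⟨t, hy, rfl⟩
    have hc2 : {z : Np F | s • z = z}.ncard =
        (({z1, z2} : Set (AlgebraicClosure F)) \ Set.range (algebraMap F (AlgebraicClosure F))).ncard := by
      rw [hN, ← Set.ncard_image_of_injective _ Subtype.val_injective]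
      congr 1
      ext y
      constructor
      · rintro ⟨t, ht, rfl⟩
        exact ⟨ht, t.2⟩
      · rintro ⟨hy, hy2⟩
        exact ⟨⟨y, hy2⟩, hy, rfl⟩
    refine ⟨by rw [hP]; exact hf1.image _, by rw [hN]; exact hf2, ?_, fun h => absurd h hc⟩
    rw [hc1, hc2, Set.ncard_inter_add_ncard_diff_eq_ncard _ _ hRf, hRc]

/-- the multiplier on the stabilizer of a non-rational point -/
lemma den_mul {s t : SL F} {z : Np F} (ht : t • z = z) :
    den (s * t) z = den s z * den t z := by
  rw [smul_np_eq] at ht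
  simp only [num, den, ac, mul10, mul11, map_add, map_mul] at *
  linear_combination algebraMap F (AlgebraicClosure F) (s 1 0) * ht

lemma den_inj {s : SL F} {z : Np F} (hs : s • z = z) (h : den s z = 1) : s = 1 := by
  have h1 : ac (s 1 0) * z.1 + ac (s 1 1 - 1) = 0 := by
    simp only [den, ac, map_sub, map_one] at h ⊢
    linear_combination h
  obtain ⟨h2, h3⟩ := ac_lin z h1
  rw [smul_np_eq, h, one_mul] at hs
  have h4 : ac (s 0 0 - 1) * z.1 + ac (s 0 1) = 0 := by
    simp only [num, ac, map_sub, map_one] at hs ⊢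
    linear_combination hs
  obtain ⟨h5, h6⟩ := ac_lin z h4
  apply sl_ext <;> simp [h2, h6, sub_eq_zero.1 h3, sub_eq_zero.1 h5]

/-- stabilizer in `K` of a non-rational point -/
noncomputable def Kz (K : Subgroup (SL F)) (z : Np F) : Subgroup (SL F) := K ⊓ MulAction.stabilizer (SL F) z

lemma mem_Kz {K : Subgroup (SL F)} {z : Np F} {s : SL F} : s ∈ Kz K z ↔ s ∈ K ∧ s • z = z :=
  Iff.rfl

/-- the multiplier homomorphism -/
noncomputable def denHom (K : Subgroup (SL F)) (z : Np F) : Kz K z →* AlgebraicClosure F where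
  toFun s := den s.1 z
  map_one' := by simp [den, ac]
  map_mul' s t := den_mul t.2.2

lemma denHom_inj (K : Subgroup (SL F)) (z : Np F) : Function.Injective (denHom K z) := by
  intro s t h
  have h1 : denHom K z (s * t⁻¹) = 1 := by
    rw [map_mul, h, ← map_mul, mul_inv_cancel, map_one]
  have h2 := den_inj (s := (s * t⁻¹).1) (s * t⁻¹).2.2 h1
  have h3 : s * t⁻¹ = 1 := Subtype.ext h2
  exact mul_inv_eq_one.1 h3

lemma Kz_cyclic [Fintype F] (K : Subgroup (SL F)) (z : Np F) : IsCyclic (Kz K z) :=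
  isCyclic_of_subgroup_isDomain (denHom K z) (denHom_inj K z)

lemma ac_pow [Fintype F] (x : F) : ac x ^ Fintype.card F = ac x := by
  rw [ac, ← map_pow, FiniteField.pow_card]

lemma add_pow_q [Fintype F] (x y : AlgebraicClosure F) :
    (x + y) ^ Fintype.card F = x ^ Fintype.card F + y ^ Fintype.card F := by
  obtain ⟨p0, f, hp0, hf, hchar, hq⟩ := exists_prime (F := F)
  haveI := Fact.mk hp0
  haveI : CharP (AlgebraicClosure F) p0 := charP_of_injective_algebraMap (algebraMap F _).injective p0
  rw [hq, add_pow_char_pow]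

lemma np_pow_ne [Fintype F] (z : Np F) : z.1 ^ Fintype.card F ≠ z.1 := by
  classical
  intro h
  apply z.2
  let P : Polynomial (AlgebraicClosure F) := Polynomial.X ^ Fintype.card F - Polynomial.X
  have hP0 : P ≠ 0 := FiniteField.X_pow_card_sub_X_ne_zero _ Fintype.one_lt_card
  have hdeg : P.natDegree = Fintype.card F :=
    FiniteField.X_pow_card_sub_X_natDegree_eq _ Fintype.one_lt_card
  by_contra hz
  have hsub : insert z.1 (Finset.univ.image (ac : F → AlgebraicClosure F)) ⊆ P.roots.toFinset := by
    intro y hy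
    rw [Multiset.mem_toFinset, Polynomial.mem_roots hP0]
    simp only [P, Polynomial.IsRoot.def, Polynomial.eval_sub, Polynomial.eval_pow,
      Polynomial.eval_X]
    rw [Finset.mem_insert] at hy
    rcases hy with rfl | hy
    · rw [h, sub_self]
    · obtain ⟨x, -, rfl⟩ := Finset.mem_image.1 hy
      rw [ac_pow, sub_self]
  have h1 := Finset.card_le_card hsub
  rw [Finset.card_insert_of_notMem (by
    intro hy
    obtain ⟨x, -, hx⟩ := Finset.mem_image.1 hy
    exact hz ⟨x, hx⟩), Finset.card_image_of_injective _ (algebraMap F (AlgebraicClosure F)).injective,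
    Finset.card_univ] at h1
  have h2 := Multiset.toFinset_card_le P.roots
  have h3 := P.card_roots'
  omega

lemma den_pow [Fintype F] {s : SL F} {z : Np F} (hs : s • z = z) :
    den s z ^ (Fintype.card F + 1) = 1 := by
  have hd := ac_det s
  have e1 : den s z ^ Fintype.card F = ac (s 1 0) * z.1 ^ Fintype.card F + ac (s 1 1) := by
    rw [den, add_pow_q, mul_pow, ac_pow, ac_pow]
  rw [pow_succ, e1]
  have hz := (smul_np_quad s z).1 hs
  have hz' : ac (s 1 0) * (z.1 ^ Fintype.card F) ^ 2 + ac (s 1 1 - s 0 0) * z.1 ^ Fintype.card F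
      - ac (s 0 1) = 0 := by
    have h1 := congrArg (fun x => x ^ Fintype.card F) hz
    simp only [sub_eq_add_neg (G := AlgebraicClosure F)] at h1
    rw [show -ac (s 0 1) = ac (- s 0 1) by simp [ac], add_pow_q, add_pow_q, mul_pow, mul_pow, ac_pow,
      ac_pow, ac_pow, zero_pow Fintype.card_ne_zero, ← pow_mul, mul_comm 2, pow_mul] at h1
    simp only [ac, map_neg] at h1 ⊢
    linear_combination h1
  have h3 : (z.1 ^ Fintype.card F - z.1) * (ac (s 1 0) * (z.1 ^ Fintype.card F + z.1) +
      ac (s 1 1 - s 0 0)) = 0 := by linear_combination hz' - hz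
  have h4 := (mul_eq_zero.1 h3).resolve_left (sub_ne_zero.2 (np_pow_ne z))
  simp only [den, ac, map_sub] at *
  linear_combination hd + (algebraMap F (AlgebraicClosure F) (s 1 0) * z.1 +
    algebraMap F (AlgebraicClosure F) (s 1 1)) * h4 - algebraMap F (AlgebraicClosure F) (s 1 0) * hz

lemma Kz_card_dvd [Fintype F] (K : Subgroup (SL F)) (z : Np F) :
    Nat.card (Kz K z) ∣ Fintype.card F + 1 := by
  haveI := Kz_cyclic K z
  rw [← IsCyclic.exponent_eq_card]
  apply Monoid.exponent_dvd_of_forall_pow_eq_one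
  intro s
  apply denHom_inj
  rw [map_pow, map_one]
  exact den_pow s.2.2

end Poles

end Ip
namespace Ip

section Klein

variable {F}

lemma A_fixed {s : SL F} (h : (s 0 0 + s 1 1) ^ 2 = 4) : ∃ x : P1 F, s • x = x := by
  by_cases hc : s 1 0 = 0
  · exact ⟨pt none, (smul_pt_none s).2 hc⟩
  have hdet := det1 s
  obtain ⟨ε, h1, h2⟩ : ∃ ε : F, ε ^ 2 = 1 ∧ s 0 0 + s 1 1 = 2 * ε := by
    have h3 : (s 0 0 + s 1 1 - 2) * (s 0 0 + s 1 1 + 2) = 0 := by linear_combination h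
    rcases mul_eq_zero.1 h3 with h4 | h4
    · exact ⟨1, by ring, by linear_combination h4⟩
    · exact ⟨-1, by ring, by linear_combination h4⟩
  refine ⟨pt (some ((s 0 0 - ε) / s 1 0)), (smul_pt_some _ _).2 ?_⟩
  field_simp
  linear_combination ε * h2 + h1 - hdet

lemma central_tr {s : SL F} (h : s ∈ Subgroup.center (SL F)) : (s 0 0 + s 1 1) ^ 2 = 4 := by
  have h1 := center_sq h
  rw [← ((mem_center s).1 h).2.2]
  linear_combination 4 * h1

/-- poles of `K` -/
abbrev Pl (K : Subgroup (SL F)) :=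
  {z : Np F // ∃ s ∈ K, s ∉ Subgroup.center (SL F) ∧ s • z = z}

lemma pole_smul {K : Subgroup (SL F)} {z : Np F}
    (hz : ∃ s ∈ K, s ∉ Subgroup.center (SL F) ∧ s • z = z) {h : SL F} (hh : h ∈ K) :
    ∃ s ∈ K, s ∉ Subgroup.center (SL F) ∧ s • (h • z) = h • z := by
  obtain ⟨s, hs, hc, hfix⟩ := hz
  refine ⟨h * s * h⁻¹, K.mul_mem (K.mul_mem hh hs) (K.inv_mem hh), ?_, ?_⟩
  · intro h1
    apply hc
    have h2 := (inferInstance : (Subgroup.center (SL F)).Normal).conj_mem _ h1 h⁻¹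
    have h3 : h⁻¹ * (h * s * h⁻¹) * h⁻¹⁻¹ = s := by group
    rwa [h3] at h2
  · rw [mul_smul, inv_smul_smul, mul_smul, hfix]

noncomputable instance plAction (K : Subgroup (SL F)) : MulAction K (Pl K) where
  smul s z := ⟨(s : SL F) • z.1, pole_smul z.2 s.2⟩
  one_smul z := Subtype.ext (one_smul (SL F) z.1)
  mul_smul s t z := Subtype.ext (mul_smul (s : SL F) (t : SL F) z.1)

lemma smul_pl {K : Subgroup (SL F)} (s : K) (z : Pl K) : (s • z).1 = (s : SL F) • z.1 := rfl

lemma pl_finite [Fintype F] (K : Subgroup (SL F)) : Finite (Pl K) := by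
  classical
  have h1 : {z : Np F | ∃ s ∈ K, s ∉ Subgroup.center (SL F) ∧ s • z = z} ⊆
      ⋃ s : {s : SL F // s ∉ Subgroup.center (SL F)}, {z : Np F | s.1 • z = z} := by
    rintro z ⟨s, -, h, h'⟩
    exact Set.mem_iUnion.2 ⟨⟨s, h⟩, h'⟩
  exact ((Set.finite_iUnion fun s => (fixed_count s.2).2.1).subset h1).to_subtype

/-- the `±`-unipotent part of the Borel in `K` -/
lemma card_Ainf [Fintype F] {K : Subgroup (SL F)} (hK : Subgroup.center (SL F) ≤ K) :
    {s : SL F | s ∈ K ∧ s • (pt none : P1 F) = pt none ∧ (s 0 0 + s 1 1) ^ 2 = 4}.ncard =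
      dd F * Nat.card (K ⊓ Ug F : Subgroup (SL F)) := by
  rw [dd, ← Nat.card_prod]
  symm
  let φ : Subgroup.center (SL F) × (K ⊓ Ug F : Subgroup (SL F)) → SL F := fun x => x.1.1 * x.2.1
  have hφ : Function.Injective φ := by
    rintro ⟨⟨c, hc⟩, ⟨u, hu⟩⟩ ⟨⟨c', hc'⟩, ⟨u', hu'⟩⟩ h
    simp only [φ] at h
    obtain ⟨t, rfl⟩ := hu.2
    obtain ⟨t', rfl⟩ := hu'.2
    obtain ⟨h1, h2, h3⟩ := (mem_center c).1 hc
    obtain ⟨h1', h2', h3'⟩ := (mem_center c').1 hc'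
    have h4 := congrArg (fun s : SL F => s 0 0) h
    simp only [mul00, U00, U10, h1, h1', mul_one, mul_zero, add_zero] at h4
    have h5 : c = c' := by
      apply sl_ext
      · exact h4
      · rw [h1, h1']
      · rw [h2, h2']
      · rw [← h3, ← h3', h4]
    subst h5
    simp only [Prod.mk.injEq, Subtype.mk.injEq, true_and]
    exact mul_left_cancel h
  rw [← Set.ncard_univ, ← Set.ncard_image_of_injective _ hφ]
  congr 1
  ext s
  simp only [Set.image_univ, Set.mem_range, smul_pt_none]
  constructor
  · rintro ⟨⟨⟨c, hc⟩, ⟨u, hu⟩⟩, rfl⟩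
    simp only [φ]
    obtain ⟨t, rfl⟩ := hu.2
    obtain ⟨h1, h2, h3⟩ := (mem_center c).1 hc
    have h6 := center_sq hc
    refine ⟨K.mul_mem (hK hc) hu.1, ?_, ?_⟩
    · rw [mul10, h2, U10]; ring
    · rw [mul00, mul11, U00, U10, U11, U01, h2, ← h3, h1]
      linear_combination 4 * h6
  · rintro ⟨hs, hc, htr⟩
    have hd := det1 s
    rw [hc] at hd
    have h0 : s 0 0 = s 1 1 := by
      have : (s 0 0 - s 1 1) ^ 2 = 0 := by linear_combination htr - 4 * hd
      exact sub_eq_zero.1 (pow_eq_zero_iff two_ne_zero |>.1 this)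
    have hsq : s 0 0 * s 0 0 = 1 := by linear_combination hd + s 0 0 * h0
    let c : SL F := mk4 (s 0 0) 0 0 (s 0 0) (by linear_combination hsq)
    have hcc : c ∈ Subgroup.center (SL F) := (mem_center c).2 ⟨rfl, rfl, rfl⟩
    have hu : c⁻¹ * s = U (s 0 0 * s 0 1) := by
      apply sl_ext
      · rw [mul00, inv00, inv01, U00]; simp only [c, mk4_11, mk4_01]; linear_combination hsq
      · rw [mul01, inv00, inv01, U01]; simp only [c, mk4_11, mk4_01]; ring
      · rw [mul10, inv10, inv11, U10]; simp only [c, mk4_10, mk4_00]; rw [hc]; ring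
      · rw [mul11, inv10, inv11, U11]; simp only [c, mk4_10, mk4_00]
        linear_combination hsq - s 0 0 * h0
    refine ⟨⟨⟨c, hcc⟩, ⟨c⁻¹ * s, K.mul_mem (K.inv_mem (hK hcc)) hs, ?_⟩⟩, ?_⟩
    · rw [hu]; exact ⟨_, rfl⟩
    · simp only [φ, mul_inv_cancel_left]

lemma card_Binf [Fintype F] {K : Subgroup (SL F)} (hK : Subgroup.center (SL F) ≤ K) :
    ∃ t, dd F * t ∣ Fintype.card F - 1 ∧ Nat.card (K ⊓ slBorel F : Subgroup (SL F)) =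
      dd F * Nat.card (K ⊓ Ug F : Subgroup (SL F)) * t := by
  classical
  have hB : ∀ s : (K ⊓ slBorel F : Subgroup (SL F)), s.1 1 0 = 0 := fun s => s.2.2
  have hd : ∀ s : (K ⊓ slBorel F : Subgroup (SL F)), s.1 0 0 * s.1 1 1 = 1 := by
    intro s
    have := det1 s.1
    rw [hB] at this
    linear_combination this
  let χ : (K ⊓ slBorel F : Subgroup (SL F)) →* Fˣ :=
    { toFun := fun s => ⟨s.1 0 0, s.1 1 1, hd s, by rw [mul_comm]; exact hd s⟩
      map_one' := by ext; simp
      map_mul' := by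
        intro s t
        ext
        change (s.1 * t.1) 0 0 = s.1 0 0 * t.1 0 0
        rw [mul00, hB t]
        ring }
  let χ2 := (powMonoidHom 2).comp χ
  refine ⟨Nat.card χ2.range, ?_, ?_⟩
  · have h1 : χ2.range ≤ (powMonoidHom 2 : Fˣ →* Fˣ).range := by
      rintro _ ⟨s, rfl⟩
      exact ⟨χ s, rfl⟩
    have h2 := Subgroup.card_dvd_of_le h1
    rw [IsCyclic.card_powMonoidHom_range, Nat.card_eq_fintype_card (α := Fˣ), Fintype.card_units] at h2
    rw [center_card, Nat.gcd_comm]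
    have h3 := Nat.mul_dvd_mul_left (Nat.gcd (Fintype.card F - 1) 2) h2
    rwa [Nat.mul_div_cancel' (Nat.gcd_dvd_left _ _)] at h3
  · have h1 := Subgroup.card_eq_card_quotient_mul_card_subgroup χ2.ker
    rw [Nat.card_congr (QuotientGroup.quotientKerEquivRange χ2).toEquiv] at h1
    rw [h1, mul_comm]
    congr 1
    rw [← card_Ainf hK]
    have h2 : Nat.card χ2.ker = ((fun s : (K ⊓ slBorel F : Subgroup (SL F)) => (s : SL F)) ''
        (χ2.ker : Set (K ⊓ slBorel F : Subgroup (SL F)))).ncard := by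
      rw [Set.ncard_image_of_injective _ Subtype.val_injective]
      exact Nat.card_coe_set_eq _
    rw [h2]
    congr 1
    ext s
    simp only [Set.mem_image, SetLike.mem_coe, MonoidHom.mem_ker, smul_pt_none]
    have hk : ∀ x : (K ⊓ slBorel F : Subgroup (SL F)), χ2 x = 1 ↔ (x.1 0 0 + x.1 1 1) ^ 2 = 4 := by
      intro x
      have e1 := hd x
      have e2 : χ2 x = 1 ↔ x.1 0 0 ^ 2 = 1 := by
        rw [Units.ext_iff]; rfl
      rw [e2]
      constructor
      · intro h
        have h3 : x.1 1 1 = x.1 0 0 := by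
          linear_combination -x.1 1 1 * h + x.1 0 0 * e1
        rw [h3]
        linear_combination 4 * h
      · intro h
        have : (x.1 0 0 - x.1 1 1) ^ 2 = 0 := by linear_combination h - 4 * e1
        have h4 := sub_eq_zero.1 (pow_eq_zero_iff two_ne_zero |>.1 this)
        linear_combination e1 + x.1 0 0 * h4
    constructor
    · rintro ⟨x, hx, rfl⟩
      exact ⟨x.2.1, x.2.2, (hk x).1 hx⟩
    · rintro ⟨h1, h2, h3⟩
      exact ⟨⟨s, h1, h2⟩, (hk ⟨s, h1, h2⟩).2 h3, rfl⟩

lemma card_A [Fintype F] {K : Subgroup (SL F)} (hK : Subgroup.center (SL F) ≤ K)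
    (htr : MulAction.IsPretransitive K (P1 F)) :
    {s : SL F | s ∈ K ∧ (s 0 0 + s 1 1) ^ 2 = 4}.ncard + dd F * (Fintype.card F + 1) =
      dd F + (Fintype.card F + 1) * (dd F * Nat.card (K ⊓ Ug F : Subgroup (SL F))) := by
  classical
  let A : Finset (SL F) := Finset.univ.filter (fun s => s ∈ K ∧ (s 0 0 + s 1 1) ^ 2 = 4)
  have hA : {s : SL F | s ∈ K ∧ (s 0 0 + s 1 1) ^ 2 = 4}.ncard = A.card := by
    rw [← Set.ncard_coe_finset]; simp [A]
  have hconj : ∀ x : P1 F, (A.filter (fun s => s • x = x)).card =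
      dd F * Nat.card (K ⊓ Ug F : Subgroup (SL F)) := by
    intro x
    obtain ⟨g, hg⟩ := htr.exists_smul_eq (pt none) x
    have hg' : g.1 • (pt none : P1 F) = x := hg
    rw [← card_Ainf hK, ← Set.ncard_coe_finset]
    rw [← Set.ncard_image_of_injective {s : SL F | s ∈ K ∧ s • (pt none : P1 F) = pt none ∧
      (s 0 0 + s 1 1) ^ 2 = 4} (MulAut.conj g.1).injective]
    congr 1
    ext s
    simp only [A, Finset.coe_filter, Finset.mem_filter, Finset.mem_univ, true_and, Set.mem_image,
      Set.mem_setOf_eq]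
    have htrc : ∀ y : SL F, (MulAut.conj g.1 y) 0 0 + (MulAut.conj g.1 y) 1 1 = y 0 0 + y 1 1 := by
      intro y
      have hd := det1 g.1
      rw [MulAut.conj_apply, mul00, mul11, mul00 g.1, mul01 g.1, mul10 g.1, mul11 g.1, inv00, inv01, inv10, inv11]
      linear_combination (y 0 0 + y 1 1) * hd
    constructor
    · rintro ⟨⟨h1, h2⟩, h3⟩
      refine ⟨g.1⁻¹ * s * g.1, ⟨K.mul_mem (K.mul_mem (K.inv_mem g.2) h1) g.2, ?_, ?_⟩, ?_⟩
      · rw [mul_smul, mul_smul, hg', h3, inv_smul_eq_iff, hg']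
      · rw [← htrc, MulAut.conj_apply]
        have : g.1 * (g.1⁻¹ * s * g.1) * g.1⁻¹ = s := by group
        rw [this, h2]
      · rw [MulAut.conj_apply]; group
    · rintro ⟨y, ⟨h1, h2, h3⟩, rfl⟩
      refine ⟨⟨K.mul_mem (K.mul_mem g.2 h1) (K.inv_mem g.2), by rw [htrc, h3]⟩, ?_⟩
      rw [MulAut.conj_apply, mul_smul, mul_smul, ← hg', inv_smul_smul, h2]
  have hdc : ∑ s ∈ A, (Finset.univ.filter (fun x : P1 F => s • x = x)).card =
      ∑ x : P1 F, (A.filter (fun s => s • x = x)).card := by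
    simp_rw [Finset.card_filter]
    exact Finset.sum_comm
  simp_rw [hconj] at hdc
  rw [Finset.sum_const, Finset.card_univ, card_P1, smul_eq_mul] at hdc
  rw [hA, ← hdc]
  have h1 : ∀ s ∈ A, (Finset.univ.filter (fun x : P1 F => s • x = x)).card =
      1 + if s ∈ Subgroup.center (SL F) then Fintype.card F else 0 := by
    intro s hs
    have hs' := (Finset.mem_filter.1 hs).2.2
    split_ifs with hc
    · rw [Finset.filter_true_of_mem (fun x _ => center_smul_P1 hc x), Finset.card_univ, card_P1,
        add_comm]
    · obtain ⟨-, -, h2, -⟩ := fixed_count hc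
      rw [if_pos hs'] at h2
      have h3 : {x : P1 F | s • x = x}.ncard = (Finset.univ.filter (fun x : P1 F => s • x = x)).card := by
        rw [← Set.ncard_coe_finset]; simp
      have h4 : 0 < (Finset.univ.filter (fun x : P1 F => s • x = x)).card := by
        obtain ⟨x, hx⟩ := A_fixed hs'
        exact Finset.card_pos.2 ⟨x, by simpa using hx⟩
      omega
  rw [Finset.sum_congr rfl h1, Finset.sum_add_distrib, Finset.sum_const, smul_eq_mul, mul_one,
    ← Finset.sum_filter, Finset.sum_const, smul_eq_mul]
  have h5 : (A.filter (fun s => s ∈ Subgroup.center (SL F))).card = dd F := by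
    have h6 : dd F = (Subgroup.center (SL F) : Set (SL F)).ncard :=
      Nat.card_coe_set_eq (Subgroup.center (SL F) : Set (SL F))
    rw [h6, ← Set.ncard_coe_finset]
    congr 1
    ext s
    simp only [A, Finset.coe_filter, Finset.mem_filter, Finset.mem_univ, true_and,
      SetLike.mem_coe, Set.mem_setOf_eq, and_iff_right_iff_imp]
    exact fun h => ⟨hK h, central_tr h⟩
  rw [h5]
  ring

end Klein

end Ip
namespace Ip

section Klein2

variable {F}

lemma dd_dvd_Kz [Fintype F] {K : Subgroup (SL F)} (hK : Subgroup.center (SL F) ≤ K) (z : Np F) :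
    ∃ e, Nat.card (Kz K z) = dd F * e := by
  have h : Subgroup.center (SL F) ≤ Kz K z := fun s hs => ⟨hK hs, center_smul_np hs z⟩
  exact Subgroup.card_dvd_of_le h

lemma e_two [Fintype F] {K : Subgroup (SL F)} (hK : Subgroup.center (SL F) ≤ K) {z : Np F} {e : ℕ}
    (he : Nat.card (Kz K z) = dd F * e)
    (hz : ∃ s ∈ K, s ∉ Subgroup.center (SL F) ∧ s • z = z) : 2 ≤ e := by
  have h : Subgroup.center (SL F) ≤ Kz K z := fun s hs => ⟨hK hs, center_smul_np hs z⟩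
  by_contra hlt
  have h1 : Nat.card (Kz K z) ≤ Nat.card (Subgroup.center (SL F)) := by
    rw [he]
    change _ ≤ dd F
    have : e ≤ 1 := by omega
    nlinarith
  have h2 := Subgroup.eq_of_le_of_card_ge h h1
  obtain ⟨s, hs, hc, hf⟩ := hz
  apply hc
  rw [h2]
  exact ⟨hs, hf⟩

lemma card_stab_pl [Fintype F] {K : Subgroup (SL F)} (z : Pl K) :
    Nat.card (MulAction.stabilizer K z) = Nat.card (Kz K z.1) := by
  apply Nat.card_congr
  exact
    { toFun := fun s => ⟨s.1.1, s.1.2, by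
        have := s.2
        rw [MulAction.mem_stabilizer_iff] at this
        exact congrArg Subtype.val this⟩
      invFun := fun s => ⟨⟨s.1, s.2.1⟩, by
        rw [MulAction.mem_stabilizer_iff]
        exact Subtype.ext s.2.2⟩
      left_inv := fun s => rfl
      right_inv := fun s => rfl }

lemma burnside_sum [Fintype F] {K : Subgroup (SL F)} (hK : Subgroup.center (SL F) ≤ K)
    (htr : MulAction.IsPretransitive K (P1 F)) :
    (1 + Nat.card (MulAction.orbitRel.Quotient K (Pl K))) * Nat.card K +
      {s : SL F | s ∈ K ∧ (s 0 0 + s 1 1) ^ 2 = 4}.ncard + 2 * dd F =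
    2 * Nat.card K + dd F * (Fintype.card F + 2 + Nat.card (Pl K)) := by
  classical
  haveI := pl_finite K
  letI : Fintype (Pl K) := Fintype.ofFinite _
  have h1 := MulAction.sum_card_fixedBy_eq_card_orbits_mul_card_group K (P1 F)
  have h2 := MulAction.sum_card_fixedBy_eq_card_orbits_mul_card_group K (Pl K)
  have h3 : Fintype.card (MulAction.orbitRel.Quotient K (P1 F)) = 1 := by
    rw [Fintype.card_eq_one_iff_nonempty_unique]
    haveI := htr
    refine ⟨⟨⟨Quotient.mk _ (pt none)⟩, ?_⟩⟩
    intro a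
    induction a using Quotient.inductionOn with
    | h x =>
      apply Quotient.sound
      exact MulAction.exists_smul_eq K (pt none) x
  have h3' : Fintype.card (Quotient (MulAction.orbitRel K (P1 F))) = 1 := h3
  rw [h3', one_mul] at h1
  have hA : {s : SL F | s ∈ K ∧ (s 0 0 + s 1 1) ^ 2 = 4}.ncard =
      ∑ s : K, if ((s : SL F) 0 0 + (s : SL F) 1 1) ^ 2 = 4 then 1 else 0 := by
    rw [Finset.sum_boole, ← Set.ncard_coe_finset,
      ← Set.ncard_image_of_injective (f := fun s : K => (s : SL F)) _ Subtype.val_injective]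
    rw [Nat.cast_id]
    congr 1
    ext s
    simp only [Set.mem_setOf_eq, Finset.coe_filter, Finset.mem_univ, true_and, Set.mem_image]
    constructor
    · rintro ⟨a, b⟩
      exact ⟨⟨s, a⟩, b, rfl⟩
    · rintro ⟨a, b, rfl⟩
      exact ⟨a.2, b⟩
  have key : ∀ s : K, Fintype.card (MulAction.fixedBy (P1 F) s) +
      Fintype.card (MulAction.fixedBy (Pl K) s) +
      (if ((s : SL F) 0 0 + (s : SL F) 1 1) ^ 2 = 4 then 1 else 0) +
      (if (s : SL F) ∈ Subgroup.center (SL F) then 2 else 0) =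
      2 + if (s : SL F) ∈ Subgroup.center (SL F) then Fintype.card F + 2 + Nat.card (Pl K) else 0 := by
    intro s
    rw [← Nat.card_eq_fintype_card, ← Nat.card_eq_fintype_card]
    rw [Nat.card_coe_set_eq, Nat.card_coe_set_eq]
    by_cases hc : (s : SL F) ∈ Subgroup.center (SL F)
    · rw [if_pos (central_tr hc), if_pos hc, if_pos hc]
      have e1 : MulAction.fixedBy (P1 F) s = Set.univ := by
        ext x
        simp only [MulAction.mem_fixedBy, Set.mem_univ, iff_true]
        exact center_smul_P1 hc x
      have e2 : MulAction.fixedBy (Pl K) s = Set.univ := by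
        ext x
        simp only [MulAction.mem_fixedBy, Set.mem_univ, iff_true]
        exact Subtype.ext (center_smul_np hc x.1)
      rw [e1, e2, Set.ncard_univ, Set.ncard_univ, Nat.card_eq_fintype_card, card_P1]
      ring
    · obtain ⟨-, -, h, -⟩ := fixed_count hc
      rw [if_neg hc, if_neg hc, add_zero, add_zero]
      refine Eq.trans ?_ h
      suffices hpp : (MulAction.fixedBy (Pl K) s).ncard = {z : Np F | (s : SL F) • z = z}.ncard by
        rw [hpp]
        rfl
      rw [← Set.ncard_image_of_injective _ (Subtype.val_injective : Function.Injective (fun z : Pl K => z.1))]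
      congr 1
      ext z
      simp only [Set.mem_image, MulAction.mem_fixedBy, Set.mem_setOf_eq]
      constructor
      · rintro ⟨y, hy, rfl⟩
        exact congrArg Subtype.val hy
      · intro hz
        exact ⟨⟨z, s, s.2, hc, hz⟩, Subtype.ext hz, rfl⟩
  have hsum := Finset.sum_congr (rfl : (Finset.univ : Finset K) = Finset.univ) (fun s _ => key s)
  have hcen : ∀ m : ℕ, (∑ s : K, if (s : SL F) ∈ Subgroup.center (SL F) then m else 0) = dd F * m := by
    intro m
    rw [← Finset.sum_filter, Finset.sum_const, smul_eq_mul]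
    congr 1
    have h6 : dd F = (Subgroup.center (SL F) : Set (SL F)).ncard :=
      Nat.card_coe_set_eq (Subgroup.center (SL F) : Set (SL F))
    rw [h6, ← Set.ncard_coe_finset,
      ← Set.ncard_image_of_injective (f := fun s : K => (s : SL F)) _ Subtype.val_injective]
    congr 1
    ext s
    simp only [Set.mem_setOf_eq, Finset.coe_filter, Finset.mem_univ, true_and, Set.mem_image,
      SetLike.mem_coe]
    constructor
    · rintro ⟨a, b, rfl⟩
      exact b
    · intro h
      exact ⟨⟨s, hK h⟩, h, rfl⟩
  rw [Finset.sum_add_distrib, Finset.sum_add_distrib, Finset.sum_add_distrib,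
    Finset.sum_add_distrib, h1, h2, hcen, hcen, ← hA, Finset.sum_const, Finset.card_univ,
    smul_eq_mul] at hsum
  rw [Nat.card_eq_fintype_card (α := K)]
  have h7 : Nat.card (MulAction.orbitRel.Quotient K (Pl K)) =
      Fintype.card (Quotient (MulAction.orbitRel K (Pl K))) := Nat.card_eq_fintype_card
  rw [h7]
  linarith

theorem klein [Fintype F] (H : Subgroup (PSL2 F))
    (htr : MulAction.IsPretransitive (lift H) (P1 F)) :
    ∃ v t : ℕ, v = Nat.card (lift H ⊓ Ug F : Subgroup (SL F)) ∧ v ∣ Fintype.card F ∧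
      dd F * t ∣ Fintype.card F - 1 ∧ Nat.card H = (Fintype.card F + 1) * v * t ∧
      ∃ (ι : Type) (_ : Fintype ι) (z : ι → Np F) (e o : ι → ℕ),
        (∀ i, Nat.card (Kz (lift H) (z i)) = dd F * e i ∧ 2 ≤ e i ∧ e i * o i = Nat.card H ∧
          {y | ∃ s ∈ lift H, s • z i = y}.ncard = o i) ∧
        (∀ y : Np F, (∃ s ∈ lift H, s ∉ Subgroup.center (SL F) ∧ s • y = y) →
          ∃ i, ∃ s ∈ lift H, s • z i = y) ∧
        (∀ i j, (∃ s ∈ lift H, s • z i = z j) → i = j) ∧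
        (∑ i, ((Nat.card H : ℤ) - o i)) =
          Nat.card H - 2 - (Fintype.card F + 1) * ((v : ℤ) - 2) := by
  classical
  have hK := center_le_lift H
  haveI := pl_finite (lift H)
  letI : Fintype (Pl (lift H)) := Fintype.ofFinite _
  obtain ⟨t, ht1, ht2⟩ := card_Binf hK
  have hdpos : 0 < dd F := dd_pos
  have hcK := card_lift H
  have horb : Nat.card (lift H) = (Fintype.card F + 1) *
      Nat.card (lift H ⊓ slBorel F : Subgroup (SL F)) := by
    have h1 := MulAction.card_orbit_mul_card_stabilizer_eq_card_group (lift H) (pt none : P1 F)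
    rw [← Nat.card_eq_fintype_card, ← Nat.card_eq_fintype_card, ← Nat.card_eq_fintype_card] at h1
    rw [← h1, MulAction.orbit_eq_univ, Nat.card_univ, Nat.card_eq_fintype_card, card_P1]
    congr 1
    apply Nat.card_congr
    exact
    { toFun := fun s => ⟨s.1.1, s.1.2, by
        have := s.2
        rw [MulAction.mem_stabilizer_iff] at this
        exact (smul_pt_none s.1.1).1 this⟩
      invFun := fun s => ⟨⟨s.1, s.2.1⟩, by
        rw [MulAction.mem_stabilizer_iff]
        exact (smul_pt_none s.1).2 s.2.2⟩
      left_inv := fun s => rfl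
      right_inv := fun s => rfl }
  have hcard : Nat.card H = (Fintype.card F + 1) *
      Nat.card (lift H ⊓ Ug F : Subgroup (SL F)) * t := by
    apply Nat.eq_of_mul_eq_mul_left hdpos
    rw [← hcK, horb, ht2]
    ring
  refine ⟨_, t, rfl, ?_, ht1, hcard, ?_⟩
  · have := Subgroup.card_dvd_of_le (inf_le_right : lift H ⊓ Ug F ≤ Ug F)
    rw [card_Ug, Nat.card_eq_fintype_card (α := F)] at this
    exact this
  have hz : ∀ z : Pl (lift H), ∃ e o : ℕ, Nat.card (Kz (lift H) z.1) = dd F * e ∧ 2 ≤ e ∧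
      e * o = Nat.card H ∧ {y | ∃ s ∈ lift H, s • z.1 = y}.ncard = o ∧
      (Fintype.card (lift H) / Fintype.card (MulAction.stabilizer (lift H) z)) = o := by
    intro z
    obtain ⟨e, he⟩ := dd_dvd_Kz hK z.1
    have he2 := e_two hK he z.2
    have h1 := MulAction.card_orbit_mul_card_stabilizer_eq_card_group (lift H) z
    have h2 : Fintype.card (MulAction.stabilizer (lift H) z) = dd F * e := by
      rw [← Nat.card_eq_fintype_card, card_stab_pl, he]
    refine ⟨e, Fintype.card (MulAction.orbit (lift H) z), he, he2, ?_, ?_, ?_⟩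
    · rw [h2, ← Nat.card_eq_fintype_card (α := lift H), hcK] at h1
      apply Nat.eq_of_mul_eq_mul_left hdpos
      rw [← h1]; ring
    · rw [← Nat.card_eq_fintype_card, Nat.card_coe_set_eq,
        ← Set.ncard_image_of_injective _ (Subtype.val_injective :
          Function.Injective (fun z : Pl (lift H) => z.1))]
      congr 1
      ext y
      constructor
      · rintro ⟨s, hs, rfl⟩
        exact ⟨(⟨s, hs⟩ : lift H) • z, ⟨_, rfl⟩, rfl⟩
      · rintro ⟨_, ⟨s, rfl⟩, rfl⟩
        exact ⟨s.1, s.2, rfl⟩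
    · rw [← h1]
      exact Nat.mul_div_cancel _ Fintype.card_pos
  choose e o he using hz
  refine ⟨MulAction.orbitRel.Quotient (lift H) (Pl (lift H)),
    (inferInstance : Fintype (MulAction.orbitRel.Quotient (lift H) (Pl (lift H)))),
    fun i => (Quotient.out i).1, fun i => e (Quotient.out i), fun i => o (Quotient.out i),
    fun i => ⟨(he _).1, (he _).2.1, (he _).2.2.1, (he _).2.2.2.1⟩, ?_, ?_, ?_⟩
  · intro y hy
    refine ⟨Quotient.mk _ ⟨y, hy⟩, ?_⟩
    have h1 := Quotient.mk_out (s := MulAction.orbitRel (lift H) (Pl (lift H))) ⟨y, hy⟩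
    obtain ⟨s, hs⟩ := (MulAction.orbitRel (lift H) (Pl (lift H))).symm h1
    exact ⟨s.1, s.2, congrArg Subtype.val hs⟩
  · rintro i j ⟨s, hs, h⟩
    rw [← Quotient.out_eq i, ← Quotient.out_eq j]
    apply Quotient.sound
    apply (MulAction.orbitRel (lift H) (Pl (lift H))).symm
    exact ⟨⟨s, hs⟩, Subtype.ext h⟩
  · have h1 := MulAction.card_eq_sum_card_group_div_card_stabilizer (lift H) (Pl (lift H))
    have h2 : Nat.card (Pl (lift H)) =
        ∑ i : MulAction.orbitRel.Quotient (lift H) (Pl (lift H)), o (Quotient.out i) := by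
      rw [Nat.card_eq_fintype_card, h1]
      refine Finset.sum_congr rfl fun i _ => (he _).2.2.2.2
    have h3 := burnside_sum hK htr
    have h4 := card_A hK htr
    rw [hcK, Nat.card_eq_fintype_card (α := MulAction.orbitRel.Quotient (lift H) (Pl (lift H)))] at h3
    rw [Finset.sum_sub_distrib, Finset.sum_const, Finset.card_univ, nsmul_eq_mul, ← Nat.cast_sum]
    have h5 : ∑ i : MulAction.orbitRel.Quotient (lift H) (Pl (lift H)), o (Quotient.out i) =
      Nat.card (Pl (lift H)) := h2.symm
    have hd' : (dd F : ℤ) ≠ 0 := by exact_mod_cast hdpos.ne'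
    apply mul_left_cancel₀ hd'
    have h6 : ((∑ i : MulAction.orbitRel.Quotient (lift H) (Pl (lift H)), o (Quotient.out i) : ℕ) : ℤ) =
      Nat.card (Pl (lift H)) := by exact_mod_cast h5
    zify at h3 h4
    push_cast at h3 h4 h6 ⊢
    linear_combination h3 - h4 - (dd F : ℤ) * h6

end Klein2

end Ip
namespace Ip

section EvenTwo

variable {F}

lemma cyclic_of_lift [Fintype F] {H : Subgroup (PSL2 F)} (hc : IsCyclic (lift H)) : IsCyclic H := by
  let f : lift H →* H :=
    { toFun := fun s => ⟨pr F s.1, s.2⟩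
      map_one' := Subtype.ext (map_one _)
      map_mul' := fun a b => Subtype.ext (map_mul _ _ _) }
  apply isCyclic_of_surjective f
  rintro ⟨x, hx⟩
  obtain ⟨s, rfl⟩ := pr_surj x
  exact ⟨⟨s, hx⟩, rfl⟩

lemma dd_one_of_even [Fintype F] (hq : Even (Fintype.card F)) : dd F = 1 := dd_even hq

lemma sum_o_bound {ι : Type} [Fintype ι] {N c : ℕ} {o : ι → ℕ} (h : ∀ i, c * o i ≤ N) :
    ((Fintype.card ι : ℤ)) * ((c - 1) * N) ≤ c * ∑ i, ((N : ℤ) - o i) := by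
  rw [Finset.mul_sum]
  have : ∀ i ∈ (Finset.univ : Finset ι), ((c : ℤ) - 1) * N ≤ c * ((N : ℤ) - o i) := by
    intro i _
    have := h i
    zify at this
    linarith
  have h2 := Finset.sum_le_sum this
  rw [Finset.sum_const, Finset.card_univ, nsmul_eq_mul] at h2
  exact h2

lemma sum_zero_of_card {ι : Type} [Fintype ι] (f : ι → ℤ) (h : Fintype.card ι = 0) : ∑ i, f i = 0 := by
  haveI := Fintype.card_eq_zero_iff.1 h
  simp

lemma sum_one_of_card {ι : Type} [Fintype ι] (h : Fintype.card ι = 1) :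
    ∃ i : ι, (∀ j, j = i) ∧ ∀ f : ι → ℤ, ∑ i, f i = f i := by
  obtain ⟨i, hi⟩ := Fintype.card_eq_one_iff.1 h
  refine ⟨i, hi, fun f => ?_⟩
  rw [Fintype.sum_eq_single i]
  intro j hj
  exact absurd (hi j) hj

lemma sum_two_of_card {ι : Type} [Fintype ι] (h : Fintype.card ι = 2) :
    ∃ i j : ι, i ≠ j ∧ (∀ l, l = i ∨ l = j) ∧ ∀ f : ι → ℤ, ∑ i, f i = f i + f j := by
  classical
  have h2 := Finset.card_eq_two.1 ((Finset.card_univ (α := ι)).trans h)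
  obtain ⟨i, j, hij, hu⟩ := h2
  refine ⟨i, j, hij, fun l => ?_, fun f => ?_⟩
  · have := Finset.mem_univ l
    rw [hu] at this
    simpa using this
  · rw [hu, Finset.sum_pair hij]

theorem fwd_even2 [Fintype F] {k : Type} [Field k] [IsAlgClosed k] [CharP k 2]
    (hq : Even (Fintype.card F)) (hq7 : 7 ≤ Fintype.card F) {H : Subgroup (PSL2 F)} (hH : HasIp k 2 H) :
    IsCyclic H ∧ Nat.card H = Fintype.card F + 1 := by
  haveI : Fact (Nat.Prime 2) := ⟨Nat.prime_two⟩
  have hodd : ¬ 2 ∣ Nat.card H := hH.1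
  have hpq : ¬ 2 ∣ Fintype.card F + 1 := by
    obtain ⟨m, hm⟩ := hq
    omega
  have htr := isTrans hH hpq
  obtain ⟨v, t, -, hv, ht, hcard, ι, hι, z, e, o, hi, -, -, hsum⟩ := klein H htr
  set q := Fintype.card F with hqd
  have hd : dd F = 1 := dd_one_of_even hq
  have hv1 : v = 1 := by
    obtain ⟨p0, f, hp0, -, -, hcf⟩ := exists_prime (F := F)
    have h2 : p0 = 2 := by
      have : 2 ∣ p0 ^ f := by rw [← hcf]; exact hq.two_dvd
      have := Nat.prime_two.dvd_of_dvd_pow this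
      exact ((Nat.prime_dvd_prime_iff_eq Nat.prime_two hp0).1 this).symm
    rw [hqd, hcf, h2] at hv
    obtain ⟨m, -, hm⟩ := (Nat.dvd_prime_pow Nat.prime_two).1 hv
    rcases Nat.eq_zero_or_pos m with h0 | h0
    · rw [hm, h0, pow_zero]
    · exfalso
      apply hodd
      rw [hcard, hm]
      exact Dvd.dvd.mul_right (Dvd.dvd.mul_left (dvd_pow_self 2 h0.ne') _) _
  rw [hv1, mul_one] at hcard
  have ht2 : ¬ 2 ∣ t := fun h => hodd (by rw [hcard]; exact Dvd.dvd.mul_left h _)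
  have he3 : ∀ i, 3 * o i ≤ Nat.card H := by
    intro i
    obtain ⟨-, h2, h3, -⟩ := hi i
    rw [← h3]
    apply Nat.mul_le_mul_right
    by_contra hlt
    have : e i = 2 := by omega
    apply hodd
    rw [← h3, this]
    exact dvd_mul_right _ _
  have hb := sum_o_bound he3
  rw [hsum, hv1] at hb
  set N := Nat.card H with hN
  have hNt : (N : ℤ) = ((q : ℤ) + 1) * t := by exact_mod_cast hcard
  have hq7' : (7 : ℤ) ≤ q := by exact_mod_cast hq7
  have hNpos : 0 < N := Nat.card_pos
  have hr : Fintype.card ι = 0 ∨ Fintype.card ι = 1 ∨ 2 ≤ Fintype.card ι := by omega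
  rcases hr with hr | hr | hr
  · rw [sum_zero_of_card _ hr, hv1] at hsum
    push_cast at hsum
    linarith
  · obtain ⟨i, -, hs⟩ := sum_one_of_card hr
    rw [hs, hv1] at hsum
    push_cast at hsum
    have : (0 : ℤ) ≤ o i := by positivity
    linarith
  · have ht1 : t = 1 := by
      by_contra hne
      have ht3 : 3 ≤ t := by
        have : t ≠ 0 := by rintro rfl; rw [mul_zero] at hcard; omega
        omega
      have h3 : 3 * ((q : ℤ) + 1) ≤ N := by
        rw [hNt]
        have : (3 : ℤ) ≤ t := by exact_mod_cast ht3
        nlinarith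
      have hr' : (2 : ℤ) ≤ Fintype.card ι := by exact_mod_cast hr
      push_cast at hb
      have hN0 : (0 : ℤ) < N := by exact_mod_cast hNpos
      nlinarith
    rw [ht1, mul_one] at hcard
    refine ⟨?_, hcard⟩
    have hNq : (N : ℤ) = q + 1 := by rw [hNt, ht1]; simp
    have hr2 : Fintype.card ι = 2 := by
      by_contra hne
      have hr' : (3 : ℤ) ≤ Fintype.card ι := by
        have : 3 ≤ Fintype.card ι := by omega
        exact_mod_cast this
      push_cast at hb
      nlinarith
    obtain ⟨i, j, -, -, hs⟩ := sum_two_of_card hr2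
    rw [hs, hv1] at hsum
    push_cast at hsum
    have hopos : ∀ i, 0 < o i := by
      intro i
      obtain ⟨-, h2, h3, -⟩ := hi i
      rcases Nat.eq_zero_or_pos (o i) with h | h
      · rw [h] at h3; omega
      · exact h
    have h1 := hopos i
    have h2 := hopos j
    have ho : o i = 1 := by
      zify at h1 h2 ⊢
      linarith
    obtain ⟨h3, h4, h5, -⟩ := hi i
    rw [ho, mul_one] at h5
    rw [h5, ← card_lift H] at h3
    have h6 : Kz (lift H) (z i) = lift H :=
      Subgroup.eq_of_le_of_card_ge (fun s hs => hs.1) h3.ge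
    apply cyclic_of_lift
    have := Kz_cyclic (lift H) (z i)
    rw [h6] at this
    exact this

end EvenTwo

end Ip
namespace Ip

section Qtrick

variable {F}

lemma avg_exists {k : Type*} [Field k] {p : ℕ} [CharP k p] {U X : Type*} [Group U] [Finite U]
    [MulAction U X] [Fintype X] (hp : ¬ p ∣ Nat.card U) :
    ∃ E : (X → k) →ₗ[k] (X → k), (∀ (u : U) f x, E f (u • x) = E f x) ∧
      (∀ f, (∀ (u : U) x, f (u • x) = f x) → E f = f) ∧
      (∀ f x, E f x = (Nat.card U : k)⁻¹ * ∑ᶠ u : U, f (u • x)) := by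
  classical
  letI := Fintype.ofFinite U
  have hne : (Nat.card U : k) ≠ 0 := fun h => hp ((CharP.cast_eq_zero_iff k p _).1 h)
  refine ⟨{ toFun := fun f x => (Nat.card U : k)⁻¹ * ∑ u : U, f (u • x)
            map_add' := ?_
            map_smul' := ?_ }, ?_, ?_, ?_⟩
  · intro f g
    ext x
    simp [Finset.sum_add_distrib, mul_add]
  · intro c f
    ext x
    simp only [Pi.smul_apply, smul_eq_mul, RingHom.id_apply, ← Finset.mul_sum]
    ring
  · intro u f x
    change (Nat.card U : k)⁻¹ * ∑ v : U, f (v • u • x) = (Nat.card U : k)⁻¹ * ∑ v : U, f (v • x)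
    congr 1
    exact Fintype.sum_equiv (Equiv.mulRight u) _ _ (fun v => by simp [mul_smul])
  · intro f hf
    ext x
    change (Nat.card U : k)⁻¹ * ∑ v : U, f (v • x) = f x
    simp only [hf, Finset.sum_const, Finset.card_univ, nsmul_eq_mul]
    rw [← mul_assoc, Nat.card_eq_fintype_card]
    rw [Nat.card_eq_fintype_card] at hne
    rw [inv_mul_cancel₀ hne, one_mul]
  · intro f x
    rw [finsum_eq_sum_of_fintype]
    rfl

lemma finrank_inv {k : Type*} [Field k] {U X : Type*} [Group U] [MulAction U X] [Fintype X]
    (W : Submodule k (X → k)) (hW : ∀ f, f ∈ W ↔ ∀ (u : U) x, f (u • x) = f x) :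
    Module.finrank k W = Nat.card (MulAction.orbitRel.Quotient U X) := by
  classical
  letI : Fintype (MulAction.orbitRel.Quotient U X) := Fintype.ofFinite _
  let L : (MulAction.orbitRel.Quotient U X → k) →ₗ[k] (X → k) :=
    { toFun := fun f x => f (Quotient.mk _ x)
      map_add' := fun _ _ => rfl
      map_smul' := fun _ _ => rfl }
  have hL : Function.Injective L := by
    intro f g h
    ext y
    induction y using Quotient.inductionOn with
    | h x => exact congrFun h x
  have hr : LinearMap.range L = W := by
    ext f
    rw [hW]
    constructor
    · rintro ⟨g, rfl⟩ u x
      change g _ = g _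
      congr 1
      exact Quotient.sound ⟨u, rfl⟩
    · intro hf
      refine ⟨fun y => Quotient.lift f ?_ y, rfl⟩
      rintro a b ⟨u, rfl⟩
      exact hf u b
  rw [← hr, LinearMap.finrank_range_of_inj hL, Module.finrank_fintype_fun_eq_card,
    Nat.card_eq_fintype_card]

lemma qtrick {k : Type*} [Field k] {p : ℕ} [CharP k p] {U X Y : Type*} [Group U] [Finite U]
    [MulAction U X] [Fintype X] [MulAction U Y] [Fintype Y] (hp : ¬ p ∣ Nat.card U)
    (β : (X → k) →ₗ[k] (Y → k)) (hβ : Equi U β) (hs : Function.Surjective β)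
    (hc : Fintype.card X + Nat.card (MulAction.orbitRel.Quotient U Y) ≤
      Fintype.card Y + Nat.card (MulAction.orbitRel.Quotient U X))
    (f : X → k) (hf : β f = 0) (u : U) (x : X) : f (u • x) = f x := by
  classical
  letI := Fintype.ofFinite U
  obtain ⟨EX, hX1, hX2, hX3⟩ := avg_exists (k := k) (X := X) hp
  obtain ⟨EY, hY1, hY2, hY3⟩ := avg_exists (k := k) (X := Y) hp
  have hcomm : ∀ f, β (EX f) = EY (β f) := by
    intro f
    have : EX f = (Nat.card U : k)⁻¹ • ∑ u : U, (fun x => f (u • x)) := by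
      ext x
      rw [hX3, finsum_eq_sum_of_fintype]
      simp
    rw [this, map_smul, map_sum]
    ext y
    rw [hY3, finsum_eq_sum_of_fintype]
    simp only [Pi.smul_apply, Finset.sum_apply, smul_eq_mul]
    congr 1
    exact Finset.sum_congr rfl fun u _ => hβ u f y
  have rX : Module.finrank k (LinearMap.range EX) = Nat.card (MulAction.orbitRel.Quotient U X) := by
    apply finrank_inv
    intro f
    constructor
    · rintro ⟨g, rfl⟩ u x
      exact hX1 u g x
    · intro h
      exact ⟨f, hX2 f h⟩
  have rY : Module.finrank k (LinearMap.range EY) = Nat.card (MulAction.orbitRel.Quotient U Y) := by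
    apply finrank_inv
    intro f
    constructor
    · rintro ⟨g, rfl⟩ u x
      exact hY1 u g x
    · intro h
      exact ⟨f, hY2 f h⟩
  have nX := LinearMap.finrank_range_add_finrank_ker EX
  have nY := LinearMap.finrank_range_add_finrank_ker EY
  rw [Module.finrank_fintype_fun_eq_card, rX] at nX
  rw [Module.finrank_fintype_fun_eq_card, rY] at nY
  let γ : LinearMap.ker EX →ₗ[k] LinearMap.ker EY := β.restrict (by
    intro f hf
    rw [LinearMap.mem_ker] at hf ⊢
    rw [← hcomm, hf, map_zero])
  have iX : ∀ f, EX (EX f) = EX f := fun f => hX2 _ (fun u x => hX1 u f x)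
  have iY : ∀ f, EY (EY f) = EY f := fun f => hY2 _ (fun u x => hY1 u f x)
  have hγ : Function.Surjective γ := by
    rintro ⟨g, hg⟩
    rw [LinearMap.mem_ker] at hg
    obtain ⟨f, rfl⟩ := hs g
    refine ⟨⟨f - EX f, ?_⟩, ?_⟩
    · rw [LinearMap.mem_ker, map_sub, iX, sub_self]
    · apply Subtype.ext
      change β (f - EX f) = β f
      rw [map_sub, hcomm, hg, sub_zero]
  have hle : Module.finrank k (LinearMap.ker EY) ≤ Module.finrank k (LinearMap.ker EX) :=
    LinearMap.finrank_le_finrank_of_surjective hγ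
  have hinj : Function.Injective γ :=
    (LinearMap.injective_iff_surjective_of_finrank_eq_finrank (by omega)).2 hγ
  have h0 : f - EX f = 0 := by
    have hm : f - EX f ∈ LinearMap.ker EX := by
      rw [LinearMap.mem_ker, map_sub, iX, sub_self]
    have : γ ⟨f - EX f, hm⟩ = γ 0 := by
      apply Subtype.ext
      change β (f - EX f) = β 0
      rw [map_sub, hcomm, hf, map_zero, map_zero, sub_zero]
    exact congrArg Subtype.val (hinj this)
  rw [sub_eq_zero] at h0
  rw [h0]
  exact hX1 u f x

/-- a subgroup containing all conjugates of `U` is everything -/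
lemma gen_top (S : Subgroup (SL F)) (h : ∀ (s : SL F) (t : F), s * U t * s⁻¹ ∈ S) (s : SL F) : s ∈ S := by
  have hU : ∀ t, (U t : SL F) ∈ S := fun t => by simpa using h 1 t
  have hL : ∀ c : F, (mk4 1 0 c 1 (by ring) : SL F) ∈ S := by
    intro c
    have : (mk4 1 0 c 1 (by ring) : SL F) = w0 * U (-c) * w0⁻¹ := by
      apply sl_ext <;> simp [mul00, mul01, mul10, mul11, inv00, inv01, inv10, inv11, U, w0]
    rw [this]
    exact h _ _
  have main : ∀ s : SL F, s 1 0 ≠ 0 → s ∈ S := by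
    intro s hs
    have : s = U ((s 0 0 - 1) / s 1 0) * mk4 1 0 (s 1 0) 1 (by ring) * U ((s 1 1 - 1) / s 1 0) := by
      have hd := det1 s
      apply sl_ext <;> simp only [mul00, mul01, mul10, mul11, U, mk4_00, mk4_01, mk4_10, mk4_11]
      · field_simp; ring
      · field_simp; linear_combination -hd
      · field_simp; ring
      · field_simp; ring
    rw [this]
    exact mul_mem (mul_mem (hU _) (hL _)) (hU _)
  by_cases hs : s 1 0 = 0
  · have h1 := main (s * mk4 1 0 1 1 (by ring)) (by
      rw [mul10, hs]
      simp only [mk4_00, mk4_10]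
      have := det1 s
      rw [hs] at this
      intro h0
      rw [zero_mul, zero_add, mul_one] at h0
      rw [h0] at this
      simp at this)
    exact (Subgroup.mul_mem_cancel_right S (hL 1)).1 h1
  · exact main s hs

lemma card_fixed_mul {G : Type*} [Group G] [Finite G] (L : Subgroup G) (u : G) :
    Nat.card (MulAction.fixedBy (G ⧸ L) u) * Nat.card L = {g : G | g⁻¹ * u * g ∈ L}.ncard := by
  have h := QuotientGroup.preimageMkEquivSubgroupProdSet L (MulAction.fixedBy (G ⧸ L) u)
  rw [mul_comm, ← Nat.card_prod, ← Nat.card_congr h, Nat.card_coe_set_eq]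
  congr 1
  ext g
  simp only [Set.mem_preimage, MulAction.mem_fixedBy, Set.mem_setOf_eq]
  change ((u * g : G) : G ⧸ L) = (g : G ⧸ L) ↔ _
  rw [eq_comm, QuotientGroup.eq, mul_assoc]

end Qtrick

end Ip
namespace Ip

section NoV1

variable {F}

lemma burnside_const {A X : Type*} [Group A] [Finite A] [MulAction A X] [Fintype X] {c : ℕ}
    (h : ∀ a : A, a ≠ 1 → Nat.card (MulAction.fixedBy X a) = c) :
    Nat.card (MulAction.orbitRel.Quotient A X) * Nat.card A = Fintype.card X + (Nat.card A - 1) * c := by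
  classical
  letI := Fintype.ofFinite A
  have h1 := MulAction.sum_card_fixedBy_eq_card_orbits_mul_card_group A X
  have h2 : Nat.card (MulAction.orbitRel.Quotient A X) =
    Fintype.card (Quotient (MulAction.orbitRel A X)) := Nat.card_eq_fintype_card
  rw [h2, Nat.card_eq_fintype_card (α := A), ← h1, ← Finset.add_sum_erase _ _ (Finset.mem_univ 1)]
  congr 1
  · rw [← Nat.card_eq_fintype_card, MulAction.fixedBy_one_eq_univ, Nat.card_univ,
      Nat.card_eq_fintype_card]
  · rw [Finset.sum_congr rfl (g := fun _ => c), Finset.sum_const, smul_eq_mul,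
      Finset.card_erase_of_mem (Finset.mem_univ _), Finset.card_univ]
    intro a ha
    rw [← Nat.card_eq_fintype_card]
    exact h a (Finset.ne_of_mem_erase ha)

lemma mem_Ug {s : SL F} : s ∈ Ug F ↔ s 1 0 = 0 ∧ s 0 0 = 1 := by
  constructor
  · rintro ⟨t, rfl⟩
    exact ⟨rfl, rfl⟩
  · rintro ⟨h1, h2⟩
    refine ⟨s 0 1, ?_⟩
    have h3 := det1 s
    rw [h1, h2] at h3
    apply sl_ext
    · rw [h2]; rfl
    · rfl
    · rw [h1]; rfl
    · change 1 = s 1 1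
      linear_combination -h3

lemma mem_lift' {H : Subgroup (PSL2 F)} {s : SL F} : s ∈ lift H ↔ pr F s ∈ H := Iff.rfl

/-- with `H` transitive and meeting `U` trivially it meets all conjugates trivially -/
lemma conj_U_trivial [Fintype F] {K : Subgroup (SL F)}
    (htr : MulAction.IsPretransitive K (P1 F)) (hv : Nat.card (K ⊓ Ug F : Subgroup (SL F)) = 1)
    {s : SL F} {t : F} (h : s⁻¹ * U t * s ∈ K) : t = 0 := by
  obtain ⟨⟨h0, hh0⟩, hx⟩ := htr.exists_smul_eq ((s⁻¹ : SL F) : P1 F) (pt none : P1 F)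
  have hx' : h0 * s⁻¹ ∈ slBorel F := by
    have h1 : ((h0 * s⁻¹ : SL F) : P1 F) = ((1 : SL F) : P1 F) := hx
    rw [eq_comm, QuotientGroup.eq] at h1
    simpa using h1
  set b := h0 * s⁻¹ with hb
  have hm : b * U t * b⁻¹ ∈ K ⊓ Ug F := by
    constructor
    · have : b * U t * b⁻¹ = h0 * (s⁻¹ * U t * s) * h0⁻¹ := by rw [hb]; group
      rw [this]
      exact K.mul_mem (K.mul_mem hh0 h) (K.inv_mem hh0)
    · have h2 := det1 b
      have h3 : b 1 0 = 0 := hx'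
      rw [h3] at h2
      exact mem_Ug.2 ⟨by
        rw [mul10 (b * U t), mul10 b, mul11 b, inv00, inv10, h3]; simp [U], by
        rw [mul00 (b * U t), mul00 b, mul01 b, inv00, inv10, h3]; simp [U]; linear_combination h2⟩
  rw [Subgroup.card_eq_one] at hv
  rw [hv, Subgroup.mem_bot] at hm
  have h5 : U t = 1 := by
    have h6 : U t = b⁻¹ * (b * U t * b⁻¹) * b := by group
    rw [h6, hm]; group
  have := congrArg (fun s : SL F => s 0 1) h5
  simpa [U] using this

set_option maxHeartbeats 1000000 in
lemma no_v1 [Fintype F] {k : Type*} [Field k] {p : ℕ} [CharP k p] {H : Subgroup (PSL2 F)}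
    (hH : HasIp k p H) (htr : MulAction.IsPretransitive (lift H) (P1 F))
    (hv : Nat.card (lift H ⊓ Ug F : Subgroup (SL F)) = 1) {P r : ℕ}
    (hPr : Fintype.card F - 1 = P * r) (hpp : p.Prime) (hpr : ¬ p ∣ r) (hpq : ¬ p ∣ Fintype.card F) (hP : 2 ≤ P)
    (hc : dd F * Nat.card H = (Fintype.card F + 1) * r)
    (hcen : Subgroup.center (SL F) ≤ Lm F r) : False := by
  classical
  set q := Fintype.card F with hqd
  have hq1 : 1 < q := Fintype.one_lt_card
  have hr0 : 0 < r := by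
    rcases Nat.eq_zero_or_pos r with h | h
    · rw [h] at hpr; simp at hpr
    · exact h
  let L : Subgroup (PSL2 F) := (Lm F r).map (pr F)
  have hliftL : lift L = Lm F r := by
    change ((Lm F r).map (pr F)).comap (pr F) = _
    rw [Subgroup.comap_map_eq]
    apply sup_of_le_left
    intro s hs
    exact hcen ((pr_eq_one s).1 hs)
  have hcL : dd F * Nat.card L = r * q := by
    rw [card_map_pr _ hcen, card_Lm, hPr, Nat.gcd_eq_right (Dvd.intro_left _ rfl)]
  have hd0 : 0 < dd F := dd_pos
  have hL : ¬ p ∣ Nat.card L := by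
    intro h
    have h2 : p ∣ r * q := by rw [← hcL]; exact Dvd.dvd.mul_left h _
    rcases (Nat.Prime.dvd_mul hpp).1 h2 with h3 | h3
    · exact hpr h3
    · exact hpq h3
  have iL : L.index = (q + 1) * P := by
    have h1 := index_card L
    rw [show dd F * (L.index * Nat.card L) = L.index * (dd F * Nat.card L) by ring, hcL, ← hqd, hPr] at h1
    apply Nat.eq_of_mul_eq_mul_right (Nat.mul_pos hr0 (by omega : 0 < q))
    rw [h1]; ring
  have iH : H.index = q * P := by
    have h1 := index_card H
    rw [show dd F * (H.index * Nat.card H) = H.index * (dd F * Nat.card H) by ring, hc, ← hqd, hPr] at h1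
    apply Nat.eq_of_mul_eq_mul_right (Nat.mul_pos (by omega : 0 < q + 1) hr0)
    rw [h1]; ring
  letI : Fintype (PSL2 F ⧸ H) := Fintype.ofFinite _
  letI : Fintype (PSL2 F ⧸ L) := Fintype.ofFinite _
  have cL : Fintype.card (PSL2 F ⧸ L) = (q + 1) * P := by
    rw [← Nat.card_eq_fintype_card, ← iL]; rfl
  have cH : Fintype.card (PSL2 F ⧸ H) = q * P := by
    rw [← Nat.card_eq_fintype_card, ← iH]; rfl
  obtain ⟨-, β, -, hβ, -, hs⟩ := exists_maps hH hL
  let φ : Ug F →* PSL2 F := (pr F).comp (Ug F).subtype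
  letI aH : MulAction (Ug F) (PSL2 F ⧸ H) := MulAction.compHom _ φ
  letI aL : MulAction (Ug F) (PSL2 F ⧸ L) := MulAction.compHom _ φ
  have cU : Nat.card (Ug F) = q := by rw [card_Ug, Nat.card_eq_fintype_card]
  have oH := burnside_const (A := Ug F) (X := PSL2 F ⧸ H) (c := 0) (by
    rintro ⟨_, t, rfl⟩ hne
    rw [Nat.card_eq_zero]
    left
    constructor
    rintro ⟨x, hx⟩
    rw [MulAction.mem_fixedBy] at hx
    induction x using QuotientGroup.induction_on with
    | H g =>
      obtain ⟨s, rfl⟩ := pr_surj g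
      have hx2 : ((pr F (U t) * pr F s : PSL2 F) : PSL2 F ⧸ H) = (pr F s : PSL2 F) := hx
      rw [eq_comm, QuotientGroup.eq, ← map_mul, ← map_inv, ← map_mul, ← mul_assoc] at hx2
      have := conj_U_trivial htr hv (s := s) (t := t) hx2
      apply hne
      apply Subtype.ext
      change U t = 1
      rw [this, U_zero])
  have oL := burnside_const (A := Ug F) (X := PSL2 F ⧸ L) (c := P) (by
    rintro ⟨_, t, rfl⟩ hne
    have ht : t ≠ 0 := by
      rintro rfl
      exact hne (Subtype.ext U_zero)
    have h1 := card_fixed_mul L (pr F (U t))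
    have h2 : {g : PSL2 F | g⁻¹ * pr F (U t) * g ∈ L} = (pslBorel F : Set (PSL2 F)) := by
      ext g
      obtain ⟨s, rfl⟩ := pr_surj g
      change (pr F s)⁻¹ * pr F (U t) * pr F s ∈ L ↔ s ∈ lift (pslBorel F)
      rw [pslBorel_lift, ← map_inv, ← map_mul, ← map_mul]
      change s⁻¹ * U t * s ∈ lift L ↔ _
      rw [hliftL, mem_borel]
      constructor
      · intro h
        have h3 := h.1
        rw [mul10 (s⁻¹ * U t), mul10 s⁻¹, mul11 s⁻¹, inv10, inv11] at h3
        simp only [U, mk4_00, mk4_10, mk4_01, mk4_11] at h3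
        have h4 : t * (s 1 0) ^ 2 = 0 := by linear_combination -h3
        simpa [ht] using h4
      · intro h
        exact Lm_conj h ⟨rfl, by simp [U]⟩
    rw [h2] at h1
    have h3 : (pslBorel F : Set (PSL2 F)).ncard = Nat.card (pslBorel F) :=
      (Nat.card_coe_set_eq (pslBorel F : Set (PSL2 F))).symm
    rw [h3] at h1
    have h4 : Nat.card (MulAction.fixedBy (PSL2 F ⧸ L) (⟨U t, t, rfl⟩ : Ug F)) =
      Nat.card (MulAction.fixedBy (PSL2 F ⧸ L) (pr F (U t))) := rfl
    rw [h4]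
    have h5 := card_pslBorel (F := F)
    rw [← h1, ← hqd, hPr, show ∀ a b : ℕ, dd F * (a * b) = a * (dd F * b) from fun a b => by ring, hcL] at h5
    apply Nat.eq_of_mul_eq_mul_right (Nat.mul_pos hr0 (by omega : 0 < q))
    rw [h5]; ring)
  rw [cU, cH] at oH
  rw [cU, cL] at oL
  have hUp : ¬ p ∣ Nat.card (Ug F) := by rw [cU]; exact hpq
  have hoo : Fintype.card (PSL2 F ⧸ L) + Nat.card (MulAction.orbitRel.Quotient (Ug F) (PSL2 F ⧸ H)) ≤
      Fintype.card (PSL2 F ⧸ H) + Nat.card (MulAction.orbitRel.Quotient (Ug F) (PSL2 F ⧸ L)) := by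
    rw [cL, cH]
    have e1 : Nat.card (MulAction.orbitRel.Quotient (Ug F) (PSL2 F ⧸ H)) = P := by
      apply Nat.eq_of_mul_eq_mul_right (by omega : 0 < q)
      rw [oH]; ring
    have e2 : Nat.card (MulAction.orbitRel.Quotient (Ug F) (PSL2 F ⧸ L)) = 2 * P := by
      apply Nat.eq_of_mul_eq_mul_right (by omega : 0 < q)
      rw [oL]
      obtain ⟨m, hm⟩ : ∃ m, q = m + 1 := ⟨q - 1, by omega⟩
      rw [hm]; simp; ring
    rw [e1, e2]
    linarith
  have hfix := qtrick hUp β (fun u f y => hβ (φ u) f y) hs hoo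
  have hconst : ∀ f, β f = 0 → ∀ x y, f x = f y := by
    intro f hf
    let S : Subgroup (SL F) :=
      { carrier := {s | ∀ x, f (pr F s • x) = f x}
        one_mem' := fun x => by rw [map_one, one_smul]
        mul_mem' := fun {a b} ha hb x => by rw [map_mul, mul_smul, ha, hb]
        inv_mem' := fun {a} ha x => by
          rw [← ha, map_inv, smul_inv_smul] }
    have hS : ∀ s, s ∈ S := gen_top S (by
      intro s t x
      have hz : β (fun x => f (pr F s • x)) = 0 := by
        ext y
        rw [hβ (pr F s) f y, hf]; rfl
      have h6 := hfix _ hz ⟨U t, t, rfl⟩ (pr F s⁻¹ • x)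
      change f (pr F s • pr F (U t) • pr F s⁻¹ • x) = f (pr F s • pr F s⁻¹ • x) at h6
      rw [map_mul, map_mul, mul_smul, mul_smul, h6, map_inv, smul_inv_smul])
    intro x y
    obtain ⟨g, rfl⟩ := MulAction.exists_smul_eq (PSL2 F) x y
    obtain ⟨s, rfl⟩ := pr_surj g
    exact (hS s x).symm
  have h8 := LinearMap.finrank_range_add_finrank_ker β
  rw [LinearMap.range_eq_top.2 hs, finrank_top, Module.finrank_fintype_fun_eq_card,
    Module.finrank_fintype_fun_eq_card, cL, cH] at h8
  have h9 : Module.finrank k (LinearMap.ker β) ≤ 1 := by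
    let ev : LinearMap.ker β →ₗ[k] k := (LinearMap.proj (QuotientGroup.mk 1)).comp (LinearMap.ker β).subtype
    have : Function.Injective ev := by
      intro f g hfg
      apply Subtype.ext
      have h1 : f.1 (QuotientGroup.mk 1) = g.1 (QuotientGroup.mk 1) := hfg
      funext x
      rw [hconst f.1 f.2 x (QuotientGroup.mk 1), h1, hconst g.1 g.2 (QuotientGroup.mk 1) x]
    have := LinearMap.finrank_le_finrank_of_injective this
    rwa [Module.finrank_self] at this
  nlinarith

end NoV1

end Ip
namespace Ip

section Dihedral

variable {F}

lemma dihedral_of {G : Type*} [Group G] [Finite G] (C : Subgroup G) (hC : IsCyclic C) {n : ℕ}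
    (hn : Nat.card C = n) (hG : Nat.card G = 2 * n) (h2 : ∀ g : G, g ∉ C → g * g = 1) :
    Nonempty (G ≃* DihedralGroup n) := by
  subst hn
  have hpos : 0 < Nat.card C := Nat.card_pos
  have hne : ∃ g : G, g ∉ C := by
    by_contra hcon
    push Not at hcon
    have : C = ⊤ := by ext g; simp [hcon g]
    have h3 : Nat.card C = Nat.card G := by rw [this]; exact Nat.card_congr Subgroup.topEquiv.toEquiv
    omega
  obtain ⟨g, hg⟩ := hne
  let E := zmodCyclicMulEquiv hC
  let ρ : ZMod (Nat.card C) → G := fun i => (E (Multiplicative.ofAdd i)).1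
  have hρ : ∀ i j, ρ (i + j) = ρ i * ρ j := by
    intro i j
    change (E (Multiplicative.ofAdd (i + j))).1 = _
    rw [ofAdd_add, map_mul]
    rfl
  have hρm : ∀ i, ρ i ∈ C := fun i => (E (Multiplicative.ofAdd i)).2
  have hρ0 : ρ 0 = 1 := by
    change (E (Multiplicative.ofAdd 0)).1 = _
    rw [ofAdd_zero, map_one]; rfl
  have hρn : ∀ i, ρ i * ρ (-i) = 1 := by
    intro i
    rw [← hρ, add_neg_cancel, hρ0]
  have hgg := h2 g hg
  have hcom : ∀ i, ρ i * g = g * ρ (-i) := by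
    intro i
    have h3 := h2 (g * ρ i) (fun h => hg ((Subgroup.mul_mem_cancel_right C (hρm i)).1 h))
    calc ρ i * g = (g * g) * ρ i * g * (ρ i * ρ (-i)) := by rw [hgg, hρn]; group
      _ = g * ((g * ρ i) * (g * ρ i)) * ρ (-i) := by group
      _ = g * ρ (-i) := by rw [h3, mul_one]
  let f : DihedralGroup (Nat.card C) →* G :=
    { toFun := fun x => match x with
        | .r i => ρ i
        | .sr i => g * ρ i
      map_one' := hρ0
      map_mul' := by
        rintro (i | i) (j | j)
        · exact hρ i j
        · change g * ρ (j - i) = ρ i * (g * ρ j)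
          rw [← mul_assoc, hcom, mul_assoc, ← hρ, neg_add_eq_sub]
        · change g * ρ (i + j) = g * ρ i * ρ j
          rw [hρ, mul_assoc]
        · change ρ (j - i) = g * ρ i * (g * ρ j)
          rw [mul_assoc, ← mul_assoc (ρ i), hcom, mul_assoc, ← hρ, ← mul_assoc, hgg, one_mul,
            neg_add_eq_sub] }
  have hf : Function.Injective f := by
    rw [injective_iff_map_eq_one]
    rintro (i | i) h
    · change (E (Multiplicative.ofAdd i)).1 = 1 at h
      have h3 : E (Multiplicative.ofAdd i) = 1 := Subtype.ext h
      have h4 := (map_eq_one_iff E E.injective).1 h3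
      have h5 : i = 0 := by exact ofAdd_eq_one.1 h4
      rw [h5]; rfl
    · exfalso
      change g * ρ i = 1 at h
      apply hg
      rw [eq_inv_of_mul_eq_one_left h]
      exact C.inv_mem (hρm i)
  have hb : Function.Bijective f := hf.bijective_of_nat_card_le (by
    rw [hG, DihedralGroup.nat_card])
  exact ⟨(MulEquiv.ofBijective f hb).symm⟩

lemma center_bot [Fintype F] (hd : dd F = 1) : Subgroup.center (SL F) = ⊥ :=
  Subgroup.card_eq_one.1 hd

lemma liftEquiv [Fintype F] (hd : dd F = 1) (H : Subgroup (PSL2 F)) : Nonempty (lift H ≃* H) := by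
  let f : lift H →* H :=
    { toFun := fun s => ⟨pr F s.1, s.2⟩
      map_one' := Subtype.ext (map_one _)
      map_mul' := fun a b => Subtype.ext (map_mul _ _ _) }
  have hs : Function.Surjective f := by
    rintro ⟨x, hx⟩
    obtain ⟨s, rfl⟩ := pr_surj x
    exact ⟨⟨s, hx⟩, rfl⟩
  have hi : Function.Injective f := by
    rw [injective_iff_map_eq_one]
    intro s h
    have h1 : pr F s.1 = 1 := congrArg Subtype.val h
    rw [pr_eq_one, center_bot hd, Subgroup.mem_bot] at h1
    exact Subtype.ext h1
  exact ⟨MulEquiv.ofBijective f ⟨hi, hs⟩⟩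

lemma stab_card_mul [Fintype F] {K : Subgroup (SL F)} (htr : MulAction.IsPretransitive K (P1 F)) (x : P1 F) :
    (Fintype.card F + 1) * Nat.card (MulAction.stabilizer K x) = Nat.card K := by
  classical
  have h1 := MulAction.card_orbit_mul_card_stabilizer_eq_card_group K x
  rw [← Nat.card_eq_fintype_card, ← Nat.card_eq_fintype_card, ← Nat.card_eq_fintype_card] at h1
  rw [← h1, MulAction.orbit_eq_univ, Nat.card_univ, Nat.card_eq_fintype_card (α := P1 F),
    card_P1]

/-- an element fixing no rational point fixes exactly two poles -/
lemma two_poles {s : SL F} (hs : s ∉ Subgroup.center (SL F)) (hx : ∀ x : P1 F, s • x ≠ x) :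
    {z : Np F | s • z = z}.ncard = 2 := by
  obtain ⟨-, -, h, -⟩ := fixed_count hs
  have h1 : {x : P1 F | s • x = x} = ∅ := by
    ext x; simp [hx x]
  have h2 : ¬ (s 0 0 + s 1 1) ^ 2 = 4 := by
    intro h2
    obtain ⟨x, hx'⟩ := A_fixed h2
    exact hx x hx'
  rw [h1, if_neg h2] at h
  simpa using h

theorem dihedral_case [Fintype F] {H : Subgroup (PSL2 F)} (hd : dd F = 1)
    (htr : MulAction.IsPretransitive (lift H) (P1 F)) (hc : Nat.card H = 2 * (Fintype.card F + 1))
    (z : Np F) (hz : Nat.card (Kz (lift H) z) = Fintype.card F + 1)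
    (ho : {y | ∃ s ∈ lift H, s • z = y}.ncard = 2)
    (hall : ∀ y : Np F, (∃ s ∈ lift H, s ∉ Subgroup.center (SL F) ∧ s • y = y) →
          ∃ s ∈ lift H, s • z = y) :
    Nonempty (H ≃* DihedralGroup (Fintype.card F + 1)) := by
  obtain ⟨e⟩ := liftEquiv hd H
  have hcK : Nat.card (lift H) = 2 * (Fintype.card F + 1) := by rw [card_lift, hd, one_mul, hc]
  have hle : Kz (lift H) z ≤ lift H := fun s hs => hs.1
  have hcyc : IsCyclic ((Kz (lift H) z).subgroupOf (lift H)) := by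
    haveI := Kz_cyclic (lift H) z
    exact isCyclic_of_surjective (Subgroup.subgroupOfEquivOfLe hle).symm
      (Subgroup.subgroupOfEquivOfLe hle).symm.surjective
  have hcc : Nat.card ((Kz (lift H) z).subgroupOf (lift H)) = Fintype.card F + 1 := by
    rw [Nat.card_congr (Subgroup.subgroupOfEquivOfLe hle).toEquiv, hz]
  obtain ⟨e2⟩ := dihedral_of _ hcyc hcc hcK (by
    intro s hs
    have hsz : s.1 • z ≠ z := fun h => hs (Subgroup.mem_subgroupOf.2 ⟨s.2, h⟩)
    have hsc : s.1 ∉ Subgroup.center (SL F) := fun h => hsz (center_smul_np h z)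
    have hfx : ∃ x : P1 F, s.1 • x = x := by
      by_contra hcon
      push Not at hcon
      have h2 := two_poles hsc hcon
      have hfin : {y : Np F | ∃ s ∈ lift H, s • z = y}.Finite := Set.finite_of_ncard_ne_zero (by rw [ho]; norm_num)
      have h3 : {y : Np F | s.1 • y = y} = {y | ∃ s ∈ lift H, s • z = y} := by
        apply Set.eq_of_subset_of_ncard_le _ _ hfin
        · intro y hy
          exact hall y ⟨s.1, s.2, hsc, hy⟩
        · rw [h2, ho]
      have h4 : z ∈ {y : Np F | s.1 • y = y} := by
        rw [h3]
        exact ⟨1, one_mem _, one_smul _ _⟩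
      exact hsz h4
    obtain ⟨x, hx⟩ := hfx
    have h5 := stab_card_mul htr x
    rw [hcK, mul_comm] at h5
    have h6 : Nat.card (MulAction.stabilizer (lift H) x) = 2 :=
      Nat.eq_of_mul_eq_mul_right (by omega) h5
    have h7 : (⟨s, hx⟩ : MulAction.stabilizer (lift H) x) ^ 2 = 1 := by
      have h9 := pow_card_eq_one' (x := (⟨s, hx⟩ : MulAction.stabilizer (lift H) x))
      rwa [h6] at h9
    have h8 := congrArg Subtype.val h7
    rw [← pow_two]
    exact h8)
  exact ⟨e.symm.trans e2⟩

end Dihedral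

section Arith

lemma mersenne_pow {p n f : ℕ} (hp : p.Prime) (hodd : Odd p) (hn : 0 < n) (hf : 2 ≤ f)
    (h : p ^ n + 1 = 2 ^ f) : n = 1 := by
  have h4 : 4 ∣ 2 ^ f := pow_dvd_pow 2 hf
  have hp2 := hp.two_le
  rcases Nat.even_or_odd n with he | ho
  · exfalso
    obtain ⟨m, rfl⟩ := he
    have h1 : p ^ (m + m) % 4 = 1 := by
      rw [← two_mul, pow_mul]
      have : p ^ 2 % 4 = 1 := by
        obtain ⟨c, rfl⟩ := hodd
        have : (2 * c + 1) ^ 2 = 1 + 4 * (c ^ 2 + c) := by ring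
        rw [this]; omega
      rw [Nat.pow_mod, this]; simp
    omega
  · obtain ⟨m, rfl⟩ := ho
    have h1 : 2 * (p + 1) ∣ p ^ 2 - 1 := by
      obtain ⟨c, rfl⟩ := hodd
      refine ⟨c, ?_⟩
      have : (2 * c + 1) ^ 2 = 2 * (2 * c + 1 + 1) * c + 1 := by ring
      omega
    have h2 : p ^ 2 ≡ 1 [MOD 2 * (p + 1)] :=
      ((Nat.modEq_iff_dvd' (Nat.one_le_pow _ _ (by omega))).2 h1).symm
    have h3 : p ^ (2 * m + 1) + 1 ≡ p + 1 [MOD 2 * (p + 1)] := by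
      rw [pow_succ, pow_mul]
      have := (h2.pow m).mul_right p
      rw [one_pow, one_mul] at this
      exact this.add_right 1
    have h5 : p + 1 ∣ p ^ (2 * m + 1) + 1 := by
      have := Odd.nat_add_dvd_pow_add_pow p 1 (n := 2 * m + 1) ⟨m, rfl⟩
      simpa using this
    rw [h] at h5 h3
    obtain ⟨a, ha, ha2⟩ := (Nat.dvd_prime_pow Nat.prime_two).1 h5
    rcases Nat.lt_or_ge a f with hlt | hge
    · exfalso
      have h6 : 2 * (p + 1) ∣ 2 ^ f := by
        rw [ha2, ← pow_succ']
        exact pow_dvd_pow 2 hlt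
      have h7 := (h3.dvd_iff (dvd_refl _)).1 h6
      have := Nat.le_of_dvd (by omega) h7
      omega
    · have : a = f := le_antisymm ha hge
      rw [this, ← h] at ha2
      have h8 : p ^ (2 * m + 1) = p ^ 1 := by rw [pow_one]; omega
      exact Nat.pow_right_injective hp2 h8

lemma arith_qm1 {p0 f q v t d e m : ℕ} (hp0 : p0.Prime) (hq : q = p0 ^ f) (hq7 : 7 ≤ q)
    (hd : d = Nat.gcd 2 (q - 1)) (hv : v ∣ q) (hv2 : 2 ≤ v) (ht : d * t ∣ q - 1) (ht0 : 0 < t)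
    (hem : q + 1 = e * m) (hdm : d ∣ m) (heq : m * v * t + 2 * q = v * (q + 1)) :
    (v = 2 ∧ m = 1 ∧ t = 1) ∨ d * ((q + 1) * v * t) = (q + 1) * q * (q - 1) ∨ q = 9 := by
  obtain ⟨w, hw⟩ := hv
  have hm0 : 0 < m := by
    rcases Nat.eq_zero_or_pos m with h | h
    · rw [h] at hem; omega
    · exact h
  have hw0 : 0 < w := by
    rcases Nat.eq_zero_or_pos w with h | h
    · rw [h] at hw; omega
    · exact h
  rcases Nat.lt_or_ge 2 v with h3 | h3
  · right
    have h4 : m * t + 2 * w = q + 1 := by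
      apply Nat.eq_of_mul_eq_mul_left (by omega : 0 < v)
      have : v * (m * t + 2 * w) = m * v * t + 2 * (v * w) := by ring
      rw [this, ← hw, heq]
    have hmw : m ∣ 2 * w := by
      have h5 : m ∣ m * t + 2 * w := by rw [h4, hem]; exact dvd_mul_left _ _
      exact (Nat.dvd_add_right (dvd_mul_right m t)).1 h5
    have hcop : Nat.Coprime m w := by
      have h6 : Nat.Coprime (q + 1) q := by simp
      exact Nat.Coprime.coprime_dvd_right ⟨v, by rw [hw]; ring⟩
        (Nat.Coprime.coprime_dvd_left ⟨e, by rw [hem]; ring⟩ h6)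
    have hm2 : m ∣ 2 := hcop.dvd_of_dvd_mul_right hmw
    have hmd : m = d := by
      have hm2' : m ≤ 2 := Nat.le_of_dvd (by norm_num) hm2
      apply Nat.dvd_antisymm _ hdm
      rw [hd]
      apply Nat.dvd_gcd hm2
      have h7 : m ∣ q + 1 := by rw [hem]; exact dvd_mul_left _ _
      have : q - 1 + 2 = q + 1 := by omega
      rw [← this] at h7
      exact (Nat.dvd_add_left hm2).1 h7
    rw [← hmd] at ht ⊢
    have h8 : m * t = q + 1 - 2 * w := by omega
    rcases Nat.eq_or_lt_of_le (show 1 ≤ w from hw0) with h1 | h1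
    · left
      rw [← h1, mul_one] at hw h8
      rw [← hw, show m * ((q + 1) * q * t) = (q + 1) * q * (m * t) by ring, h8]
      congr 1
    · right
      have h9 : m * t ∣ 2 * w - 2 := by
        have : q - 1 = m * t + (2 * w - 2) := by omega
        rw [this] at ht
        exact (Nat.dvd_add_right (dvd_refl _)).1 ht
      have h10 := Nat.le_of_dvd (by omega) h9
      have hv4 : v = 3 := by
        have : v < 4 := by
          by_contra hcon
          have : 4 * w ≤ v * w := Nat.mul_le_mul_right w (by omega)
          omega
        omega
      rw [hv4] at hw
      have h11 : m * t = w + 1 := by omega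
      rw [h11] at ht
      have h12 : w + 1 ∣ 4 := by
        have h13 : w + 1 ∣ 3 * (w + 1) := dvd_mul_left _ _
        have h14 : 3 * (w + 1) = (q - 1) + 4 := by omega
        rw [h14] at h13
        exact (Nat.dvd_add_right ht).1 h13
      have h15 := Nat.le_of_dvd (by norm_num) h12
      have : w = 3 ∨ w = 2 := by omega
      rcases this with h | h
      · omega
      · rw [h] at h12; norm_num at h12
  · left
    have hv' : v = 2 := by omega
    rw [hv'] at heq
    have : m * t = 1 := by nlinarith
    exact ⟨hv', Nat.eq_one_of_mul_eq_one_right this, Nat.eq_one_of_mul_eq_one_left this⟩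

end Arith

end Ip
namespace Ip

section Qm1

variable {F}

set_option maxHeartbeats 1000000 in
theorem fwd_qm1 [Fintype F] {k : Type} [Field k] [IsAlgClosed k] {p : ℕ} [Fact p.Prime] [CharP k p]
    (hodd : Odd p) (hp1 : p ∣ Fintype.card F - 1) (hq7 : 7 ≤ Fintype.card F)
    {H : Subgroup (PSL2 F)} (hH : HasIp k p H) :
    (∃ f : ℕ, Fintype.card F = 2 ^ f) ∧ p = Fintype.card F - 1 ∧
      Nonempty (H ≃* DihedralGroup (Fintype.card F + 1)) ∧ Nat.card H = 2 * (Fintype.card F + 1) := by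
  have hpp : p.Prime := Fact.out
  have hpo : ¬ p ∣ 2 := by
    intro h
    have := Nat.le_of_dvd (by norm_num) h
    have := hpp.two_le
    obtain ⟨c, hc⟩ := hodd
    omega
  have hpq1 : ¬ p ∣ Fintype.card F + 1 := by
    intro h
    apply hpo
    have h1 : Fintype.card F + 1 = (Fintype.card F - 1) + 2 := by omega
    rw [h1] at h
    exact (Nat.dvd_add_right hp1).1 h
  have hpq : ¬ p ∣ Fintype.card F := by
    intro h
    have h1 : Fintype.card F = (Fintype.card F - 1) + 1 := by omega
    rw [h1] at h
    have := (Nat.dvd_add_right hp1).1 h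
    exact hpp.one_lt.ne' (Nat.dvd_one.1 this)
  have htr := isTrans hH hpq1
  obtain ⟨v, t, hvd, hv, ht, hcard, ι, hι, z, e, o, hi, hall, -, hsum⟩ := klein H htr
  obtain ⟨p0, f, hp0, -, -, hcf⟩ := exists_prime (F := F)
  set q := Fintype.card F with hqd
  obtain ⟨n, r, hpr, hPr⟩ := Nat.exists_eq_pow_mul_and_not_dvd (n := q - 1) (by omega) p hpp.ne_one
  have hn : n ≠ 0 := by
    rintro rfl
    rw [pow_zero, one_mul] at hPr
    rw [hPr] at hp1
    exact hpr hp1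
  have hd0 : 0 < dd F := dd_pos
  have hdg : dd F = Nat.gcd 2 (q - 1) := center_card
  have hNp : ¬ p ∣ Nat.card H := hH.1
  have hN0 : 0 < Nat.card H := Nat.card_pos
  have ht0 : 0 < t := by
    rcases Nat.eq_zero_or_pos t with h | h
    · rw [h, mul_zero] at hcard; omega
    · exact h
  have hpd : ¬ p ∣ dd F := fun h => hpo (h.trans (by rw [hdg]; exact Nat.gcd_dvd_left _ _))
  have hpdt : ¬ p ∣ dd F * t := by
    intro h
    rcases (Nat.Prime.dvd_mul hpp).1 h with h | h
    · exact hpd h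
    · exact hNp (by rw [hcard]; exact Dvd.dvd.mul_left h _)
  have hdtr : dd F * t ∣ r := by
    rw [hPr] at ht
    exact (((Nat.Prime.coprime_iff_not_dvd hpp).2 hpdt).symm.pow_right n).dvd_of_dvd_mul_left ht
  have hcen : Subgroup.center (SL F) ≤ Lm F r := by
    have hdr : dd F ∣ r := (dvd_mul_right _ _).trans hdtr
    have h12 : dd F = 1 ∨ dd F = 2 := by
      rw [hdg]
      exact (Nat.dvd_prime Nat.prime_two).1 (Nat.gcd_dvd_left _ _)
    rcases h12 with h | h
    · rw [center_bot h]; exact bot_le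
    · rw [h] at hdr
      obtain ⟨m, hm⟩ := hdr
      rw [hm]
      exact center_le_Lm
  have hcL : dd F * Nat.card ((Lm F r).map (pr F)) = r * q := by
    rw [card_map_pr _ hcen, card_Lm, ← hqd, hPr, Nat.gcd_eq_right (Dvd.intro_left _ rfl)]
  have hL : ¬ p ∣ Nat.card ((Lm F r).map (pr F)) := by
    intro h
    have h2 : p ∣ r * q := by rw [← hcL]; exact Dvd.dvd.mul_left h _
    rcases (Nat.Prime.dvd_mul hpp).1 h2 with h3 | h3
    · exact hpr h3
    · exact hpq h3
  have hle : r * q ≤ dd F * Nat.card H := by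
    rw [← hcL]
    exact Nat.mul_le_mul_left _ (card_le hH hL)
  have hr0 : 0 < r := by
    rcases Nat.eq_zero_or_pos r with h | h
    · rw [h] at hpr; simp at hpr
    · exact h
  have hv0 : v ≠ 0 := by
    rintro rfl
    simp at hcard; omega
  by_cases hv1 : v = 1
  · exfalso
    obtain ⟨s, hs⟩ := hdtr
    rw [hv1, mul_one] at hcard
    have hs1 : s = 1 := by
      have hs0 : s ≠ 0 := by rintro rfl; omega
      by_contra hne
      have hs2 : 2 ≤ s := by omega
      rw [hs, hcard, show dd F * t * s * q = (dd F * t) * (s * q) by ring,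
        show dd F * ((q + 1) * t) = (dd F * t) * (q + 1) by ring] at hle
      have h3 := Nat.le_of_mul_le_mul_left hle (Nat.mul_pos hd0 ht0)
      nlinarith
    rw [hs1, mul_one] at hs
    refine no_v1 hH htr (by rw [← hvd, hv1]) hPr hpp hpr hpq ?_ ?_ hcen
    · calc 2 ≤ p := hpp.two_le
        _ = p ^ 1 := (pow_one p).symm
        _ ≤ p ^ n := Nat.pow_le_pow_right hpp.pos (by omega)
    · rw [hs, hcard]; ring
  have hv2 : 2 ≤ v := by omega
  have hNZ : (Nat.card H : ℤ) = ((q : ℤ) + 1) * v * t := by exact_mod_cast hcard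
  have hv2' : (2 : ℤ) ≤ v := by exact_mod_cast hv2
  have ht0' : (1 : ℤ) ≤ t := by exact_mod_cast ht0
  have hq0' : (7 : ℤ) ≤ q := by exact_mod_cast hq7
  have hr1 : Fintype.card ι = 1 := by
    have hb := sum_o_bound (c := 2) (N := Nat.card H) (o := o) (fun i => by
      obtain ⟨-, h2, h3, -⟩ := hi i
      rw [← h3]
      exact Nat.mul_le_mul_right _ h2)
    by_contra hne
    rcases Nat.lt_or_ge (Fintype.card ι) 1 with h | h
    · rw [sum_zero_of_card _ (by omega)] at hsum
      have h2 : ((q : ℤ) + 1) * (v * t - v + 2) = 2 := by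
        rw [hNZ] at hsum
        linarith
      have h3 : (v : ℤ) * t - v ≥ 0 := by nlinarith
      nlinarith
    · have h2 : 2 ≤ Fintype.card ι := by omega
      have h2' : (2 : ℤ) ≤ Fintype.card ι := by exact_mod_cast h2
      rw [hsum] at hb
      push_cast at hb
      have hNn : (0 : ℤ) < Nat.card H := by exact_mod_cast hN0
      have h4 : 0 ≤ ((q : ℤ) + 1) * (v - 2) := by
        apply mul_nonneg <;> linarith
      nlinarith
  obtain ⟨i, hall1, hs⟩ := sum_one_of_card hr1
  rw [hs] at hsum
  obtain ⟨hk1, he2, heo, hor⟩ := hi i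
  have hed : dd F * e i ∣ q + 1 := by
    rw [← hk1]; exact Kz_card_dvd _ _
  obtain ⟨m', hm'⟩ := hed
  have hom : o i = (dd F * m') * v * t := by
    apply Nat.eq_of_mul_eq_mul_left (by omega : 0 < e i)
    rw [heo, hcard, hm']
    ring
  have heq : (dd F * m') * v * t + 2 * q = v * (q + 1) := by
    rw [← hom]
    zify
    linarith
  have hem : q + 1 = e i * (dd F * m') := by rw [hm']; ring
  rcases arith_qm1 hp0 hcf hq7 hdg hv hv2 ht ht0 hem (dvd_mul_right _ _) heq with ⟨h1, h2, h3⟩ | h | h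
  · have hd1 : dd F = 1 := Nat.eq_one_of_mul_eq_one_right h2
    have hm1 : m' = 1 := Nat.eq_one_of_mul_eq_one_left h2
    rw [h1, h3, mul_one] at hcard
    have hcard' : Nat.card H = 2 * (q + 1) := by rw [hcard]; ring
    have hee : e i = q + 1 := by rw [hem, h2, mul_one]
    have ho2 : o i = 2 := by rw [hom, h2, h1, h3]
    have hev : 2 ∣ q := by rw [← h1]; exact hv
    have hp02 : p0 = 2 := by
      rw [hcf] at hev
      exact ((Nat.prime_dvd_prime_iff_eq Nat.prime_two hp0).1 (Nat.prime_two.dvd_of_dvd_pow hev)).symm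
    rw [hp02] at hcf
    have hr : r = 1 := by
      rw [hd1, one_mul, hcard'] at hle
      have h5 : r < 3 := by
        by_contra hcon
        have : 3 * q ≤ r * q := Nat.mul_le_mul_right q (by omega)
        omega
      have h6 : r ≠ 2 := by
        rintro rfl
        omega
      omega
    rw [hr, mul_one] at hPr
    have hn1 : n = 1 := by
      apply mersenne_pow hpp hodd (by omega) (f := f)
      · by_contra hcon
        have : f = 0 ∨ f = 1 := by omega
        rcases this with h | h <;> rw [h] at hcf <;> norm_num at hcf <;> omega
      · rw [← hcf, ← hPr]; omega
    rw [hn1, pow_one] at hPr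
    refine ⟨⟨f, hcf⟩, hPr.symm, ?_, hcard'⟩
    apply dihedral_case hd1 htr hcard' (z i)
    · rw [hk1, hd1, one_mul, hee]
    · rw [hor, ho2]
    · intro y hy
      obtain ⟨j, s, hs1, hs2⟩ := hall y hy
      rw [hall1 j] at hs2
      exact ⟨s, hs1, hs2⟩
  · exfalso
    have h1 : p ∣ dd F * Nat.card H := by
      rw [hcard, h]
      exact Dvd.dvd.mul_left hp1 _
    rcases (Nat.Prime.dvd_mul hpp).1 h1 with h2 | h2
    · exact hpd h2
    · exact hNp h2
  · exfalso
    rw [h] at hp1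
    have h8 : p ∣ 2 ^ 3 := by simpa using hp1
    exact hpo (hpp.dvd_of_dvd_pow h8)

end Qm1

end Ip
namespace Ip

section Pq
variable {F}

lemma arith_two {q t N e1 e2 o1 o2 : ℕ} (hq7 : 7 ≤ q) (ht2 : 2 ≤ t) (hN : N = (q + 1) * t)
    (h1 : e1 * o1 = N) (h2 : e2 * o2 = N) (he1 : 2 ≤ e1) (hle : e1 ≤ e2)
    (hd2 : 2 * e2 ∣ q + 1) (hs : o1 + o2 + (q + 1) = N + 2) :
    (q = 7 ∧ t = 3 ∧ e1 = 2 ∧ e2 = 4) ∨ (q = 19 ∧ t = 3) ∨ (q = 11 ∧ t = 5 ∧ e1 = 2 ∧ e2 = 3) ∨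
      (q = 11 ∧ t = 2) ∨ (q = 29 ∧ t = 2) := by
  have hNpos : 0 < N := by rw [hN]; positivity
  have hle3 : e1 ≤ 3 := by
    by_contra hcon
    push Not at hcon
    have a1 : 4 * o1 ≤ N := by rw [← h1]; exact Nat.mul_le_mul_right _ (by omega)
    have a2 : 4 * o2 ≤ N := by rw [← h2]; exact Nat.mul_le_mul_right _ (by omega)
    have a3 : (q + 1) * 2 ≤ N := by rw [hN]; exact Nat.mul_le_mul_left _ ht2
    omega
  have he2le : 2 * e2 ≤ q + 1 := Nat.le_of_dvd (by omega) hd2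
  obtain rfl | rfl : e1 = 2 ∨ e1 = 3 := by omega
  · have a1 : 2 * o2 + 2 * (q + 1) = N + 4 := by omega
    rcases Nat.lt_or_ge t 3 with ht | ht
    · obtain rfl : t = 2 := by omega
      have : o2 = 2 := by omega
      subst this
      omega
    · have hlt : e2 < 6 := by
        by_contra hcon
        have a2 : 6 * o2 ≤ N := by rw [← h2]; exact Nat.mul_le_mul_right _ (by omega)
        have a3 : (q + 1) * 3 ≤ N := by rw [hN]; exact Nat.mul_le_mul_left _ ht
        omega
      obtain rfl | rfl | rfl | rfl : e2 = 2 ∨ e2 = 3 ∨ e2 = 4 ∨ e2 = 5 := by omega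
      · omega
      · have a3 : 6 * (q + 1) = N + 12 := by omega
        have a4 : t < 6 := by
          by_contra hcon
          have : (q + 1) * 6 ≤ N := by rw [hN]; exact Nat.mul_le_mul_left _ (by omega)
          omega
        interval_cases t <;> omega
      · have a3 : 4 * (q + 1) = N + 8 := by omega
        have a4 : t < 4 := by
          by_contra hcon
          have : (q + 1) * 4 ≤ N := by rw [hN]; exact Nat.mul_le_mul_left _ (by omega)
          omega
        interval_cases t; omega
      · have a3 : 10 * (q + 1) = 3 * N + 20 := by omega
        have a4 : t < 4 := by
          by_contra hcon
          have : (q + 1) * 4 ≤ N := by rw [hN]; exact Nat.mul_le_mul_left _ (by omega)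
          omega
        interval_cases t; omega
  · have a2 : 3 * o2 ≤ N := by rw [← h2]; exact Nat.mul_le_mul_right _ (by omega)
    have a1 : 3 * o2 + 3 * (q + 1) = 2 * N + 6 := by omega
    have a4 : t < 3 := by
      by_contra hcon
      have : (q + 1) * 3 ≤ N := by rw [hN]; exact Nat.mul_le_mul_left _ (by omega)
      omega
    obtain rfl : t = 2 := by omega
    have hlt : e2 < 6 := by
      by_contra hcon
      have a2 : 6 * o2 ≤ N := by rw [← h2]; exact Nat.mul_le_mul_right _ (by omega)
      omega
    obtain rfl | rfl | rfl : e2 = 3 ∨ e2 = 4 ∨ e2 = 5 := by omega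
    · omega
    · omega
    · omega

/-- the Klein data in defining odd characteristic -/
theorem klein_p [Fintype F] {k : Type} [Field k] {p : ℕ} [Fact p.Prime] [CharP F p] [CharP k p]
    (hodd : Odd p) {H : Subgroup (PSL2 F)} (hH : HasIp k p H) :
    dd F = 2 ∧ Nat.card (lift H ⊓ Ug F : Subgroup (SL F)) = 1 ∧
    MulAction.IsPretransitive (lift H) (P1 F) ∧
    ∃ t : ℕ, 0 < t ∧ 2 * t ∣ Fintype.card F - 1 ∧ Nat.card H = (Fintype.card F + 1) * t ∧
      ∃ (ι : Type) (_ : Fintype ι) (z : ι → Np F) (e o : ι → ℕ),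
        (∀ i, Nat.card (Kz (lift H) (z i)) = 2 * e i ∧ 2 ≤ e i ∧ e i * o i = Nat.card H ∧
          {y | ∃ s ∈ lift H, s • z i = y}.ncard = o i) ∧
        (∀ y : Np F, (∃ s ∈ lift H, s ∉ Subgroup.center (SL F) ∧ s • y = y) →
          ∃ i, ∃ s ∈ lift H, s • z i = y) ∧
        (∀ i j, (∃ s ∈ lift H, s • z i = z j) → i = j) ∧
        (∑ i, ((Nat.card H : ℤ) - o i)) = Nat.card H + Fintype.card F - 1 := by
  have hpp : p.Prime := Fact.out
  obtain ⟨⟨f, hf0⟩, -, hf⟩ := FiniteField.card F p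
  simp only [PNat.mk_coe] at hf
  have hpq : p ∣ Fintype.card F := by rw [hf]; exact dvd_pow_self p hf0.ne'
  have hq1 : ¬ p ∣ Fintype.card F + 1 := by
    intro h
    exact hpp.one_lt.ne' (Nat.dvd_one.1 ((Nat.dvd_add_right hpq).1 h))
  have hqodd : Odd (Fintype.card F) := by rw [hf]; exact hodd.pow
  have htr := isTrans hH hq1
  have hd : dd F = 2 := by
    rw [center_card]
    apply Nat.gcd_eq_left
    obtain ⟨m, hm⟩ := hqodd
    omega
  obtain ⟨v, t, hv, hvq, ht, hcard, ι, hι, z, e, o, h1, h2, h3, h4⟩ := klein H htr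
  have hv1 : v = 1 := by
    rw [hf] at hvq
    obtain ⟨m, -, hm⟩ := (Nat.dvd_prime_pow hpp).1 hvq
    rcases Nat.eq_zero_or_pos m with h0 | h0
    · rw [hm, h0, pow_zero]
    · exfalso
      apply hH.1
      rw [hcard, hm]
      exact Dvd.dvd.mul_right (Dvd.dvd.mul_left (dvd_pow_self p h0.ne') _) _
  have hcp : 0 < Nat.card H := Nat.card_pos
  refine ⟨hd, by rw [← hv, hv1], htr, t, ?_, ?_, ?_, ι, hι, z, e, o, ?_, h2, h3, ?_⟩
  · rcases Nat.eq_zero_or_pos t with h0 | h0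
    · rw [hcard, h0, mul_zero] at hcp; exact absurd hcp (lt_irrefl _)
    · exact h0
  · rw [← hd]; exact ht
  · rw [hcard, hv1, mul_one]
  · intro i
    obtain ⟨a, b, c, d⟩ := h1 i
    exact ⟨by rw [a, hd], b, c, d⟩
  · rw [h4, hv1]; push_cast; ring

/-- arithmetic consequences when `t ≥ 2` -/
theorem arith_klein {q t N : ℕ} {ι : Type} [Fintype ι] {e o : ι → ℕ} (hq7 : 7 ≤ q) (ht2 : 2 ≤ t)
    (hN : N = (q + 1) * t) (h1 : ∀ i, 2 * e i ∣ q + 1 ∧ 2 ≤ e i ∧ e i * o i = N)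
    (hs : (∑ i, ((N : ℤ) - o i)) = N + q - 1) :
    ∃ i j, i ≠ j ∧ (∀ l, l = i ∨ l = j) ∧ ((q = 7 ∧ t = 3 ∧ e i = 2 ∧ e j = 4) ∨ (q = 19 ∧ t = 3) ∨
      (q = 11 ∧ t = 5 ∧ e i = 2 ∧ e j = 3) ∨
      (q = 11 ∧ t = 2) ∨ (q = 29 ∧ t = 2)) := by
  have hb : ∀ i, 2 * o i ≤ N := by
    intro i
    rw [← (h1 i).2.2]
    exact Nat.mul_le_mul_right _ (h1 i).2.1
  have hb2 := sum_o_bound hb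
  rw [hs] at hb2
  have a3 : (q + 1) * 2 ≤ N := by rw [hN]; exact Nat.mul_le_mul_left _ ht2
  have hr : Fintype.card ι < 3 := by
    by_contra hcon
    have : (3 : ℤ) * N ≤ Fintype.card ι * N := by
      apply mul_le_mul_of_nonneg_right _ (by positivity)
      exact_mod_cast (by omega : 3 ≤ Fintype.card ι)
    push_cast at hb2
    rw [one_mul] at hb2
    omega
  obtain h0 | h0 | h0 : Fintype.card ι = 0 ∨ Fintype.card ι = 1 ∨ Fintype.card ι = 2 := by omega
  · rw [sum_zero_of_card _ h0] at hs
    omega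
  · obtain ⟨i, -, hi⟩ := sum_one_of_card h0
    rw [hi] at hs
    omega
  · obtain ⟨i, j, hij, hall, hsum⟩ := sum_two_of_card h0
    rw [hsum] at hs
    have hs' : o i + o j + (q + 1) = N + 2 := by omega
    rcases le_total (e i) (e j) with hle | hle
    · exact ⟨i, j, hij, hall, arith_two hq7 ht2 hN (h1 i).2.2 (h1 j).2.2 (h1 i).2.1 hle (h1 j).1 hs'⟩
    · exact ⟨j, i, hij.symm, fun l => (hall l).symm,
        arith_two hq7 ht2 hN (h1 j).2.2 (h1 i).2.2 (h1 j).2.1 hle (h1 i).1 (by omega)⟩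

/-- exclusion of `q = 9` -/
theorem arith_nine {t N : ℕ} {ι : Type} [Fintype ι] {e o : ι → ℕ} (ht : 2 * t ∣ 8) 
    (hN : N = 10 * t) (h1 : ∀ i, 2 * e i ∣ 10 ∧ 2 ≤ e i ∧ e i * o i = N)
    (hs : (∑ i, ((N : ℤ) - o i)) = N + 9 - 1) : False := by
  have ho : ∀ i, o i = 2 * t := by
    intro i
    obtain ⟨a, b, c⟩ := h1 i
    have h5 : e i = 5 := by
      have : e i ≤ 5 := by have := Nat.le_of_dvd (by norm_num) a; omega
      generalize e i = x at *
      interval_cases x <;> revert a <;> decide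
    rw [h5] at c
    omega
  have h2 : (∑ i, ((N : ℤ) - o i)) = Fintype.card ι * (8 * t) := by
    rw [Finset.sum_congr rfl (g := fun _ => (8 * t : ℤ))]
    · simp
    · intro i _
      rw [ho, hN]; push_cast; ring
  rw [h2, hN] at hs
  have htle : t ≤ 4 := by have := Nat.le_of_dvd (by norm_num) ht; omega
  push_cast at hs
  interval_cases t <;> push_cast at hs <;> omega

end Pq

end Ip
namespace Ip

section Nonprime
variable {F}

lemma smul_v0 (s : SL F) (v : Fin 2 → F) : (s • v) 0 = s 0 0 * v 0 + s 0 1 * v 1 := by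
  simp [Matrix.SpecialLinearGroup.smul_def, Matrix.mulVec, dotProduct, Fin.sum_univ_two]

lemma smul_v1 (s : SL F) (v : Fin 2 → F) : (s • v) 1 = s 1 0 * v 0 + s 1 1 * v 1 := by
  simp [Matrix.SpecialLinearGroup.smul_def, Matrix.mulVec, dotProduct, Fin.sum_univ_two]

/-- normaliser of the nonsplit torus -/
def Dt (δ : F) : Subgroup (SL F) where
  carrier := {s | (s 1 1 = s 0 0 ∧ s 0 1 = δ * s 1 0) ∨ (s 1 1 = - s 0 0 ∧ s 0 1 = - (δ * s 1 0))}
  one_mem' := by left; simp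
  mul_mem' := by
    rintro a b ha hb
    simp only [Set.mem_setOf_eq] at *
    rw [mul00, mul01, mul10, mul11]
    rcases ha with ⟨h1, h2⟩ | ⟨h1, h2⟩ <;> rcases hb with ⟨h3, h4⟩ | ⟨h3, h4⟩ <;>
      rw [h1, h2, h3, h4]
    · left; constructor <;> ring
    · right; constructor <;> ring
    · right; constructor <;> ring
    · left; constructor <;> ring
  inv_mem' := by
    rintro a ha
    simp only [Set.mem_setOf_eq] at *
    rw [inv00, inv01, inv10, inv11]
    rcases ha with ⟨h1, h2⟩ | ⟨h1, h2⟩ <;> rw [h1, h2]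
    · left; constructor <;> ring
    · right; constructor <;> ring

lemma mem_Dt {δ : F} {s : SL F} : s ∈ Dt δ ↔
    (s 1 1 = s 0 0 ∧ s 0 1 = δ * s 1 0) ∨ (s 1 1 = - s 0 0 ∧ s 0 1 = - (δ * s 1 0)) := Iff.rfl

lemma exists_sqrt {δ : F} (hδ : ¬ IsSquare δ) : ∃ z : Np F, z.1 ^ 2 = ac δ := by
  obtain ⟨z, hz⟩ := IsAlgClosed.exists_pow_nat_eq (ac δ) (n := 2) (by norm_num)
  refine ⟨⟨z, ?_⟩, hz⟩
  rintro ⟨x, rfl⟩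
  apply hδ
  refine ⟨x, ?_⟩
  have : ac (x ^ 2) = ac δ := by rw [← hz]; simp [ac]
  have := (algebraMap F (AlgebraicClosure F)).injective this
  rw [← this, sq]

lemma stab_sqrt {δ : F} {z : Np F} (hz : z.1 ^ 2 = ac δ) (s : SL F) :
    s • z = z ↔ s 1 1 = s 0 0 ∧ s 0 1 = δ * s 1 0 := by
  rw [smul_np_quad, hz]
  constructor
  · intro h
    have h1 : ac (s 1 1 - s 0 0) * z.1 + ac (δ * s 1 0 - s 0 1) = 0 := by
      rw [← h]; simp only [ac, map_sub, map_mul]; ring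
    obtain ⟨h2, h3⟩ := ac_lin z h1
    exact ⟨sub_eq_zero.1 h2, (sub_eq_zero.1 h3).symm⟩
  · rintro ⟨h1, h2⟩
    rw [h1, h2]; simp only [ac, map_sub, map_mul]; ring

lemma norm_ne {δ : F} (hδ : ¬ IsSquare δ) {c d : F} (h : d ≠ 0 ∨ c ≠ 0) : d ^ 2 - δ * c ^ 2 ≠ 0 := by
  intro h0
  have hc : c ≠ 0 := by
    rintro rfl
    rcases h with h | h
    · apply h; simpa using h0
    · exact h rfl
  apply hδ
  refine ⟨d / c, ?_⟩
  field_simp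
  linear_combination -h0

lemma card_stab_sqrt [Fintype F] {δ : F} (hδ : ¬ IsSquare δ) {z : Np F} (hz : z.1 ^ 2 = ac δ) :
    Nat.card (MulAction.stabilizer (SL F) z) = Fintype.card F + 1 := by
  classical
  have h1 : Nat.card (MulAction.stabilizer (SL F) z) ∣ Fintype.card F + 1 := by
    have := Kz_card_dvd (⊤ : Subgroup (SL F)) z
    rwa [Kz, top_inf_eq] at this
  have hor : (MulAction.orbit (SL F) z).ncard ≤ Fintype.card F * (Fintype.card F - 1) := by
    have hsub : (fun y : Np F => y.1) '' MulAction.orbit (SL F) z ⊆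
        Set.range (fun xy : F × Fˣ => ac xy.1 + ac (xy.2 : F) * z.1) := by
      rintro _ ⟨_, ⟨s, rfl⟩, rfl⟩
      have hn : (s 1 1) ^ 2 - δ * (s 1 0) ^ 2 ≠ 0 := by
        apply norm_ne hδ
        by_contra hcon
        push Not at hcon
        have := det1 s
        rw [hcon.1, hcon.2] at this
        simp at this
      refine ⟨((s 0 1 * s 1 1 - s 0 0 * s 1 0 * δ) / ((s 1 1) ^ 2 - δ * (s 1 0) ^ 2),
        Units.mk0 (((s 1 1) ^ 2 - δ * (s 1 0) ^ 2)⁻¹) (inv_ne_zero hn)), ?_⟩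
      have hden : den s z ≠ 0 := den_ne s z
      have hnE : ac ((s 1 1) ^ 2 - δ * (s 1 0) ^ 2) ≠ 0 := (map_ne_zero _).2 hn
      simp only [Units.val_mk0]
      have key : (num s z) * ac ((s 1 1) ^ 2 - δ * (s 1 0) ^ 2) =
          (ac (s 0 1 * s 1 1 - s 0 0 * s 1 0 * δ) + z.1) * den s z := by
        have hd := ac_det s
        unfold num den
        simp only [ac, map_sub, map_mul, map_pow] at hz hd ⊢
        linear_combination (- (algebraMap F (AlgebraicClosure F) (s 1 0))) * hz +
          (z.1 * (algebraMap F (AlgebraicClosure F) (s 1 1)) +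
            algebraMap F (AlgebraicClosure F) δ * (algebraMap F (AlgebraicClosure F) (s 1 0))) * hd
      change _ = (s • z).1
      rw [smul_np, eq_div_iff hden]
      have e1 : ac ((s 0 1 * s 1 1 - s 0 0 * s 1 0 * δ) / ((s 1 1) ^ 2 - δ * (s 1 0) ^ 2)) =
        ac (s 0 1 * s 1 1 - s 0 0 * s 1 0 * δ) / ac ((s 1 1) ^ 2 - δ * (s 1 0) ^ 2) := map_div₀ _ _ _
      have e2 : ac (((s 1 1) ^ 2 - δ * (s 1 0) ^ 2)⁻¹) = (ac ((s 1 1) ^ 2 - δ * (s 1 0) ^ 2))⁻¹ :=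
        map_inv₀ _ _
      rw [e1, e2]
      generalize ac ((s 1 1) ^ 2 - δ * (s 1 0) ^ 2) = n at *
      rw [div_eq_mul_inv]
      have hn1 : n * n⁻¹ = 1 := mul_inv_cancel₀ hnE
      linear_combination (-n⁻¹) * key + num s z * hn1
    have h2 := Set.ncard_le_ncard hsub (Set.finite_range _)
    rw [Set.ncard_image_of_injective _ Subtype.val_injective] at h2
    refine h2.trans ?_
    rw [← Set.image_univ]
    refine (Set.ncard_image_le).trans ?_
    rw [Set.ncard_univ, Nat.card_eq_fintype_card, Fintype.card_prod, Fintype.card_units]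
  rw [← MulAction.index_stabilizer] at hor
  have h3 := Subgroup.card_mul_index (MulAction.stabilizer (SL F) z)
  rw [card_SL] at h3
  have hq : 1 < Fintype.card F := Fintype.one_lt_card
  apply le_antisymm (Nat.le_of_dvd (by omega) h1)
  obtain ⟨m, hm⟩ : ∃ m, Fintype.card F = m + 2 := ⟨Fintype.card F - 2, by omega⟩
  rw [hm] at h3 hor ⊢
  have h4 : (m + 2) ^ 2 - 1 = (m + 1) * (m + 3) := by
    have : (m + 2) ^ 2 = (m + 1) * (m + 3) + 1 := by ring
    omega
  rw [h4] at h3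
  have h5 : m + 2 - 1 = m + 1 := by omega
  rw [h5] at hor
  have h6 := Nat.mul_le_mul_left (Nat.card (MulAction.stabilizer (SL F) z)) hor
  rw [h3] at h6
  have h7 : ((m + 2) * (m + 1)) * (m + 3) ≤ ((m + 2) * (m + 1)) * Nat.card (MulAction.stabilizer (SL F) z) := by
    nlinarith
  exact Nat.le_of_mul_le_mul_left h7 (by positivity)

lemma card_Dt [Fintype F] (hq : Odd (Fintype.card F)) {δ : F} (hδ : ¬ IsSquare δ) :
    Nat.card (Dt δ) = 2 * (Fintype.card F + 1) := by
  classical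
  obtain ⟨z, hz⟩ := exists_sqrt hδ
  have h2 : (2 : F) ≠ 0 := by
    intro h
    haveI : CharP F 2 := CharTwo.of_one_ne_zero_of_two_eq_zero one_ne_zero h
    obtain ⟨⟨n, hn⟩, -, hc⟩ := FiniteField.card F 2
    rw [hc] at hq
    simp only [PNat.mk_coe] at hq
    rw [Nat.odd_pow_iff hn.ne'] at hq
    exact absurd hq (by decide)
  have hδ0 : δ ≠ 0 := by rintro rfl; exact hδ ⟨0, by simp⟩
  obtain ⟨a, b, hab⟩ := FiniteField.exists_root_sum_quadratic (R := F)
    (f := Polynomial.X ^ 2 + Polynomial.C 1) (g := Polynomial.C (-δ) * Polynomial.X ^ 2)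
    (by apply Polynomial.degree_X_pow_add_C; norm_num)
    (by apply Polynomial.degree_C_mul_X_pow; simpa using hδ0)
    (Nat.odd_iff.1 hq)
  simp only [Polynomial.eval_add, Polynomial.eval_mul, Polynomial.eval_pow, Polynomial.eval_X,
    Polynomial.eval_C] at hab
  let s0 : SL F := mk4 a (-(δ * b)) b (-a) (by linear_combination -hab)
  have hs0 : s0 ∈ Dt δ := Or.inr ⟨by simp [s0, mk4], by simp [s0, mk4]⟩
  have hle : MulAction.stabilizer (SL F) z ≤ Dt δ := by
    intro s hs
    exact Or.inl ((stab_sqrt hz s).1 hs)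
  have hsplit : ∀ s ∈ Dt δ, s ∈ MulAction.stabilizer (SL F) z ∨
      (s 1 1 = - s 0 0 ∧ s 0 1 = - (δ * s 1 0)) := by
    rintro s (h | h)
    · left; exact (stab_sqrt hz s).2 h
    · right; exact h
  have hexcl : ∀ s : SL F, s ∈ MulAction.stabilizer (SL F) z →
      (s 1 1 = - s 0 0 ∧ s 0 1 = - (δ * s 1 0)) → False := by
    intro s hs h
    obtain ⟨h3, h4⟩ := (stab_sqrt hz s).1 hs
    have h5 : s 0 0 = 0 := by
      have : 2 * s 0 0 = 0 := by linear_combination h.1 - h3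
      exact (mul_eq_zero.1 this).resolve_left h2
    have h6 : δ * s 1 0 = 0 := by
      have : 2 * (δ * s 1 0) = 0 := by linear_combination h.2 - h4
      exact (mul_eq_zero.1 this).resolve_left h2
    have := det1 s
    rw [h4, h6, h5] at this
    simp at this
  have hidx : ((MulAction.stabilizer (SL F) z).subgroupOf (Dt δ)).index = 2 := by
    rw [Subgroup.index_eq_two_iff]
    refine ⟨⟨s0, hs0⟩, ?_⟩
    rintro ⟨s, hs⟩
    rw [Subgroup.mem_subgroupOf, Subgroup.mem_subgroupOf]
    change Xor (s * s0 ∈ MulAction.stabilizer (SL F) z) (s ∈ MulAction.stabilizer (SL F) z)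
    have hprod : ∀ s : SL F, (s 1 1 = - s 0 0 ∧ s 0 1 = - (δ * s 1 0)) →
        s * s0 ∈ MulAction.stabilizer (SL F) z := by
      rintro s ⟨h3, h4⟩
      refine (stab_sqrt hz _).2 ?_
      rw [mul00, mul01, mul10, mul11, h3, h4]
      simp only [s0, mk4_00, mk4_01, mk4_10, mk4_11]
      constructor <;> ring
    rcases hsplit s hs with h | h
    · refine Or.inr ⟨h, fun h5 => ?_⟩
      have h6 : s0 ∈ MulAction.stabilizer (SL F) z := by
        have := mul_mem (inv_mem h) h5
        rwa [inv_mul_cancel_left] at this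
      exact hexcl s0 h6 ⟨by simp [s0, mk4], by simp [s0, mk4]⟩
    · exact Or.inl ⟨hprod s h, fun h5 => hexcl s h5 h⟩
  have h3 := Subgroup.card_mul_index ((MulAction.stabilizer (SL F) z).subgroupOf (Dt δ))
  rw [hidx, Nat.card_congr (Subgroup.subgroupOfEquivOfLe hle).toEquiv, card_stab_sqrt hδ hz] at h3
  rw [← h3, mul_comm]

lemma Q_inv {δ : F} {s : SL F} (hs : s ∈ Dt δ) (v : Fin 2 → F) :
    (((s • v) 0) ^ 2 - δ * ((s • v) 1) ^ 2) = ((v 0) ^ 2 - δ * (v 1) ^ 2) ∨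
    (((s • v) 0) ^ 2 - δ * ((s • v) 1) ^ 2) = -((v 0) ^ 2 - δ * (v 1) ^ 2) := by
  rw [smul_v0, smul_v1]
  have hd := det1 s
  rcases hs with ⟨h1, h2⟩ | ⟨h1, h2⟩
  · left
    rw [h1, h2] at hd ⊢
    linear_combination (v 0 ^ 2 - δ * v 1 ^ 2) * hd
  · right
    rw [h1, h2] at hd ⊢
    linear_combination - (v 0 ^ 2 - δ * v 1 ^ 2) * hd

lemma sum_inv_pow_units [Fintype F] [DecidableEq F] (n : ℕ) :
    ∑ x : Fˣ, ((x⁻¹ : Fˣ) : F) ^ n = ∑ x : Fˣ, (x : F) ^ n :=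
  Fintype.sum_equiv (Equiv.inv Fˣ) _ _ (fun _ => rfl)

/-- torus sum vanishes -/
lemma sum_torus [Fintype F] [DecidableEq F] {p : ℕ} [Fact p.Prime] [CharP F p] (hp : 3 ≤ p)
    (hq : 2 * p + 2 < Fintype.card F - 1) (δ x y : F) :
    ∑ μ : Fˣ, (((μ : F) * x) ^ 2 - δ * (((μ⁻¹ : Fˣ) : F) * y) ^ 2) ^ (1 + p) = 0 := by
  have hz : ∀ n : ℕ, 0 < n → n < Fintype.card F - 1 → ∑ μ : Fˣ, (μ : F) ^ n = 0 := by
    intro n h1 h2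
    rw [FiniteField.sum_pow_units, if_neg]
    intro h
    have := Nat.le_of_dvd h1 h
    omega
  have hexp : ∀ μ : Fˣ, (((μ : F) * x) ^ 2 - δ * (((μ⁻¹ : Fˣ) : F) * y) ^ 2) ^ (1 + p) =
      (x ^ (2 * p + 2)) * (μ : F) ^ (2 * p + 2) - (δ * y ^ 2 * x ^ (2 * p)) * (μ : F) ^ (2 * p - 2)
      - (x ^ 2 * δ ^ p * y ^ (2 * p)) * ((μ⁻¹ : Fˣ) : F) ^ (2 * p - 2)
      + (δ ^ (p + 1) * y ^ (2 * p + 2)) * ((μ⁻¹ : Fˣ) : F) ^ (2 * p + 2) := by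
    intro μ
    obtain ⟨m, hm⟩ : ∃ m, 2 * p = m + 2 := ⟨2 * p - 2, by omega⟩
    have h1 : (μ : F) * ((μ⁻¹ : Fˣ) : F) = 1 := by simp
    rw [pow_add, pow_one, sub_pow_char]
    generalize ((μ⁻¹ : Fˣ) : F) = ν at *
    generalize (μ : F) = μ' at *
    rw [mul_pow (δ), ← pow_mul, ← pow_mul, hm]
    have e1 : m + 2 - 2 = m := by omega
    rw [e1]
    have h2 : μ' ^ 2 * ν ^ 2 = 1 := by rw [← mul_pow, h1, one_pow]
    rw [mul_pow, mul_pow, mul_pow, mul_pow]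
    rw [pow_succ δ p]
    linear_combination (-(x ^ 2 * δ ^ p * y ^ (m + 2) * ν ^ m) - δ * y ^ 2 * x ^ (m + 2) * μ' ^ m) * h2
  simp only [hexp]
  rw [Finset.sum_add_distrib, Finset.sum_sub_distrib, Finset.sum_sub_distrib, ← Finset.mul_sum,
    ← Finset.mul_sum, ← Finset.mul_sum, ← Finset.mul_sum, sum_inv_pow_units, sum_inv_pow_units,
    hz _ (by omega) (by omega), hz _ (by omega) (by omega)]
  ring

theorem no_nonprime [Fintype F] {k : Type} [Field k] [IsAlgClosed k] {p : ℕ} [Fact p.Prime] [CharP F p]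
    [CharP k p] (hodd : Odd p) (hq : 2 * p + 2 < Fintype.card F - 1) {H : Subgroup (PSL2 F)}
    (hH : HasIp k p H) (hd : dd F = 2) (hc : Nat.card H = Fintype.card F + 1) : False := by
  classical
  have hpp : p.Prime := Fact.out
  have hp3 : 3 ≤ p := by
    have := hpp.two_le
    obtain ⟨m, hm⟩ := hodd
    omega
  have hqodd : Odd (Fintype.card F) := by
    obtain ⟨n, -, hf⟩ := FiniteField.card F p
    rw [hf]; exact hodd.pow
  obtain ⟨δ, hδ⟩ := FiniteField.exists_nonsquare (F := F) (by
    rw [ringChar.eq F p]; omega)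
  have hcen : Subgroup.center (SL F) ≤ Dt δ := by
    intro s hs
    obtain ⟨h1, h2, h3⟩ := (mem_center _).1 hs
    exact Or.inl ⟨h3.symm, by rw [h1, h2, mul_zero]⟩
  have hcD := card_map_pr (Dt δ) hcen
  rw [hd, card_Dt hqodd hδ] at hcD
  have hD : HasIp k p ((Dt δ).map (pr F)) := hasIp_of_card_eq hH (by omega)
  obtain ⟨ι⟩ := exists_emb F k p
  have hlift : ∀ h ∈ lift ((Dt δ).map (pr F)), h ∈ Dt δ := by
    rintro h ⟨s, hs, hsh⟩
    have h1 : pr F (s⁻¹ * h) = 1 := by rw [map_mul, map_inv, hsh, inv_mul_cancel]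
    have h2 := hcen ((pr_eq_one _).1 h1)
    have := mul_mem hs h2
    rwa [mul_inv_cancel_left] at this
  have hev : Even (1 + p) := by obtain ⟨m, hm⟩ := hodd; exact ⟨m + 1, by omega⟩
  obtain ⟨w, hw⟩ := exists_weights hD (Y := Fin 2 → F)
    (fun v => ι (((v 0) ^ 2 - δ * (v 1) ^ 2) ^ (1 + p)))
    (by
      intro h hh y
      rcases Q_inv (hlift h hh) y with h1 | h1
      · simp only [h1]
      · simp only [h1]
        rw [hev.neg_pow])
    (by
      intro h0
      have := congrFun h0 ![1, 0]
      simp at this)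
  have h1 : ∑ μ : Fˣ, ∑ v : Fin 2 → F, w v * ι ((((T μ • v) 0) ^ 2 - δ * ((T μ • v) 1) ^ 2) ^ (1 + p)) =
      ((Fintype.card F - 1 : ℕ) : k) := by
    rw [Finset.sum_congr rfl (fun μ _ => hw (T μ))]
    rw [Finset.sum_const, nsmul_eq_mul, mul_one, Finset.card_univ, Fintype.card_units]
  rw [Finset.sum_comm] at h1
  have h2 : ∀ v : Fin 2 → F, ∑ μ : Fˣ, w v * ι ((((T μ • v) 0) ^ 2 - δ * ((T μ • v) 1) ^ 2) ^ (1 + p)) = 0 := by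
    intro v
    rw [← Finset.mul_sum, ← map_sum]
    have := sum_torus hp3 hq δ (v 0) (v 1)
    rw [Finset.sum_congr rfl (g := fun μ : Fˣ => (((μ : F) * v 0) ^ 2 - δ * (((μ⁻¹ : Fˣ) : F) * v 1) ^ 2) ^ (1 + p)),
      this, map_zero, mul_zero]
    intro μ _
    rw [smul_v0, smul_v1, T00, T01, T10, T11]
    congr 3 <;> ring
  rw [Finset.sum_congr rfl (fun v _ => h2 v), Finset.sum_const_zero] at h1
  have hpq : p ∣ Fintype.card F := by
    obtain ⟨n, -, hf⟩ := FiniteField.card F p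
    rw [hf]; exact dvd_pow_self p n.ne_zero
  have h3 : p ∣ Fintype.card F - 1 := (CharP.cast_eq_zero_iff k p _).1 h1.symm
  have h4 : p ∣ 1 := by
    have := (Nat.dvd_sub hpq h3)
    rwa [show Fintype.card F - (Fintype.card F - 1) = 1 by omega] at this
  exact hpp.one_lt.ne' (Nat.dvd_one.1 h4)

end Nonprime

end Ip
namespace Ip

section PrimeField
variable {F}

lemma sum_pow_F [Fintype F] (n : ℕ) (hn : 0 < n) :
    ∑ x : F, x ^ n = if Fintype.card F - 1 ∣ n then -1 else 0 := by
  classical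
  rw [← FiniteField.sum_pow_units]
  have h1 : ∑ x : F, x ^ n = ∑ x ∈ (Finset.univ : Finset F).erase 0, x ^ n := by
    rw [← Finset.add_sum_erase Finset.univ _ (Finset.mem_univ (0 : F)), zero_pow hn.ne', zero_add]
  rw [h1]
  symm
  refine Finset.sum_bij (fun (u : Fˣ) _ => (u : F)) ?_ ?_ ?_ ?_
  · intro u _; simp
  · intro u _ v _ h; exact Units.ext h
  · intro x hx
    exact ⟨Units.mk0 x (Finset.ne_of_mem_erase hx), Finset.mem_univ _, rfl⟩
  · intro u _; rfl

lemma sum_extract [Fintype F] {k : Type*} [Field k] (ι : F →+* k) {n b : ℕ} (hn : n < Fintype.card F - 1)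
    (hb : b ≤ n) (A B : k) :
    ∑ d : F, ι d ^ (Fintype.card F - 1 - (n - b)) * (A + ι d * B) ^ n =
      - ((n.choose b : k) * A ^ b * B ^ (n - b)) := by
  have h1 : ∀ d : F, ι d ^ (Fintype.card F - 1 - (n - b)) * (A + ι d * B) ^ n =
      ∑ r ∈ Finset.range (n + 1), (A ^ r * B ^ (n - r) * (n.choose r : k)) *
        ι (d ^ (Fintype.card F - 1 - (n - b) + (n - r))) := by
    intro d
    rw [add_pow, Finset.mul_sum]
    apply Finset.sum_congr rfl
    intro r _
    rw [map_pow, pow_add, mul_pow]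
    ring
  simp only [h1]
  rw [Finset.sum_comm]
  simp only [← Finset.mul_sum, ← map_sum]
  rw [Finset.sum_eq_single b]
  · rw [sum_pow_F _ (by omega), if_pos (by
      rw [show Fintype.card F - 1 - (n - b) + (n - b) = Fintype.card F - 1 by omega])]
    rw [map_neg, map_one]; ring
  · intro r hr hrb
    have hr' : r ≤ n := by have := Finset.mem_range.1 hr; omega
    rw [sum_pow_F _ (by omega), if_neg, map_zero, mul_zero]
    rintro ⟨c, hc⟩
    have hc1 : c < 2 := by
      by_contra hcon
      have := Nat.mul_le_mul_left (Fintype.card F - 1) (by omega : 2 ≤ c)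
      omega
    interval_cases c
    · omega
    · omega
  · intro h
    exact absurd (Finset.mem_range.2 (by omega)) h

lemma e1_def : (![1, 0] : Fin 2 → F) 0 = 1 ∧ (![1, 0] : Fin 2 → F) 1 = 0 := ⟨rfl, rfl⟩

lemma exists_row (c d : F) (h : c ≠ 0 ∨ d ≠ 0) : ∃ s : SL F, s 1 0 = c ∧ s 1 1 = d := by
  by_cases hc : c = 0
  · have hd : d ≠ 0 := h.resolve_left (fun h => h hc)
    exact ⟨mk4 d⁻¹ 0 c d (by rw [inv_mul_cancel₀ hd]; ring), mk4_10 .., mk4_11 ..⟩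
  · exact ⟨mk4 0 (-c⁻¹) c d (by field_simp; ring), mk4_10 .., mk4_11 ..⟩

lemma claimA [Fintype F] {k : Type} [Field k] {p : ℕ} [CharP k p] {H : Subgroup (PSL2 F)}
    (hH : HasIp k p H) (ι : F →+* k) {n : ℕ} (hn1 : 1 ≤ n) (hn : n < Fintype.card F - 1)
    (g : (Fin 2 → F) → k) (hinv : ∀ h ∈ lift H, ∀ v, g (h • v) = g v) (h1 : g ![1, 0] ≠ 0)
    (h3 : ∀ v, ∑ t : F, ι t ^ (Fintype.card F - 1 - n) * g (U t • v) = - (g ![1, 0] * ι (v 1) ^ n))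
    (h4 : ∀ w : (Fin 2 → F) → k, (∀ c d : F, ∑ v, w v * ι (c * v 0 + d * v 1) ^ n = 0) →
      ∑ v, w v * g v = 0) : False := by
  classical
  obtain ⟨w, hw⟩ := exists_weights hH g hinv (fun h => h1 (by rw [h]; rfl))
  have key : ∀ s : SL F, ∑ v, w v * ι ((s • v) 1) ^ n = 0 := by
    intro s
    have e1 : ∑ t : F, ι t ^ (Fintype.card F - 1 - n) * ∑ v, w v * g ((U t * s) • v) = 0 := by
      simp only [hw, mul_one]
      simp only [← map_pow]
      rw [← map_sum, sum_pow_F _ (by omega), if_neg, map_zero]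
      intro hdvd
      have := Nat.le_of_dvd (by omega) hdvd
      omega
    simp only [Finset.mul_sum] at e1
    rw [Finset.sum_comm] at e1
    have e2 : ∀ v, ∑ t : F, ι t ^ (Fintype.card F - 1 - n) * (w v * g ((U t * s) • v)) =
        (- g ![1, 0]) * (w v * ι ((s • v) 1) ^ n) := by
      intro v
      have := h3 (s • v)
      have e3 : ∀ t : F, ι t ^ (Fintype.card F - 1 - n) * (w v * g ((U t * s) • v)) =
          w v * (ι t ^ (Fintype.card F - 1 - n) * g (U t • s • v)) := by
        intro t; rw [mul_smul]; ring
      simp only [e3]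
      rw [← Finset.mul_sum, this]
      ring
    simp only [e2] at e1
    rw [← Finset.mul_sum] at e1
    exact (mul_eq_zero.1 e1).resolve_left (neg_ne_zero.2 h1)
  have h5 := h4 w (by
    intro c d
    by_cases h : c ≠ 0 ∨ d ≠ 0
    · obtain ⟨s, hs1, hs2⟩ := exists_row c d h
      rw [← key s]
      simp only [smul_v1, hs1, hs2]
    · push Not at h
      rw [h.1, h.2]
      simp [zero_pow (by omega : n ≠ 0)])
  have h6 := hw 1
  simp only [one_smul] at h6
  rw [h5] at h6
  exact zero_ne_one h6

lemma sub_pow_pm1 {k : Type*} [Field k] {p : ℕ} [Fact p.Prime] [CharP k p] (X Y : k) :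
    (X - Y) ^ (p - 1) = ∑ m ∈ Finset.range p, X ^ m * Y ^ (p - 1 - m) := by
  have hp : 2 ≤ p := (Fact.out : p.Prime).two_le
  by_cases h : X = Y
  · subst h
    rw [sub_self, zero_pow (by omega)]
    rw [Finset.sum_congr rfl (g := fun _ => X ^ (p - 1))]
    · simp
    · intro m hm
      rw [← pow_add]; congr 1; have := Finset.mem_range.1 hm; omega
  · have h0 : X - Y ≠ 0 := sub_ne_zero.2 h
    apply mul_right_cancel₀ h0
    rw [geom_sum₂_mul, ← pow_succ, show p - 1 + 1 = p by omega, sub_pow_char]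

lemma sum_V [Fintype F] {k : Type*} [AddCommMonoid k] (f : (Fin 2 → F) → k) :
    ∑ v, f v = ∑ y : F, ∑ x : F, f ![x, y] := by
  rw [← Fintype.sum_prod_type_right']
  refine Fintype.sum_equiv (finTwoArrowEquiv F) _ _ ?_
  intro v
  congr 1
  ext i; fin_cases i <;> rfl

/-- sum of a function of degree zero over the plane -/
lemma sum_deg0 [Fintype F] {k : Type*} [Field k] (ι : F →+* k) (f : (Fin 2 → F) → k) (h0 : f 0 = 0)
    (hf : ∀ (c : F) v, c ≠ 0 → f (c • v) = f v) :
    ∑ v, f v = - (f ![1, 0] + ∑ s : F, f ![s, 1]) := by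
  classical
  have hcq : ((Fintype.card F : ℕ) : k) = 0 := by
    have := map_natCast ι (Fintype.card F)
    rw [FiniteField.cast_card_eq_zero, map_zero] at this
    exact this.symm
  have hcount : ∀ a : k, ∑ x : F, (if x = 0 then 0 else a) = - a := by
    intro a
    have : ∀ x : F, (if x = 0 then 0 else a) = a - (if x = 0 then a else 0) := by
      intro x; split_ifs <;> simp
    simp only [this]
    rw [Finset.sum_sub_distrib]
    simp [hcq]
  rw [sum_V]
  have h1 : ∀ y : F, ∑ x : F, f ![x, y] = (if y = 0 then - f ![1, 0] else 0) +
      (if y = 0 then 0 else ∑ s : F, f ![s, 1]) := by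
    intro y
    by_cases hy : y = 0
    · subst hy
      rw [if_pos rfl, if_pos rfl, add_zero, ← hcount]
      apply Finset.sum_congr rfl
      intro x _
      by_cases hx : x = 0
      · subst hx
        rw [if_pos rfl, ← h0]; congr 1; ext i; fin_cases i <;> rfl
      · rw [if_neg hx, ← hf x ![1, 0] hx]
        congr 1; ext i; fin_cases i <;> simp
    · rw [if_neg hy, if_neg hy, zero_add]
      symm
      refine Fintype.sum_equiv (Equiv.mulLeft₀ y hy) _ _ ?_
      intro s
      rw [← hf y ![s, 1] hy]
      congr 1; ext i; fin_cases i <;> simp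
  rw [Finset.sum_congr rfl (fun y _ => h1 y)]
  rw [Finset.sum_add_distrib, hcount, Finset.sum_ite_eq', if_pos (Finset.mem_univ _), neg_add]

/-- determinant pairing is invariant -/
lemma det_inv (s : SL F) (u v : Fin 2 → F) :
    (s • u) 0 * (s • v) 1 - (s • u) 1 * (s • v) 0 = u 0 * v 1 - u 1 * v 0 := by
  rw [smul_v0, smul_v1, smul_v0, smul_v1]
  have := det1 s
  linear_combination (u 0 * v 1 - u 1 * v 0) * this

/-- a nonzero homogeneous invariant does not vanish at the base point -/
lemma base_ne {K : Subgroup (SL F)} (htr : MulAction.IsPretransitive K (P1 F)) {k : Type*} [Field k]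
    (ι : F →+* k) {n : ℕ} (hn : n ≠ 0) (g : (Fin 2 → F) → k) (hinv : ∀ h ∈ K, ∀ v, g (h • v) = g v)
    (hh : ∀ (c : F) v, g (c • v) = ι c ^ n * g v) (hne : ∃ v, g v ≠ 0) : g ![1, 0] ≠ 0 := by
  obtain ⟨v, hv⟩ := hne
  have hv0 : v 0 ≠ 0 ∨ v 1 ≠ 0 := by
    by_contra hcon
    push Not at hcon
    apply hv
    have : v = (0 : F) • v := by
      ext i; fin_cases i <;> simp [hcon]
    rw [this, hh, map_zero, zero_pow hn, zero_mul]
  obtain ⟨s, hs0, hs1⟩ := exists_col (v 0) (v 1) hv0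
  obtain ⟨⟨h, hK⟩, hx⟩ := htr.exists_smul_eq (s • (pt none : P1 F)) (pt none : P1 F)
  have hx' : h • s • (pt none : P1 F) = pt none := hx
  rw [← mul_smul, smul_pt_none] at hx'
  have hse : s • (![1, 0] : Fin 2 → F) = v := by
    ext i; fin_cases i
    · change (s • (![1, 0] : Fin 2 → F)) 0 = v 0
      rw [smul_v0]; simp [hs0]
    · change (s • (![1, 0] : Fin 2 → F)) 1 = v 1
      rw [smul_v1]; simp [hs1]
  have h2 : h • v = ((h * s : SL F) 0 0) • (![1, 0] : Fin 2 → F) := by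
    rw [← hse, ← mul_smul]
    ext i; fin_cases i
    · change ((h * s) • (![1, 0] : Fin 2 → F)) 0 = _
      rw [smul_v0]; simp
    · change ((h * s) • (![1, 0] : Fin 2 → F)) 1 = _
      rw [smul_v1, hx']; simp
  intro h0
  apply hv
  rw [← hinv h hK, h2, hh, h0, mul_zero]

end PrimeField

end Ip
namespace Ip

section PrimeField2
variable {F}

lemma choose_ne {k : Type*} [Field k] {p : ℕ} [CharP k p] (hp : p.Prime) {n b : ℕ} (hn : n < p) (hb : b ≤ n) :
    (n.choose b : k) ≠ 0 := by
  intro h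
  have h1 := (CharP.cast_eq_zero_iff k p _).1 h
  have h2 : n.choose b ∣ n.factorial := by
    rw [← Nat.choose_mul_factorial_mul_factorial hb, mul_assoc]
    exact dvd_mul_right _ _
  have := (hp.dvd_factorial).1 (h1.trans h2)
  omega

set_option maxHeartbeats 1000000 in
theorem no_small [Fintype F] {k : Type} [Field k] {p : ℕ} [Fact p.Prime] [CharP k p]
    (hcp : Fintype.card F = p) {H : Subgroup (PSL2 F)} (hH : HasIp k p H)
    (htr : MulAction.IsPretransitive (lift H) (P1 F)) (ι : F →+* k) {i j : ℕ} (hi : 1 ≤ i) (hj : 1 ≤ j)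
    (hij : i + j = p - 1) (Φ : (Fin 2 → F) → k) (hinv : ∀ h ∈ lift H, ∀ v, Φ (h • v) = Φ v)
    (hhom : ∀ (c : F) v, Φ (c • v) = ι c ^ i * Φ v) (hne : Φ ![1, 0] ≠ 0) : False := by
  classical
  have hpp : p.Prime := Fact.out
  have hp2 := hpp.two_le
  let g : (Fin 2 → F) → k := fun v => ∑ u : Fin 2 → F, Φ u * ι (u 0 * v 1 - u 1 * v 0) ^ j
  have ginv : ∀ h ∈ lift H, ∀ v, g (h • v) = g v := by
    intro h hh v
    symm
    refine Fintype.sum_equiv (MulAction.toPerm h) _ _ ?_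
    intro u
    change _ = Φ (h • u) * ι ((h • u) 0 * (h • v) 1 - (h • u) 1 * (h • v) 0) ^ j
    rw [det_inv, hinv h hh]
  have ghom : ∀ (c : F) v, g (c • v) = ι c ^ j * g v := by
    intro c v
    simp only [g]
    rw [Finset.mul_sum]
    apply Finset.sum_congr rfl
    intro u _
    have : u 0 * (c • v) 1 - u 1 * (c • v) 0 = c * (u 0 * v 1 - u 1 * v 0) := by
      simp only [Pi.smul_apply, smul_eq_mul]; ring
    rw [this, map_mul, mul_pow]; ring
  by_cases hg : ∃ v, g v ≠ 0
  · have hb := base_ne htr ι (by omega) g ginv ghom hg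
    refine claimA hH ι hj (by omega) g ginv hb ?_ ?_
    · intro v
      simp only [g]
      simp only [Finset.mul_sum]
      rw [Finset.sum_comm, Finset.sum_mul, ← Finset.sum_neg_distrib]
      apply Finset.sum_congr rfl
      intro u _
      have h1 := sum_extract ι (n := j) (b := 0) (by omega) (Nat.zero_le _) (ι (u 0 * v 1 - u 1 * v 0)) (ι (-(u 1 * v 1)))
      rw [Nat.sub_zero, Nat.choose_zero_right, Nat.cast_one, pow_zero, mul_one, one_mul] at h1
      have h2 : ∀ t : F, ι t ^ (Fintype.card F - 1 - j) *
          (Φ u * ι (u 0 * (U t • v) 1 - u 1 * (U t • v) 0) ^ j) =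
          Φ u * (ι t ^ (Fintype.card F - 1 - j) *
            (ι (u 0 * v 1 - u 1 * v 0) + ι t * ι (-(u 1 * v 1))) ^ j) := by
        intro t
        rw [smul_v0, smul_v1, U00, U01, U10, U11, ← map_mul, ← map_add]
        rw [show u 0 * (0 * v 0 + 1 * v 1) - u 1 * (1 * v 0 + t * v 1) =
          u 0 * v 1 - u 1 * v 0 + t * -(u 1 * v 1) by ring]
        ring
      rw [Finset.sum_congr rfl (fun t _ => h2 t), ← Finset.mul_sum, h1]
      rw [e1_def.1, e1_def.2, show u 0 * 0 - u 1 * 1 = - u 1 by ring,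
        show -(u 1 * v 1) = (-u 1) * v 1 by ring, map_mul, mul_pow]
      ring
    · intro w hw
      simp only [g, Finset.mul_sum]
      rw [Finset.sum_comm]
      apply Finset.sum_eq_zero
      intro u _
      have h1 := hw (-u 1) (u 0)
      have h2 : ∀ v : Fin 2 → F, w v * (Φ u * ι (u 0 * v 1 - u 1 * v 0) ^ j) =
          Φ u * (w v * ι (-u 1 * v 0 + u 0 * v 1) ^ j) := by
        intro v
        rw [show u 0 * v 1 - u 1 * v 0 = -u 1 * v 0 + u 0 * v 1 by ring]; ring
      simp only [h2]
      rw [← Finset.mul_sum, h1, mul_zero]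
  · push Not at hg
    have eq0 : ∀ v : Fin 2 → F, Φ ![1, 0] * ι (v 1) ^ j + ∑ s : F, Φ ![s, 1] * ι (s * v 1 - v 0) ^ j = 0 := by
      intro v
      have h1 := sum_deg0 ι (fun u => Φ u * ι (u 0 * v 1 - u 1 * v 0) ^ j)
        (by simp [zero_pow (by omega : j ≠ 0)]) (by
          intro c u hc
          have : (c • u) 0 * v 1 - (c • u) 1 * v 0 = c * (u 0 * v 1 - u 1 * v 0) := by
            simp only [Pi.smul_apply, smul_eq_mul]; ring
          simp only [this]
          rw [hhom, map_mul, mul_pow]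
          have h2 : ι c ^ i * ι c ^ j = 1 := by
            rw [← pow_add, hij, ← map_pow, ← hcp, FiniteField.pow_card_sub_one_eq_one c hc, map_one]
          linear_combination (Φ u * ι (u 0 * v 1 - u 1 * v 0) ^ j) * h2)
      have h2 : ∑ u : Fin 2 → F, Φ u * ι (u 0 * v 1 - u 1 * v 0) ^ j = 0 := hg v
      rw [h2, eq_comm, neg_eq_zero] at h1
      rw [← h1]
      simp
    let M : ℕ → k := fun b => ∑ s : F, Φ ![s, 1] * ι s ^ b
    have hMx : ∀ b ≤ j, Φ ![1, 0] * ∑ x : F, ι x ^ (Fintype.card F - 1 - (j - b)) =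
        (j.choose b : k) * (-1) ^ (j - b) * M b := by
      intro b hb
      have h1 : ∑ x : F, ι x ^ (Fintype.card F - 1 - (j - b)) *
          (Φ ![1, 0] * 1 + ∑ s : F, Φ ![s, 1] * (ι s + ι x * (-1)) ^ j) = 0 := by
        apply Finset.sum_eq_zero
        intro x _
        have := eq0 ![x, 1]
        simp at this
        rw [show Φ ![1, 0] * 1 + ∑ s : F, Φ ![s, 1] * (ι s + ι x * (-1)) ^ j = 0 by
          rw [← this, mul_one]
          congr 1
          apply Finset.sum_congr rfl
          intro s _
          ring, mul_zero]
      simp only [mul_add, Finset.mul_sum] at h1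
      rw [Finset.sum_add_distrib, Finset.sum_comm (γ := F)] at h1
      have h2 : ∀ s : F, ∑ x : F, ι x ^ (Fintype.card F - 1 - (j - b)) *
          (Φ ![s, 1] * (ι s + ι x * (-1)) ^ j) = - ((j.choose b : k) * (-1) ^ (j - b)) * (Φ ![s, 1] * ι s ^ b) := by
        intro s
        have := sum_extract ι (n := j) (b := b) (by omega) hb (ι s) (-1)
        have e : ∀ x : F, ι x ^ (Fintype.card F - 1 - (j - b)) *
          (Φ ![s, 1] * (ι s + ι x * (-1)) ^ j) = Φ ![s, 1] * (ι x ^ (Fintype.card F - 1 - (j - b)) *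
          (ι s + ι x * (-1)) ^ j) := fun x => by ring
        simp only [e]
        rw [← Finset.mul_sum, this]
        ring
      rw [Finset.sum_congr rfl (fun s _ => h2 s), ← Finset.mul_sum, ← Finset.sum_mul] at h1
      linear_combination h1
    have hM0 : ∀ b < j, M b = 0 := by
      intro b hb
      have h1 := hMx b hb.le
      have h2 : ∑ x : F, ι x ^ (Fintype.card F - 1 - (j - b)) = 0 := by
        simp only [← map_pow]
        rw [← map_sum, sum_pow_F _ (by omega), if_neg, map_zero]
        intro hdvd
        have := Nat.le_of_dvd (by omega) hdvd
        omega
      rw [h2, mul_zero] at h1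
      have h3 := mul_ne_zero (choose_ne (k := k) hpp (by omega : j < p) hb.le)
        (pow_ne_zero (j - b) (neg_ne_zero.2 one_ne_zero : (-1 : k) ≠ 0))
      exact (mul_eq_zero.1 h1.symm).resolve_left h3
    have hMj : M j = - Φ ![1, 0] := by
      have h1 := hMx j le_rfl
      have h2 : ∑ x : F, ι x ^ (Fintype.card F - 1 - (j - j)) = -1 := by
        simp only [← map_pow]
        rw [← map_sum, sum_pow_F _ (by omega), if_pos (by simp), map_neg, map_one]
      rw [h2] at h1
      simp only [Nat.choose_self, Nat.cast_one, Nat.sub_self, pow_zero, one_mul] at h1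
      linear_combination -h1
    have hvform : ∀ v : Fin 2 → F, v 1 ≠ 0 → Φ v = ι (v 1) ^ i * Φ ![v 0 / v 1, 1] := by
      intro v hv
      rw [← hhom]
      congr 1
      ext l; fin_cases l
      · simp; field_simp
      · simp
    have hvform0 : ∀ v : Fin 2 → F, v 1 = 0 → Φ v = ι (v 0) ^ i * Φ ![1, 0] := by
      intro v hv
      rw [← hhom]
      congr 1
      ext l; fin_cases l
      · simp
      · simp [hv]
    have poly : ∀ v, Φ v = - ∑ m ∈ Finset.range (i + 1), M (p - 1 - m) * (ι (v 0) ^ m * ι (v 1) ^ (i - m)) := by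
      intro v
      by_cases hv : v 1 = 0
      · rw [hvform0 v hv, hv, map_zero, Finset.sum_eq_single i]
        · rw [show p - 1 - i = j by omega, hMj, Nat.sub_self, pow_zero]; ring
        · intro m hm hmi
          have := Finset.mem_range.1 hm
          rw [zero_pow (by omega : i - m ≠ 0)]; ring
        · intro h; exact absurd (Finset.mem_range.2 (by omega)) h
      · rw [hvform v hv]
        set u := v 0 / v 1 with hu
        have h0 : v 0 = u * v 1 := by rw [hu]; field_simp
        have h1 : Φ ![u, 1] = ∑ s : F, Φ ![s, 1] * (1 - (ι u - ι s) ^ (p - 1)) := by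
          rw [Fintype.sum_eq_single u]
          · rw [sub_self, zero_pow (by omega), sub_zero, mul_one]
          · intro s hs
            rw [← map_sub, ← map_pow, ← hcp, FiniteField.pow_card_sub_one_eq_one _ (sub_ne_zero.2 hs.symm),
              map_one, sub_self, mul_zero]
        have h2 : Φ ![u, 1] = M 0 - ∑ m ∈ Finset.range p, ι u ^ m * M (p - 1 - m) := by
          rw [h1]
          simp only [M, Finset.mul_sum]
          rw [Finset.sum_comm, ← Finset.sum_sub_distrib]
          apply Finset.sum_congr rfl
          intro s _
          rw [sub_pow_pm1, mul_sub, Finset.mul_sum, pow_zero]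
          congr 1
          apply Finset.sum_congr rfl
          intro m _
          ring
        have h3 : ∑ m ∈ Finset.range (i + 1), ι u ^ m * M (p - 1 - m) =
            ∑ m ∈ Finset.range p, ι u ^ m * M (p - 1 - m) := by
          apply Finset.sum_subset
          · intro m hm
            have := Finset.mem_range.1 hm
            exact Finset.mem_range.2 (by omega)
          · intro m hm hm'
            have h4 := Finset.mem_range.1 hm
            have h5 : ¬ m < i + 1 := fun h => hm' (Finset.mem_range.2 h)
            rw [hM0 _ (by omega), mul_zero]
        rw [h2, ← h3, hM0 0 (by omega), zero_sub, mul_neg, Finset.mul_sum]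
        congr 1
        apply Finset.sum_congr rfl
        intro m hm
        have h4 := Finset.mem_range.1 hm
        rw [h0, map_mul, mul_pow]
        have h5 : ι (v 1) ^ i = ι (v 1) ^ m * ι (v 1) ^ (i - m) := by
          rw [← pow_add]; congr 1; omega
        rw [h5]; ring
    refine claimA hH ι hi (by omega) Φ hinv hne ?_ ?_
    · intro v
      have hU0 : ∀ t : F, (U t • v) 0 = v 0 + t * v 1 := by
        intro t; rw [smul_v0, U00, U01]; ring
      have hU1 : ∀ t : F, (U t • v) 1 = v 1 := by
        intro t; rw [smul_v1, U10, U11]; ring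
      have hexp : Fintype.card F - 1 - i = j := by omega
      rw [hexp]
      by_cases hv : v 1 = 0
      · have : ∀ t : F, Φ (U t • v) = Φ v := by
          intro t
          rw [hvform0 _ ((hU1 t).trans hv), hvform0 v hv, hU0, hv, mul_zero, add_zero]
        simp only [this]
        rw [← Finset.sum_mul, hv, map_zero, zero_pow (by omega), mul_zero, neg_zero]
        simp only [← map_pow]
        rw [← map_sum, sum_pow_F _ (by omega), if_neg, map_zero, zero_mul]
        intro hdvd
        have := Nat.le_of_dvd (by omega) hdvd
        omega
      · have h1 : ∀ t : F, Φ (U t • v) = ι (v 1) ^ i * Φ ![t + v 0 / v 1, 1] := by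
          intro t
          rw [hvform _ (by rw [hU1]; exact hv), hU0, hU1]
          congr 3
          field_simp
          ring_nf
        simp only [h1]
        set u := v 0 / v 1 with hu
        have h2 := eq0 ![u, 1]
        simp at h2
        have h3 : ∑ t : F, ι t ^ j * (ι (v 1) ^ i * Φ ![t + u, 1]) =
            ∑ s : F, ι (v 1) ^ i * (Φ ![s, 1] * (ι s - ι u) ^ j) := by
          refine Fintype.sum_equiv (Equiv.addRight u) _ _ ?_
          intro t
          simp only [Equiv.coe_addRight, map_add, add_sub_cancel_right]
          ring
        rw [h3, ← Finset.mul_sum]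
        linear_combination (ι (v 1) ^ i) * h2
    · intro w hw
      have h1 : ∀ m ≤ i, ∑ v, w v * (ι (v 0) ^ m * ι (v 1) ^ (i - m)) = 0 := by
        intro m hm
        have h2 : ∑ d : F, ι d ^ (Fintype.card F - 1 - (i - m)) * ∑ v : Fin 2 → F, w v * ι (1 * v 0 + d * v 1) ^ i = 0 := by
          simp only [hw, mul_zero, Finset.sum_const_zero]
        simp only [Finset.mul_sum] at h2
        rw [Finset.sum_comm] at h2
        have h3 : ∀ v : Fin 2 → F, ∑ d : F, ι d ^ (Fintype.card F - 1 - (i - m)) * (w v * ι (1 * v 0 + d * v 1) ^ i) =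
            (-(i.choose m : k)) * (w v * (ι (v 0) ^ m * ι (v 1) ^ (i - m))) := by
          intro v
          have := sum_extract ι (n := i) (b := m) (by omega) hm (ι (v 0)) (ι (v 1))
          have e : ∀ d : F, ι d ^ (Fintype.card F - 1 - (i - m)) * (w v * ι (1 * v 0 + d * v 1) ^ i) =
            w v * (ι d ^ (Fintype.card F - 1 - (i - m)) * (ι (v 0) + ι d * ι (v 1)) ^ i) := by
            intro d
            rw [one_mul, map_add, map_mul]; ring
          simp only [e]
          rw [← Finset.mul_sum, this]; ring
        rw [Finset.sum_congr rfl (fun v _ => h3 v), ← Finset.mul_sum] at h2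
        exact (mul_eq_zero.1 h2).resolve_left (neg_ne_zero.2 (choose_ne hpp (by omega) hm))
      have h2 : ∀ v, w v * Φ v = ∑ m ∈ Finset.range (i + 1),
          (- M (p - 1 - m)) * (w v * (ι (v 0) ^ m * ι (v 1) ^ (i - m))) := by
        intro v
        rw [poly v, mul_neg, Finset.mul_sum, ← Finset.sum_neg_distrib]
        apply Finset.sum_congr rfl
        intro m _
        ring
      simp only [h2]
      rw [Finset.sum_comm]
      apply Finset.sum_eq_zero
      intro m hm
      have := Finset.mem_range.1 hm
      rw [← Finset.mul_sum, h1 m (by omega), mul_zero]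

end PrimeField2

end Ip
namespace Ip

section PrimeField3
variable {F}

lemma pow_upper {s : SL F} (h : s 1 0 = 0) (n : ℕ) :
    ((s ^ n : SL F) 1 0 = 0) ∧ ((s ^ n : SL F) 0 0 = s 0 0 ^ n) := by
  induction n with
  | zero => simp
  | succ n ih =>
    rw [pow_succ, mul10, mul00, ih.1, ih.2, h]
    constructor <;> ring

theorem prime_t [Fintype F] {k : Type} [Field k] {p : ℕ} [Fact p.Prime] [CharP k p]
    (hcp : Fintype.card F = p) {H : Subgroup (PSL2 F)} (hH : HasIp k p H) (hd : dd F = 2)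
    (htr : MulAction.IsPretransitive (lift H) (P1 F)) (ι : F →+* k) {t : ℕ} (ht0 : 0 < t)
    (ht : 2 * t ∣ Fintype.card F - 1) (hc : Nat.card H = (Fintype.card F + 1) * t) :
    2 * t = Fintype.card F - 1 := by
  classical
  have hpp : p.Prime := Fact.out
  have hp2 := hpp.two_le
  by_contra hcon
  have hlt : 2 * t < Fintype.card F - 1 :=
    lt_of_le_of_ne (Nat.le_of_dvd (by omega) ht) hcon
  letI : Fintype (lift H) := Fintype.ofFinite _
  have hst := stab_card_mul htr (pt none : P1 F)
  rw [card_lift, hd, hc] at hst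
  have hst' : Nat.card (MulAction.stabilizer (lift H) (pt none : P1 F)) = 2 * t := by
    apply Nat.eq_of_mul_eq_mul_left (by omega : 0 < Fintype.card F + 1)
    rw [hst]; ring
  let e : (Fin 2 → F) → k := fun v => if v 1 = 0 then ι (v 0) ^ (2 * t) else 0
  let Φ : (Fin 2 → F) → k := fun v => ∑ h : lift H, e (h.1 • v)
  have hinv : ∀ h ∈ lift H, ∀ v, Φ (h • v) = Φ v := by
    intro h hh v
    refine Fintype.sum_equiv (Equiv.mulRight (⟨h, hh⟩ : lift H)) _ _ ?_
    intro x
    change e (x.1 • h • v) = e ((x.1 * h) • v)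
    rw [mul_smul]
  have ehom : ∀ (c : F) v, e (c • v) = ι c ^ (2 * t) * e v := by
    intro c v
    simp only [e, Pi.smul_apply, smul_eq_mul]
    by_cases hc : c = 0
    · subst hc
      simp [zero_pow (by omega : 2 * t ≠ 0)]
    · by_cases hv : v 1 = 0
      · simp [hv, mul_pow]
      · simp [hv, hc]
  have hhom : ∀ (c : F) v, Φ (c • v) = ι c ^ (2 * t) * Φ v := by
    intro c v
    simp only [Φ]
    rw [Finset.mul_sum]
    apply Finset.sum_congr rfl
    intro h _
    rw [← ehom]
    congr 1
    ext l; fin_cases l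
    · change (h.1 • (c • v)) 0 = c * (h.1 • v) 0
      rw [smul_v0, smul_v0]
      simp only [Pi.smul_apply, smul_eq_mul]; ring
    · change (h.1 • (c • v)) 1 = c * (h.1 • v) 1
      rw [smul_v1, smul_v1]
      simp only [Pi.smul_apply, smul_eq_mul]; ring
  have hval : ∀ h : lift H, e (h.1 • ![1, 0]) =
      if h ∈ MulAction.stabilizer (lift H) (pt none : P1 F) then 1 else 0 := by
    intro h
    have hmem : h ∈ MulAction.stabilizer (lift H) (pt none : P1 F) ↔ h.1 1 0 = 0 := by
      rw [← smul_pt_none]; rfl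
    simp only [e]
    rw [smul_v0, smul_v1]
    simp only [e1_def.1, e1_def.2, mul_one, mul_zero, add_zero]
    by_cases hh : h.1 1 0 = 0
    · rw [if_pos hh, if_pos (hmem.2 hh), ← map_pow]
      have h1 : (⟨h, hmem.2 hh⟩ : MulAction.stabilizer (lift H) (pt none : P1 F)) ^ (2 * t) = 1 := by
        rw [← hst']; exact pow_card_eq_one'
      have h2 : (h.1 ^ (2 * t) : SL F) = 1 := congrArg (fun x => x.1.1) h1
      have h3 := (pow_upper hh (2 * t)).2
      rw [h2] at h3
      rw [← h3]
      simp
    · rw [if_neg hh, if_neg (fun h => hh (hmem.1 h))]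
  have hne : Φ ![1, 0] ≠ 0 := by
    simp only [Φ, hval]
    rw [Finset.sum_boole]
    have : (Finset.univ.filter (fun h => h ∈ MulAction.stabilizer (lift H) (pt none : P1 F))).card = 2 * t := by
      rw [← hst', Nat.card_eq_fintype_card, Fintype.card_subtype]
    rw [this]
    intro h
    have := Nat.le_of_dvd (by omega) ((CharP.cast_eq_zero_iff k p _).1 h)
    omega
  exact no_small hcp hH htr ι (i := 2 * t) (j := Fintype.card F - 1 - 2 * t) (by omega) (by omega)
    (by omega) Φ hinv hhom hne

/-- summary in defining characteristic -/
theorem fwd_p [Fintype F] {k : Type} [Field k] [IsAlgClosed k] {p : ℕ} [Fact p.Prime] [CharP F p]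
    [CharP k p] (hodd : Odd p) (hq7 : 7 ≤ Fintype.card F) {H : Subgroup (PSL2 F)} (hH : HasIp k p H) :
    p = Fintype.card F ∧ dd F = 2 ∧ Nat.card (lift H ⊓ Ug F : Subgroup (SL F)) = 1 ∧
    MulAction.IsPretransitive (lift H) (P1 F) ∧
    ∃ t : ℕ, Nat.card H = (Fintype.card F + 1) * t ∧
    ∃ (ι : Type) (z : ι → Np F) (e : ι → ℕ) (i j : ι), i ≠ j ∧ (∀ l, l = i ∨ l = j) ∧
      (∀ i, Nat.card (Kz (lift H) (z i)) = 2 * e i ∧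
          e i * {y | ∃ s ∈ lift H, s • z i = y}.ncard = Nat.card H) ∧
        (∀ y : Np F, (∃ s ∈ lift H, s ∉ Subgroup.center (SL F) ∧ s • y = y) →
          ∃ i, ∃ s ∈ lift H, s • z i = y) ∧
        (∀ i j, (∃ s ∈ lift H, s • z i = z j) → i = j) ∧
        ((Fintype.card F = 7 ∧ t = 3 ∧ e i = 2 ∧ e j = 4) ∨
          (Fintype.card F = 11 ∧ t = 5 ∧ e i = 2 ∧ e j = 3)) := by
  have hpp : p.Prime := Fact.out
  have hp2 := hpp.two_le
  obtain ⟨hd, hv, htr, t, ht0, ht, hc, ι, hι, z, e, o, h1, h2, h3, h4⟩ := klein_p hodd hH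
  obtain ⟨⟨f, hf0⟩, -, hf⟩ := FiniteField.card F p
  simp only [PNat.mk_coe] at hf
  obtain ⟨emb⟩ := exists_emb F k p
  have hdv : ∀ i, 2 * e i ∣ Fintype.card F + 1 ∧ 2 ≤ e i ∧ e i * o i = Nat.card H := by
    intro i
    obtain ⟨a, b, c, -⟩ := h1 i
    exact ⟨by rw [← a]; exact Kz_card_dvd _ _, b, c⟩
  have hp3 : 3 ≤ p := by obtain ⟨m, hm⟩ := hodd; omega
  have hf1 : f = 1 := by
    by_contra hcon
    have hf2 : 2 ≤ f := by omega
    have hnp : ¬ (Fintype.card F).Prime := by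
      rw [hf]; exact Nat.Prime.not_prime_pow hf2
    by_cases h9 : Fintype.card F = 9
    · rw [h9] at hdv hc ht h4
      exact arith_nine ht hc hdv (by rw [h4]; norm_num)
    · by_cases ht1 : t = 1
      · subst ht1
        rw [mul_one] at hc
        refine no_nonprime hodd ?_ hH hd hc
        have hge : p ^ 2 ≤ Fintype.card F := by rw [hf]; exact Nat.pow_le_pow_right (by omega) hf2
        have hne4 : p ≠ 4 := by rintro rfl; exact absurd hpp (by decide)
        rcases Nat.lt_or_ge p 4 with h | h
        · have hp3' : p = 3 := by omega
          rw [hp3'] at hf ⊢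
          have hf3 : 3 ≤ f := by
            by_contra hcc
            have : f = 2 := by omega
            rw [this] at hf; norm_num at hf; exact h9 hf
          have : 3 ^ 3 ≤ Fintype.card F := by rw [hf]; exact Nat.pow_le_pow_right (by omega) hf3
          omega
        · have : 5 * p ≤ p ^ 2 := by rw [sq]; exact Nat.mul_le_mul_right _ (by omega)
          omega
      · obtain ⟨i, j, -, -, hcases⟩ := arith_klein hq7 (by omega) hc hdv h4
        rcases hcases with h | h | h | h | h <;> (apply hnp; rw [h.1]; norm_num)
  rw [hf1, pow_one] at hf
  have h2t := prime_t hf hH hd htr emb ht0 ht hc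
  obtain ⟨i, j, hij, hall, hcases⟩ := arith_klein hq7 (by omega) hc hdv h4
  refine ⟨hf.symm, hd, hv, htr, t, hc, ι, z, e, i, j, hij, hall, ?_, h2, h3, ?_⟩
  · intro i
    obtain ⟨a, b, c, d⟩ := h1 i
    exact ⟨a, by rw [d, c]⟩
  · rcases hcases with h | h | h | h | h
    · exact Or.inl h
    · omega
    · exact Or.inr h
    · omega
    · omega

end PrimeField3

end Ip

namespace Ip

section Abstract

lemma factorization_of_eq {p : ℕ} (hp : p.Prime) {n e m : ℕ} (h : n = p ^ e * m) (hm : ¬ p ∣ m) : n.factorization p = e := by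
  have hm0 : m ≠ 0 := by rintro rfl; exact hm (dvd_zero _)
  rw [h, Nat.factorization_mul (pow_ne_zero _ hp.ne_zero) hm0, Finsupp.add_apply,
    Nat.factorization_eq_zero_of_not_dvd hm, hp.factorization_pow]
  simp

lemma comm_prime {G : Type*} [Group G] (hE : ∀ g : G, ∃ r n : ℕ, r.Prime ∧ g ^ (r ^ n) = 1)
    {a b : G} (hab : Commute a b) {p r : ℕ} (hp : p.Prime) (hr : r.Prime) (ha : orderOf a = p)
    (hb : orderOf b = r) : p = r := by
  by_contra hne
  have hc : (orderOf a).Coprime (orderOf b) := by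
    rw [ha, hb]; exact (Nat.coprime_primes hp hr).2 hne
  have h1 := hab.orderOf_mul_eq_mul_orderOf_of_coprime hc
  obtain ⟨s, n, hs, h2⟩ := hE (a * b)
  have h3 := orderOf_dvd_of_pow_eq_one h2
  rw [h1, ha, hb] at h3
  have h4 : p = s := (Nat.prime_dvd_prime_iff_eq hp hs).1
    (hp.dvd_of_dvd_pow ((Dvd.intro _ rfl).trans h3))
  have h5 : r = s := (Nat.prime_dvd_prime_iff_eq hr hs).1
    (hr.dvd_of_dvd_pow ((Dvd.intro_left _ rfl).trans h3))
  exact hne (h4.trans h5.symm)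

lemma exists_pow_prime {G : Type*} [Group G] [Finite G] {n : G} (hn : n ≠ 1) :
    ∃ m r : ℕ, r.Prime ∧ r ∣ orderOf n ∧ orderOf (n ^ m) = r := by
  have h1 : orderOf n ≠ 1 := fun h => hn (orderOf_eq_one_iff.1 h)
  refine ⟨orderOf n / (orderOf n).minFac, _, Nat.minFac_prime h1, Nat.minFac_dvd _, ?_⟩
  exact orderOf_pow_orderOf_div (orderOf_pos n).ne' (Nat.minFac_dvd _)

lemma faithful {G : Type*} [Group G] [Finite G]
    (hE : ∀ g : G, ∃ r n : ℕ, r.Prime ∧ g ^ (r ^ n) = 1) {p : ℕ} [hp : Fact p.Prime]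
    (hpG : p ∣ Nat.card G)
    (hB : ∀ g : G, orderOf g = p → ∃ P : Sylow p G, g ∉ P) :
    Function.Injective (MulAction.toPermHom G (Sylow p G)) := by
  have hA : ∀ n ∈ (MulAction.toPermHom G (Sylow p G)).ker, orderOf n ≠ p := by
    intro n hn ho
    obtain ⟨P, hP⟩ := hB n ho
    have h1 : n • P = P := by
      have := congrArg (fun f => f P) ((MonoidHom.mem_ker).1 hn)
      simpa using this
    rw [Sylow.smul_eq_iff_mem_normalizer] at h1
    have hz : IsPGroup p (Subgroup.zpowers n) :=
      IsPGroup.of_card (n := 1) (by rw [Nat.card_zpowers, ho, pow_one])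
    have h2 := hz.inf_normalizer_sylow P
    have h3 : n ∈ Subgroup.zpowers n ⊓ (P : Subgroup G) := by
      rw [← h2]
      exact ⟨Subgroup.mem_zpowers n, h1⟩
    exact hP h3.2
  rw [injective_iff_map_eq_one]
  intro n hn
  by_contra hne
  obtain ⟨m, r, hr, -, ho⟩ := exists_pow_prime hne
  have hnk : n ^ m ∈ (MulAction.toPermHom G (Sylow p G)).ker := Subgroup.pow_mem _ hn _
  obtain ⟨u, hu⟩ := exists_prime_orderOf_dvd_card' p hpG
  have hz : IsPGroup p (Subgroup.zpowers u) :=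
    IsPGroup.of_card (n := 1) (by rw [Nat.card_zpowers, hu, pow_one])
  obtain ⟨P, hP⟩ := hz.exists_le_sylow
  have huP : u ∈ P := hP (Subgroup.mem_zpowers u)
  set x := n ^ m with hx
  have hcN : x * u * x⁻¹ * u⁻¹ ∈ (MulAction.toPermHom G (Sylow p G)).ker := by
    have := Subgroup.mul_mem _ hnk ((MulAction.toPermHom G (Sylow p G)).normal_ker.conj_mem _
      (Subgroup.inv_mem _ hnk) u)
    simpa [mul_assoc] using this
  have hcP : x * u * x⁻¹ * u⁻¹ ∈ P := by
    have h1 : x • P = P := by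
      have := congrArg (fun f => f P) ((MonoidHom.mem_ker).1 hnk)
      simpa using this
    rw [Sylow.smul_eq_iff_mem_normalizer] at h1
    refine P.mul_mem ?_ (P.inv_mem huP)
    exact (Subgroup.mem_normalizer_iff.1 h1 u).1 huP
  have hc1 : x * u * x⁻¹ * u⁻¹ = 1 := by
    by_contra hcn
    obtain ⟨m', r', hr', hd, ho'⟩ := exists_pow_prime hcn
    obtain ⟨j, hj⟩ := P.2 ⟨_, hcP⟩
    have hj' := congrArg Subtype.val hj
    simp only [SubmonoidClass.mk_pow, OneMemClass.coe_one] at hj'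
    have h3 := orderOf_dvd_of_pow_eq_one hj'
    have h4 : r' = p := (Nat.prime_dvd_prime_iff_eq hr' hp.out).1 (hr'.dvd_of_dvd_pow (hd.trans h3))
    exact hA _ (Subgroup.pow_mem _ hcN m') (ho'.trans h4)
  have hcomm : Commute x u := by
    have h5 := mul_inv_eq_one.1 hc1
    have h6 := mul_inv_eq_iff_eq_mul.1 h5
    exact h6
  have := comm_prime hE hcomm hr hp.out ho hu
  exact hA _ hnk (ho.trans this)

lemma sylow_order_p {G : Type*} [Group G] [Finite G] {p : ℕ} [hp : Fact p.Prime]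
    (P : Sylow p G) {g : G} (hg : g ∈ P) (hg1 : g ≠ 1) {n : ℕ} (hc : Nat.card P = p) : 
    (P : Subgroup G) = Subgroup.zpowers g := by
  have h1 : Nat.card (Subgroup.zpowers g) = p := by
    have h2 : Nat.card (Subgroup.zpowers g) ∣ Nat.card P :=
      Subgroup.card_dvd_of_le ((Subgroup.zpowers_le (H := (P : Subgroup G))).2 hg)
    rw [hc] at h2
    rcases (Nat.dvd_prime hp.out).1 h2 with h3 | h3
    · exact absurd (orderOf_eq_one_iff.1 (by rw [← Nat.card_zpowers, h3])) hg1
    · exact h3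
  exact (Subgroup.eq_of_le_of_card_ge ((Subgroup.zpowers_le (H := (P : Subgroup G))).2 hg)
    (by rw [h1]; exact hc.le)).symm

set_option maxHeartbeats 1000000 in
lemma iso_S4 {G : Type*} [Group G] [Finite G] (hc : Nat.card G = 24)
    (h : ∀ g : G, g ^ 3 = 1 ∨ g ^ 4 = 1) : Nonempty (G ≃* Equiv.Perm (Fin 4)) := by
  haveI : Fact (Nat.Prime 3) := ⟨Nat.prime_three⟩
  have hE : ∀ g : G, ∃ r n : ℕ, r.Prime ∧ g ^ (r ^ n) = 1 := by
    intro g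
    rcases h g with h | h
    · exact ⟨3, 1, Nat.prime_three, by simpa using h⟩
    · exact ⟨2, 2, Nat.prime_two, by simpa using h⟩
  have hP3 : ∀ P : Sylow 3 G, Nat.card P = 3 := by
    intro P
    rw [P.card_eq_multiplicity, hc]
    have : Nat.factorization 24 3 = 1 :=
      factorization_of_eq Nat.prime_three (m := 8) (by norm_num) (by norm_num)
    rw [this]; norm_num
  let P0 : Sylow 3 G := default
  have hidx : Nat.card (Sylow 3 G) ∣ 8 := by
    have h1 := P0.card_dvd_index
    have h2 := (P0 : Subgroup G).card_mul_index
    rw [hP3 P0, hc] at h2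
    have : (P0 : Subgroup G).index = 8 := by omega
    rwa [this] at h1
  have hmod := card_sylow_modEq_one 3 G
  have hn3 : Nat.card (Sylow 3 G) = 1 ∨ Nat.card (Sylow 3 G) = 4 := by
    have hle := Nat.le_of_dvd (by norm_num) hidx
    unfold Nat.ModEq at hmod
    generalize Nat.card (Sylow 3 G) = n at *
    interval_cases n <;> omega
  rcases hn3 with h1 | h4
  · exfalso
    have hN : (P0 : Subgroup G).Normal := by
      rw [← Subgroup.normalizer_eq_top_iff, ← Subgroup.index_eq_one]
      exact P0.card_eq_index_normalizer.symm.trans h1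
    let f : G →* MulAut (P0 : Subgroup G) := MulAut.conjNormal
    haveI : IsCyclic (P0 : Subgroup G) := isCyclic_of_prime_card (p := 3) (hP3 P0)
    have hA : Nat.card (MulAut (P0 : Subgroup G)) = 2 := by
      rw [IsCyclic.card_mulAut, hP3 P0]; decide
    have hk : Nat.card f.ker * Nat.card f.range = 24 := by
      rw [← hc, ← f.ker.card_mul_index, Subgroup.index_ker]
    have hr : Nat.card f.range ∣ 2 := by rw [← hA]; exact Subgroup.card_subgroup_dvd_card _
    have h2k : 2 ∣ Nat.card f.ker := by
      rcases (Nat.dvd_prime Nat.prime_two).1 hr with h | h <;> rw [h] at hk <;> omega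
    haveI : Fact (Nat.Prime 2) := ⟨Nat.prime_two⟩
    obtain ⟨a, ha⟩ := exists_prime_orderOf_dvd_card' 2 h2k
    obtain ⟨u, hu⟩ := exists_prime_orderOf_dvd_card' (G := (P0 : Subgroup G)) 3 (by rw [hP3 P0])
    have hcomm : Commute a.1 u.1 := by
      have h5 := congrArg (fun φ : MulAut (P0 : Subgroup G) => (φ u).1) (MonoidHom.mem_ker.1 a.2)
      have h6 : a.1 * u.1 * (a.1)⁻¹ = u.1 := h5
      exact mul_inv_eq_iff_eq_mul.1 h6
    have := comm_prime hE hcomm Nat.prime_two Nat.prime_three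
      ((Subgroup.orderOf_coe a).trans ha) ((Subgroup.orderOf_coe u).trans hu)
    omega
  · have hinj := faithful hE (p := 3) (by rw [hc]; norm_num) (by
      intro g hg
      by_contra hcon
      push Not at hcon
      have hg1 : g ≠ 1 := by rintro rfl; simp at hg
      have : Subsingleton (Sylow 3 G) := by
        constructor
        intro P Q
        apply Sylow.ext
        rw [sylow_order_p P (hcon P) hg1 (n := 0) (hP3 P), sylow_order_p Q (hcon Q) hg1 (n := 0) (hP3 Q)]
      have : Nat.card (Sylow 3 G) ≤ 1 := Finite.card_le_one_iff_subsingleton.2 this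
      omega)
    have e4 : Nonempty (Sylow 3 G ≃ Fin 4) := by
      have := Finite.equivFin (Sylow 3 G)
      rw [h4] at this
      exact ⟨this⟩
    obtain ⟨e4⟩ := e4
    have hcp : Nat.card (Equiv.Perm (Sylow 3 G)) = 24 := by
      rw [Nat.card_perm, h4]; rfl
    have hbij : Function.Bijective (MulAction.toPermHom G (Sylow 3 G)) :=
      (Nat.bijective_iff_injective_and_card _).2 ⟨hinj, by rw [hc, hcp]⟩
    exact ⟨(MulEquiv.ofBijective _ hbij).trans (Equiv.permCongrHom e4)⟩

end Abstract

end Ip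

namespace Ip

section Abstract2

lemma free_conj {G : Type*} [Group G] [Finite G] (A : Subgroup G) {r : ℕ}
    (hf : ∀ a ∈ A, a ≠ 1 → ∀ x : G, orderOf x = r → ¬ Commute a x) :
    Nat.card A ∣ Nat.card {x : G // orderOf x = r} := by
  classical
  letI : Fintype {x : G // orderOf x = r} := Fintype.ofFinite _
  letI : MulAction A {x : G // orderOf x = r} :=
    { smul := fun a x => ⟨a.1 * x.1 * a.1⁻¹, by
        have := (MulAut.conj a.1).orderOf_eq x.1
        rw [x.2] at this
        exact this⟩
      one_smul := fun x => Subtype.ext (by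
        change (1 : G) * x.1 * (1 : G)⁻¹ = x.1
        simp)
      mul_smul := fun a b x => Subtype.ext (by
        change (a.1 * b.1) * x.1 * (a.1 * b.1)⁻¹ = a.1 * (b.1 * x.1 * b.1⁻¹) * a.1⁻¹
        group) }
  have h := burnside_const (A := A) (X := {x : G // orderOf x = r}) (c := 0) (by
    intro a ha
    rw [Nat.card_eq_zero]
    left
    constructor
    rintro ⟨x, hx⟩
    have hx' : a.1 * x.1 * a.1⁻¹ = x.1 := congrArg Subtype.val hx
    exact hf a.1 a.2 (fun h => ha (Subtype.ext h)) x.1 x.2 (mul_inv_eq_iff_eq_mul.1 hx'))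
  rw [mul_zero, add_zero, ← Nat.card_eq_fintype_card] at h
  exact Dvd.intro_left _ h

lemma sylow_free {G : Type*} [Group G] [Finite G]
    (hE : ∀ g : G, ∃ r n : ℕ, r.Prime ∧ g ^ (r ^ n) = 1) {p : ℕ} [hp : Fact p.Prime]
    (P : Sylow p G) {r : ℕ} (hr : r.Prime) (hpr : p ≠ r) :
    Nat.card P ∣ Nat.card {x : G // orderOf x = r} := by
  apply free_conj
  intro a ha ha1 x hx hcomm
  obtain ⟨m', r', hr', hd, ho'⟩ := exists_pow_prime ha1
  obtain ⟨j, hj⟩ := P.2 ⟨_, ha⟩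
  have hj' := congrArg Subtype.val hj
  simp only [SubmonoidClass.mk_pow, OneMemClass.coe_one] at hj'
  have h3 := orderOf_dvd_of_pow_eq_one hj'
  have h4 : r' = p := (Nat.prime_dvd_prime_iff_eq hr' hp.out).1 (hr'.dvd_of_dvd_pow (hd.trans h3))
  exact hpr (comm_prime hE (hcomm.pow_left m') hp.out hr (ho'.trans h4) hx)

set_option maxHeartbeats 1000000 in
lemma iso_A5 {G : Type*} [Group G] [Finite G] (hc : Nat.card G = 60)
    (h : ∀ g : G, g ^ 2 = 1 ∨ g ^ 3 = 1 ∨ g ^ 5 = 1) :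
    Nonempty (G ≃* alternatingGroup (Fin 5)) := by
  classical
  letI := Fintype.ofFinite G
  haveI f2 : Fact (Nat.Prime 2) := ⟨Nat.prime_two⟩
  haveI f3 : Fact (Nat.Prime 3) := ⟨Nat.prime_three⟩
  haveI f5 : Fact (Nat.Prime 5) := ⟨Nat.prime_five⟩
  have hE : ∀ g : G, ∃ r n : ℕ, r.Prime ∧ g ^ (r ^ n) = 1 := by
    intro g
    rcases h g with h | h | h
    · exact ⟨2, 1, Nat.prime_two, by simpa using h⟩
    · exact ⟨3, 1, Nat.prime_three, by simpa using h⟩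
    · exact ⟨5, 1, Nat.prime_five, by simpa using h⟩
  have hord : ∀ g : G, g ≠ 1 → orderOf g = 2 ∨ orderOf g = 3 ∨ orderOf g = 5 := by
    intro g hg
    rcases h g with h | h | h
    · exact Or.inl (orderOf_eq_prime h hg)
    · exact Or.inr (Or.inl (orderOf_eq_prime h hg))
    · exact Or.inr (Or.inr (orderOf_eq_prime h hg))
  have hP2 : ∀ P : Sylow 2 G, Nat.card P = 4 := by
    intro P
    rw [P.card_eq_multiplicity, hc]
    have : Nat.factorization 60 2 = 2 :=
      factorization_of_eq Nat.prime_two (m := 15) (by norm_num) (by norm_num)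
    rw [this]; norm_num
  have hP3 : ∀ P : Sylow 3 G, Nat.card P = 3 := by
    intro P
    rw [P.card_eq_multiplicity, hc]
    have : Nat.factorization 60 3 = 1 :=
      factorization_of_eq Nat.prime_three (m := 20) (by norm_num) (by norm_num)
    rw [this]; norm_num
  have hP5 : ∀ P : Sylow 5 G, Nat.card P = 5 := by
    intro P
    rw [P.card_eq_multiplicity, hc]
    have : Nat.factorization 60 5 = 1 :=
      factorization_of_eq Nat.prime_five (m := 12) (by norm_num) (by norm_num)
    rw [this]; norm_num
  have hpos : ∀ r : ℕ, [Fact r.Prime] → r ∣ 60 → 0 < Nat.card {x : G // orderOf x = r} := by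
    intro r _ hr
    obtain ⟨u, hu⟩ := exists_prime_orderOf_dvd_card' (G := G) r (by rw [hc]; exact hr)
    haveI : Nonempty {x : G // orderOf x = r} := ⟨⟨u, hu⟩⟩
    exact Nat.card_pos
  have hX2 : Nat.card {x : G // orderOf x = 2} = 15 := by
    have a3 := sylow_free hE (default : Sylow 3 G) Nat.prime_two (by norm_num)
    have a5 := sylow_free hE (default : Sylow 5 G) Nat.prime_two (by norm_num)
    have b2 := sylow_free hE (default : Sylow 2 G) Nat.prime_three (by norm_num)
    have b5 := sylow_free hE (default : Sylow 5 G) Nat.prime_three (by norm_num)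
    have c2 := sylow_free hE (default : Sylow 2 G) Nat.prime_five (by norm_num)
    have c3 := sylow_free hE (default : Sylow 3 G) Nat.prime_five (by norm_num)
    rw [hP3] at a3 c3
    rw [hP2] at b2 c2
    rw [hP5] at a5 b5
    have p2 := hpos 2 (by norm_num)
    have p3 := hpos 3 (by norm_num)
    have p5 := hpos 5 (by norm_num)
    have hsum : 60 = 1 + (Nat.card {x : G // orderOf x = 2} + (Nat.card {x : G // orderOf x = 3} +
        Nat.card {x : G // orderOf x = 5})) := by
      have h1 := Finset.card_eq_sum_card_fiberwise (f := (orderOf : G → ℕ))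
        (s := Finset.univ) (t := {1, 2, 3, 5}) (by
          intro g _
          by_cases hg : g = 1
          · simp [hg]
          · rcases hord g hg with h | h | h <;> simp [h])
      rw [Finset.sum_insert (by decide), Finset.sum_insert (by decide),
        Finset.sum_insert (by decide), Finset.sum_singleton, Finset.card_univ,
        ← Nat.card_eq_fintype_card, hc] at h1
      have h2 : ∀ r, ({x : G | orderOf x = r} : Finset G).card = Nat.card {x : G // orderOf x = r} := by
        intro r
        rw [Nat.card_eq_fintype_card, Fintype.card_subtype]
      have h3 : ({x : G | orderOf x = 1} : Finset G).card = 1 := by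
        rw [Finset.card_eq_one]
        refine ⟨1, ?_⟩
        ext x
        simp
      rw [h3, h2, h2, h2] at h1
      exact h1
    omega
  have hordP : ∀ P : Sylow 2 G, ∀ x ∈ P, x ≠ 1 → orderOf x = 2 := by
    intro P x hx hx1
    have h1 : orderOf x ∣ 4 := by
      rw [← hP2 P, ← Subgroup.orderOf_mk x hx]
      exact orderOf_dvd_natCard _
    rcases hord x hx1 with h | h | h
    · exact h
    · rw [h] at h1; omega
    · rw [h] at h1; omega
  have hcent : ∀ P : Sylow 2 G, ∀ x ∈ P, x ≠ 1 → (P : Subgroup G) = Subgroup.centralizer {x} := by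
    intro P x hx hx1
    have hC : IsPGroup 2 (Subgroup.centralizer {x} : Subgroup G) := by
      rintro ⟨g, hg⟩
      refine ⟨1, ?_⟩
      apply Subtype.ext
      change g ^ (2 ^ 1) = 1
      by_cases hg1 : g = 1
      · rw [hg1, one_pow]
      · have hcm : Commute g x := (Subgroup.mem_centralizer_singleton_iff.1 hg)
        have hpr : (orderOf g).Prime := by
          rcases hord g hg1 with h | h | h <;> rw [h] <;> norm_num
        have := comm_prime hE hcm hpr Nat.prime_two rfl (hordP P x hx hx1)
        rw [pow_one, ← this, pow_orderOf_eq_one]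
    have hle : (P : Subgroup G) ≤ Subgroup.centralizer {x} := by
      intro y hy
      rw [Subgroup.mem_centralizer_singleton_iff]
      have hs : ∀ z ∈ P, z * z = 1 := by
        intro z hz
        by_cases hz1 : z = 1
        · rw [hz1, one_mul]
        · rw [← pow_two, ← hordP P z hz hz1, pow_orderOf_eq_one]
      have e1 := hs x hx
      have e2 := hs y hy
      have e3 := hs _ (P.mul_mem hx hy)
      calc y * x = (x * x) * (y * x) * (y * y) := by rw [e1, e2]; group
        _ = x * ((x * y) * (x * y)) * y := by group
        _ = x * y := by rw [e3, mul_one]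
    exact (P.is_maximal' hC hle).symm
  have hn2 : Nat.card (Sylow 2 G) = 5 := by
    let φ : (Σ P : Sylow 2 G, {x : P // x ≠ 1}) → {x : G // orderOf x = 2} := fun y =>
      ⟨y.2.1.1, hordP y.1 _ y.2.1.2 (fun hh => y.2.2 (Subtype.ext hh))⟩
    have hφ : Function.Bijective φ := by
      constructor
      · rintro ⟨P, ⟨x, hx⟩, hx1⟩ ⟨Q, ⟨y, hy⟩, hy1⟩ hxy
        have hxy' : x = y := congrArg Subtype.val hxy
        subst hxy'
        have hx1' : x ≠ 1 := fun hh => hx1 (Subtype.ext hh)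
        have : P = Q := Sylow.ext ((hcent P x hx hx1').trans (hcent Q x hy hx1').symm)
        subst this
        rfl
      · rintro ⟨x, hx⟩
        have hz : IsPGroup 2 (Subgroup.zpowers x) :=
          IsPGroup.of_card (n := 1) (by rw [Nat.card_zpowers, hx, pow_one])
        obtain ⟨P, hP⟩ := hz.exists_le_sylow
        refine ⟨⟨P, ⟨x, hP (Subgroup.mem_zpowers x)⟩, ?_⟩, rfl⟩
        intro hh
        have : x = 1 := congrArg Subtype.val hh
        rw [this] at hx
        simp at hx
    have h1 := Nat.card_congr (Equiv.ofBijective φ hφ)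
    letI := Fintype.ofFinite (Sylow 2 G)
    rw [hX2, Nat.card_sigma] at h1
    have h2 : ∀ P : Sylow 2 G, Nat.card {x : P // x ≠ 1} = 3 := by
      intro P
      letI := Fintype.ofFinite P
      have := Set.card_ne_eq (1 : P)
      rw [← Nat.card_eq_fintype_card, ← Nat.card_eq_fintype_card] at this
      have h9 : Nat.card (P : Subgroup G) - 1 = 3 := by rw [hP2 P]
      exact this.trans h9
    rw [Finset.sum_congr rfl (fun P _ => h2 P), Finset.sum_const, Finset.card_univ,
      ← Nat.card_eq_fintype_card, smul_eq_mul] at h1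
    omega
  have hinj := faithful hE (p := 2) (by rw [hc]; norm_num) (by
    intro g hg
    by_contra hcon
    push Not at hcon
    have hg1 : g ≠ 1 := by rintro rfl; simp at hg
    have : Subsingleton (Sylow 2 G) := by
      constructor
      intro P Q
      apply Sylow.ext
      rw [hcent P g (hcon P) hg1, hcent Q g (hcon Q) hg1]
    have : Nat.card (Sylow 2 G) ≤ 1 := Finite.card_le_one_iff_subsingleton.2 this
    omega)
  have e5 : Nonempty (Sylow 2 G ≃ Fin 5) := by
    have := Finite.equivFin (Sylow 2 G)
    rw [hn2] at this
    exact ⟨this⟩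
  obtain ⟨e5⟩ := e5
  let ψ : G →* Equiv.Perm (Fin 5) :=
    (Equiv.permCongrHom e5).toMonoidHom.comp (MulAction.toPermHom G (Sylow 2 G))
  have hψ : Function.Injective ψ := (Equiv.permCongrHom e5).injective.comp hinj
  have hcr : Nat.card ψ.range = 60 := by
    rw [← hc]; exact (Nat.card_congr (MonoidHom.ofInjective hψ).toEquiv).symm
  have hidx : ψ.range.index = 2 := by
    have h1 := ψ.range.card_mul_index
    rw [hcr, Nat.card_perm, Nat.card_eq_fintype_card, Fintype.card_fin] at h1
    have : Nat.factorial 5 = 120 := rfl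
    omega
  have := Equiv.Perm.eq_alternatingGroup_of_index_eq_two hidx
  exact ⟨(MonoidHom.ofInjective hψ).trans (MulEquiv.subgroupCongr this)⟩

end Abstract2

end Ip

namespace Ip

section Identify

variable {F}

lemma pow_of_card [Fintype F] (hd : dd F = 2) {L : Subgroup (SL F)}
    (hL : Subgroup.center (SL F) ≤ L) {m : ℕ} (hm : Nat.card L = 2 * m) {s : SL F} (hs : s ∈ L) :
    pr F s ^ m = 1 := by
  have h1 := card_map_pr L hL
  rw [hd, hm] at h1
  have h2 : Nat.card (L.map (pr F)) = m := by omega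
  have h3 := pow_card_eq_one' (x := (⟨pr F s, s, hs, rfl⟩ : L.map (pr F)))
  rw [h2] at h3
  exact congrArg Subtype.val h3

lemma elem_orders [Fintype F] (hd : dd F = 2) {H : Subgroup (PSL2 F)}
    (htr : MulAction.IsPretransitive (lift H) (P1 F)) {t : ℕ}
    (ht : Nat.card H = (Fintype.card F + 1) * t) {ι : Type} {z : ι → Np F} {e : ι → ℕ}
    (h1 : ∀ i, Nat.card (Kz (lift H) (z i)) = 2 * e i)
    (h2 : ∀ y : Np F, (∃ s ∈ lift H, s ∉ Subgroup.center (SL F) ∧ s • y = y) →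
          ∃ i, ∃ s ∈ lift H, s • z i = y) (x : PSL2 F) (hx : x ∈ H) :
    x ^ t = 1 ∨ ∃ i, x ^ e i = 1 := by
  obtain ⟨s, rfl⟩ := pr_surj x
  have hs : s ∈ lift H := hx
  by_cases hsc : s ∈ Subgroup.center (SL F)
  · left
    rw [(pr_eq_one s).2 hsc, one_pow]
  by_cases hfix : ∃ y : P1 F, s • y = y
  · left
    obtain ⟨y, hy⟩ := hfix
    have h5 := stab_card_mul htr y
    rw [card_lift, hd, ht] at h5
    have h6 : Nat.card (MulAction.stabilizer (lift H) y) = 2 * t := by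
      apply Nat.eq_of_mul_eq_mul_left (Nat.succ_pos (Fintype.card F))
      rw [Nat.succ_eq_add_one, h5]; ring
    have h7 : Nat.card ((MulAction.stabilizer (lift H) y).map (lift H).subtype) = 2 * t := by
      rw [← h6]
      exact (Nat.card_congr ((MulAction.stabilizer (lift H) y).equivMapOfInjective _
        (lift H).subtype_injective).toEquiv).symm
    refine pow_of_card hd (L := (MulAction.stabilizer (lift H) y).map (lift H).subtype) ?_ h7 ?_
    · intro c hc
      exact ⟨⟨c, center_le_lift H hc⟩, center_smul_P1 hc y, rfl⟩
    · exact ⟨⟨s, hs⟩, hy, rfl⟩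
  · right
    push Not at hfix
    have h3 := two_poles hsc hfix
    have hne : {z : Np F | s • z = z}.Nonempty := by
      rw [Set.nonempty_iff_ne_empty]
      intro h
      rw [h, Set.ncard_empty] at h3
      omega
    obtain ⟨y, hy⟩ := hne
    have hy' : s • y = y := hy
    obtain ⟨i, g, hg, hgy⟩ := h2 y ⟨s, hs, hsc, hy'⟩
    refine ⟨i, ?_⟩
    have hm : g⁻¹ * s * g ∈ Kz (lift H) (z i) := by
      refine mem_Kz.2 ⟨(lift H).mul_mem ((lift H).mul_mem ((lift H).inv_mem hg) hs) hg, ?_⟩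
      rw [mul_smul, mul_smul, hgy, hy', ← hgy, inv_smul_smul]
    have h4 := pow_of_card hd (L := Kz (lift H) (z i)) (fun c hc =>
      mem_Kz.2 ⟨center_le_lift H hc, center_smul_np hc _⟩) (h1 i) hm
    rw [map_mul, map_mul, map_inv] at h4
    have h5 : (pr F g)⁻¹ * pr F s * pr F g = MulAut.conj (pr F g)⁻¹ (pr F s) := by
      rw [MulAut.conj_apply, inv_inv]
    rw [h5, ← map_pow] at h4
    exact (map_eq_one_iff _ (MulAut.conj (pr F g)⁻¹).injective).1 h4

lemma fwd_char {k : Type} [Field k] [IsAlgClosed k] [Fintype F] {p : ℕ} [Fact p.Prime] [CharP k p]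
    [CharP F p] (hodd : Odd p) (hq7 : 7 ≤ Fintype.card F) {H : Subgroup (PSL2 F)}
    (hH : HasIp k p H) :
    (Fintype.card F = 7 ∧ p = 7 ∧ Nonempty (↥H ≃* Equiv.Perm (Fin 4)) ∧ H.index = 7) ∨
      (Fintype.card F = 11 ∧ p = 11 ∧ Nonempty (↥H ≃* ↥(alternatingGroup (Fin 5))) ∧
        H.index = 11) := by
  obtain ⟨hpq, hd, -, htr, t, ht, ι, z, e, i, j, -, hall, h1, h2, -, hc⟩ := fwd_p hodd hq7 hH
  have hel := elem_orders hd htr ht (fun i => (h1 i).1) h2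
  have hidx := index_card H
  rw [hd, ht] at hidx
  rcases hc with ⟨hq, ht3, hi, hj⟩ | ⟨hq, ht5, hi, hj⟩
  · left
    rw [hq, ht3] at ht hidx
    refine ⟨hq, hpq.trans hq, iso_S4 ht ?_, by omega⟩
    rintro ⟨x, hx⟩
    rcases hel x hx with h | ⟨l, h⟩
    · left
      rw [ht3] at h
      exact Subtype.ext h
    · right
      apply Subtype.ext
      change x ^ 4 = 1
      rcases hall l with rfl | rfl
      · rw [hi] at h
        rw [show 4 = 2 * 2 from rfl, pow_mul, h, one_pow]
      · rwa [hj] at h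
  · right
    rw [hq, ht5] at ht hidx
    refine ⟨hq, hpq.trans hq, iso_A5 ht ?_, by omega⟩
    rintro ⟨x, hx⟩
    rcases hel x hx with h | ⟨l, h⟩
    · right; right
      rw [ht5] at h
      exact Subtype.ext h
    · rcases hall l with rfl | rfl
      · left
        rw [hi] at h
        exact Subtype.ext h
      · right; left
        rw [hj] at h
        exact Subtype.ext h

lemma bwd_dihedral {k : Type} [Field k] [Fintype F] {p : ℕ} [Fact p.Prime] [CharP k p]
    (hq7 : 7 ≤ Fintype.card F) (hf : ∃ f : ℕ, Fintype.card F = 2 ^ f)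
    (hp : p = Fintype.card F - 1) {H : Subgroup (PSL2 F)}
    (he : Nonempty (↥H ≃* DihedralGroup (Fintype.card F + 1))) : HasIp k p H := by
  obtain ⟨e⟩ := he
  obtain ⟨f, hf⟩ := hf
  have hev : Even (Fintype.card F) := by
    rw [hf]
    refine (Nat.even_pow.2 ⟨even_two, ?_⟩)
    rintro rfl
    rw [hf] at hq7
    norm_num at hq7
  have hcH : Nat.card H = 2 * (Fintype.card F + 1) := by
    rw [Nat.card_congr e.toEquiv, DihedralGroup.nat_card]
  let N1 : Subgroup (PSL2 F) := ((Subgroup.zpowers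
    (DihedralGroup.r (1 : ZMod (Fintype.card F + 1)))).map e.symm.toMonoidHom).map H.subtype
  have hN1 : Nat.card N1 = Fintype.card F + 1 := by
    have a1 : Nat.card N1 = Nat.card ((Subgroup.zpowers
        (DihedralGroup.r (1 : ZMod (Fintype.card F + 1)))).map e.symm.toMonoidHom) :=
      (Nat.card_congr (Subgroup.equivMapOfInjective _ _ H.subtype_injective).toEquiv).symm
    have a2 : Nat.card ((Subgroup.zpowers
        (DihedralGroup.r (1 : ZMod (Fintype.card F + 1)))).map e.symm.toMonoidHom) =
        Nat.card (Subgroup.zpowers (DihedralGroup.r (1 : ZMod (Fintype.card F + 1)))) :=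
      (Nat.card_congr (Subgroup.equivMapOfInjective _ _ e.symm.injective).toEquiv).symm
    rw [a1, a2, Nat.card_zpowers, DihedralGroup.orderOf_r_one]
  refine hasIp_case2 hev (by omega) hp (N0 := lift N1) ?_ ?_ hcH
  · exact Subgroup.comap_mono (Subgroup.map_subtype_le _)
  · rw [card_lift, dd_even hev, one_mul, hN1]

lemma main_fwd {k : Type} [Field k] [IsAlgClosed k] [Fintype F] {p : ℕ} [Fact p.Prime] [CharP k p]
    (hq : 7 ≤ Fintype.card F) (hp : p ∣ Nat.card (PSL2 F)) {H : Subgroup (PSL2 F)}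
    (hH : HasIp k p H) :
      (p = 2 ∧ Odd (Fintype.card F)) ∨
      (p = 2 ∧ Even (Fintype.card F)) ∨
      (Odd p ∧ p ∣ Fintype.card F + 1) ∨ (Odd p ∧ p ∣ Fintype.card F - 1) ∨
      (Odd p ∧ CharP F p) := by
  have hpp : p.Prime := Fact.out
  rcases hpp.eq_two_or_odd' with h2 | hodd
  · rcases Nat.even_or_odd (Fintype.card F) with h | h
    · exact Or.inr (Or.inl ⟨h2, h⟩)
    · exact Or.inl ⟨h2, h⟩
  · right; right
    have h1 := index_card H
    rw [Subgroup.index_mul_card] at h1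
    have h3 : p ∣ (Fintype.card F - 1) * (Fintype.card F + 1) * Fintype.card F := by
      rw [← h1]; exact Dvd.dvd.mul_left hp _
    rcases hpp.dvd_mul.1 h3 with h4 | h4
    · rcases hpp.dvd_mul.1 h4 with h5 | h5
      · exact Or.inr (Or.inl ⟨hodd, h5⟩)
      · exact Or.inl ⟨hodd, h5⟩
    · right; right
      obtain ⟨p0, f, a1, a2, a3, a4⟩ := exists_prime (F := F)
      rw [a4] at h4
      rw [(Nat.prime_dvd_prime_iff_eq hpp a1).1 (hpp.dvd_of_dvd_pow h4)]
      exact ⟨by rwa [← (Nat.prime_dvd_prime_iff_eq hpp a1).1 (hpp.dvd_of_dvd_pow h4)], a3⟩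

end Identify

end Ip

/-- Classification of property `(I_p)` for `PSL_2(q)`, `q ≥ 7`. -/
theorem stmt11 (k : Type) [Field k] (p : ℕ) [Fact p.Prime] [IsAlgClosed k] [CharP k p]
    [Fintype F] (q : ℕ) (hF : Fintype.card F = q) (hq : 7 ≤ q)
    (hp : p ∣ Nat.card (PSL2 F)) (H : Subgroup (PSL2 F)) :
    HasIp k p H ↔
      -- (1) odd `p ∣ q+1`, `H` a Borel subgroup, of index `q+1`
      ((Odd p ∧ p ∣ q + 1 ∧
        (∃ g : PSL2 F, H = (pslBorel F).map (MulAut.conj g).toMonoidHom) ∧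
        Nat.card H = q * (q - 1) / Nat.gcd 2 (q - 1) ∧ H.index = q + 1) ∨
      -- (2) `q = 2^f`, `p = q - 1` a Mersenne prime, `H` dihedral of order `2(q+1)`
      ((∃ f : ℕ, q = 2 ^ f) ∧ p = q - 1 ∧ Nonempty (↥H ≃* DihedralGroup (q + 1)) ∧
        H.index = q * (q - 1) / 2) ∨
      -- (3) `p = 2`, `q` odd, `H = O^2(B)` for a Borel subgroup `B`, of odd order
      -- `q·(q-1)_{2'}` and index `(q-1)_2·(q+1)/2`
      (p = 2 ∧ Odd q ∧
        (∃ (g : PSL2 F) (B : Subgroup (PSL2 F)),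
          B = (pslBorel F).map (MulAut.conj g).toMonoidHom ∧
          H = Subgroup.map B.subtype (Op 2 ↥B)) ∧
        Nat.card H = q * ((q - 1) / 2 ^ ((q - 1).factorization 2)) ∧
        H.index = 2 ^ ((q - 1).factorization 2) * (q + 1) / 2) ∨
      -- (4) `q = 7`, `p = 7`, `H ≅ S_4`, of index `7`
      (q = 7 ∧ p = 7 ∧ Nonempty (↥H ≃* Equiv.Perm (Fin 4)) ∧ H.index = 7) ∨
      -- (5) `q = 11`, `p = 11`, `H ≅ A_5`, of index `11`
      (q = 11 ∧ p = 11 ∧ Nonempty (↥H ≃* ↥(alternatingGroup (Fin 5))) ∧ H.index = 11) ∨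
      -- (6) `p = 2`, `q` even, `H` cyclic of order `q+1`, of index `q(q-1)`
      (p = 2 ∧ Even q ∧ IsCyclic ↥H ∧ Nat.card H = q + 1 ∧ H.index = q * (q - 1))) := by
  subst hF
  constructor
  · intro hH
    have hidx := Ip.index_card H
    rcases Ip.main_fwd hq hp hH with ⟨h2, ho⟩ | ⟨h2, he⟩ | ⟨ho, hd⟩ | ⟨ho, hd⟩ | ⟨ho, hc⟩
    · subst h2
      exact Or.inr (Or.inr (Or.inl ⟨rfl, ho, (Ip.case3 ho H).1 hH⟩))
    · subst h2
      obtain ⟨h1, h2⟩ := Ip.fwd_even2 he hq hH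
      refine Or.inr (Or.inr (Or.inr (Or.inr (Or.inr ⟨rfl, he, h1, h2, ?_⟩))))
      rw [Ip.dd_even he, one_mul, h2] at hidx
      apply Nat.eq_of_mul_eq_mul_right (Nat.succ_pos (Fintype.card F))
      rw [Nat.succ_eq_add_one, hidx]
      ring
    · exact Or.inl ⟨ho, hd, (Ip.case1 ho hd H).1 hH⟩
    · obtain ⟨hf, h1, h2, h3⟩ := Ip.fwd_qm1 ho hd hq hH
      refine Or.inr (Or.inl ⟨hf, h1, h2, ?_⟩)
      have he : Even (Fintype.card F) := by
        obtain ⟨f, hf⟩ := hf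
        rw [hf]
        refine (Nat.even_pow.2 ⟨even_two, ?_⟩)
        rintro rfl
        rw [hf] at hq
        norm_num at hq
      rw [Ip.dd_even he, one_mul, h3] at hidx
      have h4 : H.index * 2 = Fintype.card F * (Fintype.card F - 1) := by
        apply Nat.eq_of_mul_eq_mul_right (Nat.succ_pos (Fintype.card F))
        rw [Nat.succ_eq_add_one, mul_assoc, hidx]
        ring
      omega
    · rcases Ip.fwd_char ho hq hH with h | h
      · exact Or.inr (Or.inr (Or.inr (Or.inl h)))
      · exact Or.inr (Or.inr (Or.inr (Or.inr (Or.inl h))))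
  · rintro (⟨ho, hd, h⟩ | ⟨hf, h1, h2, -⟩ | ⟨h2, ho, h⟩ | ⟨-, h1, ⟨e⟩, h3⟩ | ⟨-, h1, ⟨e⟩, h3⟩ |
      ⟨h2, he, -, hc, -⟩)
    · exact (Ip.case1 ho hd H).2 h
    · exact Ip.bwd_dihedral hq hf h1 h2
    · subst h2
      exact (Ip.case3 ho H).2 h
    · subst h1
      refine Ip.hasIp_of_index (n := 1) ?_ (by rw [h3, pow_one])
      have : Nat.factorial 4 = 24 := rfl
      rw [Nat.card_congr e.toEquiv, Nat.card_perm, Nat.card_eq_fintype_card, Fintype.card_fin, this]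
      norm_num
    · subst h1
      refine Ip.hasIp_of_index (n := 1) ?_ (by rw [h3, pow_one])
      have h5 : Nat.factorial 5 = 120 := rfl
      have h6 : 2 * Nat.card (alternatingGroup (Fin 5)) = 120 := by
        rw [two_mul_nat_card_alternatingGroup, Nat.card_perm, Nat.card_eq_fintype_card,
          Fintype.card_fin, h5]
      rw [Nat.card_congr e.toEquiv]
      omega
    · subst h2
      exact Ip.hasIp_case6 he hc
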